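/- For every positive integer k there exists a (P2+P3, gem)-free graph G_k with ω(G_k) = k and χ(G_k) = φ(k), where φ(1)=1, φ(2)=4, φ(3)=6, and φ(k)=⌈(5k−1)/4⌉ for k ≥ 4. Consequently φ is the smallest χ-binding function for the class of (P2+P3, gem)-free graphs. -/

import Mathlib

open SimpleGraph

/-- The graph `P2 + P3` (disjoint union of a path on 2 and a path on 3 vertices). -/
def graphP2P3 : SimpleGraph (Fin 5) :=
  SimpleGraph.fromRel (fun x y => (x, y) ∈ ([(0,1),(2,3),(3,4)] : List (Fin 5 × Fin 5)))

/-- The gem: a path `P4` (0-1-2-3) plus a vertex 4 adjacent to all of it. -/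
def graphGem : SimpleGraph (Fin 5) :=
  SimpleGraph.fromRel (fun x y =>
    (x, y) ∈ ([(0,1),(1,2),(2,3),(4,0),(4,1),(4,2),(4,3)] : List (Fin 5 × Fin 5)))

/-- The path on three vertices. -/
def graphP3 : SimpleGraph (Fin 3) :=
  SimpleGraph.fromRel (fun x y => (x, y) ∈ ([(0,1),(1,2)] : List (Fin 3 × Fin 3)))

/-- The cycle on five vertices. -/
def graphC5 : SimpleGraph (Fin 5) :=
  SimpleGraph.fromRel (fun x y => y = x + 1)

/-- `F1`: a 5-cycle `v1 v2 v3 v4 v5` (vertices 0..4) plus a vertex 5 adjacent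
exactly to `v5, v1, v2` (i.e. 4, 0, 1). -/
def graphF1 : SimpleGraph (Fin 6) :=
  SimpleGraph.fromRel (fun x y =>
    (x, y) ∈ ([(0,1),(1,2),(2,3),(3,4),(4,0),(5,4),(5,0),(5,1)] : List (Fin 6 × Fin 6)))

/-- `F1'`: a 5-cycle (0..4) plus adjacent vertices 5, 6, where 5 is adjacent to 4,0,1
and 6 is adjacent to 0,1,2. -/
def graphF1' : SimpleGraph (Fin 7) :=
  SimpleGraph.fromRel (fun x y =>
    (x, y) ∈ ([(0,1),(1,2),(2,3),(3,4),(4,0),(5,4),(5,0),(5,1),(6,0),(6,1),(6,2),(5,6)] :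
      List (Fin 7 × Fin 7)))

/-- `F1''`: a 5-cycle (0..4) plus nonadjacent vertices 5, 6, where 5 is adjacent to 4,0,1
and 6 is adjacent to 1,2,3. -/
def graphF1'' : SimpleGraph (Fin 7) :=
  SimpleGraph.fromRel (fun x y =>
    (x, y) ∈ ([(0,1),(1,2),(2,3),(3,4),(4,0),(5,4),(5,0),(5,1),(6,1),(6,2),(6,3)] :
      List (Fin 7 × Fin 7)))

/-- `F2`: a 5-cycle (0..4) plus adjacent vertices 5, 6, each adjacent to `v1,v3,v4`
(i.e. 0, 2, 3). -/
def graphF2 : SimpleGraph (Fin 7) :=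
  SimpleGraph.fromRel (fun x y =>
    (x, y) ∈ ([(0,1),(1,2),(2,3),(3,4),(4,0),(5,6),(5,0),(5,2),(5,3),(6,0),(6,2),(6,3)] :
      List (Fin 7 × Fin 7)))

/-- `F3`: a 5-cycle (0..4) plus adjacent vertices 5 (adjacent to 0,2,3) and
6 (adjacent to 2,3). -/
def graphF3 : SimpleGraph (Fin 7) :=
  SimpleGraph.fromRel (fun x y =>
    (x, y) ∈ ([(0,1),(1,2),(2,3),(3,4),(4,0),(5,6),(5,0),(5,2),(5,3),(6,2),(6,3)] :
      List (Fin 7 × Fin 7)))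

/-- `G` contains no induced copy of `H`. -/
def IsFreeOf {W V : Type*} (G : SimpleGraph V) (H : SimpleGraph W) : Prop :=
  IsEmpty (H ↪g G)

/-- The disjoint union of a clique blowup `C5⟨K_{t 0},…,K_{t 4}⟩` of the 5-cycle and
`ℓ` isolated vertices. -/
def blowupC5 (t : Fin 5 → ℕ) (ℓ : ℕ) :
    SimpleGraph ((Σ i : Fin 5, Fin (t i)) ⊕ Fin ℓ) :=
  SimpleGraph.fromRel (fun x y => ∃ a b, x = Sum.inl a ∧ y = Sum.inl b ∧
    (a.1 = b.1 ∨ b.1 = a.1 + 1))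

/-- Membership in the class `𝒞`: `G` is isomorphic to the disjoint union of a clique
blowup of `C5` and some number of isolated vertices. -/
def InClassC {V : Type*} (G : SimpleGraph V) : Prop :=
  ∃ (t : Fin 5 → ℕ) (ℓ : ℕ), (∀ i, 0 < t i) ∧ Nonempty (G ≃g blowupC5 t ℓ)

/-- The function φ from the paper. -/
noncomputable def phi (x : ℕ) : ℕ :=
  if x = 1 then 1 else if x = 2 then 4 else if x = 3 then 6
  else ⌈(5 * (x : ℚ) - 1) / 4⌉₊

section Stmt
variable {V : Type*} (G : SimpleGraph V)

/-- `S` is complete to `S'`. -/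
def CompleteTo (S S' : Set V) : Prop := ∀ x ∈ S, ∀ y ∈ S', G.Adj x y

/-- `S` is anticomplete to `S'`. -/
def AnticompleteTo (S S' : Set V) : Prop := ∀ x ∈ S, ∀ y ∈ S', ¬ G.Adj x y

/-- `S` is a stable (independent) set. -/
def IsStableSet (S : Set V) : Prop := S.Pairwise (fun x y => ¬ G.Adj x y)

/-- A graph is perfect if every induced subgraph has chromatic number equal to
its clique number. -/
def IsPerfect : Prop :=
  ∀ S : Set V, (G.induce S).chromaticNumber = ((G.induce S).cliqueNum : ℕ∞)

variable (v : Fin 5 → V)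

/-- `v` induces a `C5` in `G`: two cycle vertices are adjacent iff consecutive. -/
def IsInducedC5 : Prop :=
  Function.Injective v ∧ ∀ i j : Fin 5, G.Adj (v i) (v j) ↔ (j = i + 1 ∨ i = j + 1)

def setA (i : Fin 5) : Set V :=
  {u | u ∉ Set.range v ∧ ∀ j, G.Adj u (v j) ↔ j = i}

def setB (i : Fin 5) : Set V :=
  {u | u ∉ Set.range v ∧ ∀ j, G.Adj u (v j) ↔ (j = i ∨ j = i + 1)}

def setX (i : Fin 5) : Set V :=
  {u | u ∉ Set.range v ∧ ∀ j, G.Adj u (v j) ↔ (j = i - 1 ∨ j = i + 1)}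

def setY (i : Fin 5) : Set V :=
  {u | u ∉ Set.range v ∧ ∀ j, G.Adj u (v j) ↔ (j = i - 1 ∨ j = i ∨ j = i + 1)}

def setZ (i : Fin 5) : Set V :=
  {u | u ∉ Set.range v ∧ ∀ j, G.Adj u (v j) ↔ (j = i - 2 ∨ j = i ∨ j = i + 2)}

def setT : Set V :=
  {u | u ∉ Set.range v ∧ ∀ j, ¬ G.Adj u (v j)}

end Stmt

/-- Elementwise form of `P2 + P3`-freeness. -/
def NoP2P3 {V : Type*} (G : SimpleGraph V) : Prop :=
  ∀ a b x y z, G.Adj a b → G.Adj x y → G.Adj y z → x ≠ z → ¬ G.Adj x z →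
    ¬ G.Adj a x → ¬ G.Adj a y → ¬ G.Adj a z → ¬ G.Adj b x → ¬ G.Adj b y → ¬ G.Adj b z → False

/-- Elementwise form of gem-freeness; `c` is the centre of the gem and `p q r s` its path. -/
def NoGem {V : Type*} (G : SimpleGraph V) : Prop :=
  ∀ c p q r s, G.Adj c p → G.Adj c q → G.Adj c r → G.Adj c s →
    G.Adj p q → G.Adj q r → G.Adj r s → ¬ G.Adj p r → ¬ G.Adj p s → ¬ G.Adj q s → False

theorem embedding_fin_five {V : Type*} {G : SimpleGraph V} {H : SimpleGraph (Fin 5)}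
    (g : Fin 5 → V) (hinj : ∀ i j, i < j → g i ≠ g j)
    (hadj : ∀ i j, i < j → (G.Adj (g i) (g j) ↔ H.Adj i j)) : Nonempty (H ↪g G) := by
  have hinj' : Function.Injective g := by
    intro i j h
    by_contra hne
    rcases lt_or_gt_of_ne hne with h' | h'
    · exact hinj i j h' h
    · exact hinj j i h' h.symm
  refine ⟨⟨⟨g, hinj'⟩, ?_⟩⟩
  intro i j
  rcases lt_trichotomy i j with h | h | h
  · exact hadj i j h
  · subst h; simp
  · simpa [G.adj_comm, H.adj_comm] using hadj j i h

theorem noP2P3_of_isFreeOf {V : Type*} {G : SimpleGraph V} (h : IsFreeOf G graphP2P3) :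
    NoP2P3 G := by
  intro a b x y z hab hxy hyz hxz nxz nax nay naz nbx nby nbz
  refine (embedding_fin_five (G := G) (H := graphP2P3) ![a, b, x, y, z] ?_ ?_).elim h.elim
  · have := hab.ne; have := hxy.ne; have := hyz.ne
    have : a ≠ x := by rintro rfl; exact nbx hab.symm
    have : a ≠ y := by rintro rfl; exact nax hxy.symm
    have : a ≠ z := by rintro rfl; exact nay hyz.symm
    have : b ≠ x := by rintro rfl; exact nax hab
    have : b ≠ y := by rintro rfl; exact nay hab
    have : b ≠ z := by rintro rfl; exact naz hab
    intro i j hij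
    fin_cases i <;> fin_cases j <;> simp_all
  · intro i j hij
    fin_cases i <;> fin_cases j <;> simp_all [graphP2P3]

theorem noGem_of_isFreeOf {V : Type*} {G : SimpleGraph V} (h : IsFreeOf G graphGem) :
    NoGem G := by
  intro c p q r s hcp hcq hcr hcs hpq hqr hrs npr nps nqs
  refine (embedding_fin_five (G := G) (H := graphGem) ![p, q, r, s, c] ?_ ?_).elim h.elim
  · have := hcp.ne'; have := hcq.ne'; have := hcr.ne'; have := hcs.ne'
    have := hpq.ne; have := hqr.ne; have := hrs.ne
    have : p ≠ r := by rintro rfl; exact nps hrs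
    have : p ≠ s := by rintro rfl; exact npr hrs.symm
    have : q ≠ s := by rintro rfl; exact nps hpq
    intro i j hij
    fin_cases i <;> fin_cases j <;> simp_all
  · have := hcp.symm; have := hcq.symm; have := hcr.symm; have := hcs.symm
    intro i j hij
    fin_cases i <;> fin_cases j <;> simp_all [graphGem]

section Coloring
variable {V : Type*} {G : SimpleGraph V}

theorem clique_list_coloring {α : Type*} [DecidableEq α] [Nonempty α] (C : Finset V)
    (L : V → Finset α) (hall : ∀ R ⊆ C, R.card ≤ (R.biUnion L).card) :
    ∃ f : V → α, (∀ v ∈ C, f v ∈ L v) ∧ Set.InjOn f C := by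
  classical
  have key := (Finset.all_card_le_biUnion_card_iff_exists_injective
    (fun x : {x // x ∈ C} => L x)).1 (by
      intro s
      have := hall (s.map (Function.Embedding.subtype _)) (by
        intro x hx
        simp only [Finset.mem_map] at hx
        obtain ⟨y, -, rfl⟩ := hx
        exact y.2)
      rw [Finset.card_map] at this
      refine this.trans (Finset.card_le_card ?_)
      intro c
      simp only [Finset.mem_biUnion, Finset.mem_map]
      rintro ⟨a, ⟨y, hy, rfl⟩, hc⟩
      exact ⟨y, hy, hc⟩)
  obtain ⟨g, hg, hgL⟩ := key
  refine ⟨fun v => if h : v ∈ C then g ⟨v, h⟩ else Classical.arbitrary α, ?_, ?_⟩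
  · intro v hv
    simpa [hv] using hgL ⟨v, hv⟩
  · intro u hu v hv huv
    have hu' : u ∈ C := hu
    have hv' : v ∈ C := hv
    simp only [hu', hv', dif_pos] at huv
    simpa using hg huv

/-- On a set where adjacency is transitive, list colourings exist under Hall's condition. -/
theorem cluster_list_coloring {α : Type*} [DecidableEq α] [Nonempty α] (X : Finset V)
    (htrans : ∀ x ∈ X, ∀ y ∈ X, ∀ z ∈ X, G.Adj x y → G.Adj y z → x ≠ z → G.Adj x z)
    (L : V → Finset α)
    (hall : ∀ R ⊆ X, G.IsClique (R : Set V) → R.card ≤ (R.biUnion L).card) :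
    ∃ f : V → α, (∀ v ∈ X, f v ∈ L v) ∧ ∀ u ∈ X, ∀ v ∈ X, G.Adj u v → f u ≠ f v := by
  classical
  let C : V → Finset V := fun v => X.filter (fun w => w = v ∨ G.Adj v w)
  have hC : ∀ v ∈ X, G.IsClique (C v : Set V) := by
    intro v hv a ha b hb hab
    simp only [C, Finset.coe_filter, Set.mem_ofPred_eq] at ha hb
    rcases ha with ⟨haX, rfl | ha⟩ <;> rcases hb with ⟨hbX, rfl | hb⟩
    · exact absurd rfl hab
    · exact hb
    · exact ha.symm
    · exact htrans a haX v hv b hbX ha.symm hb hab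
  have hex : ∀ v ∈ X, ∃ f : V → α, (∀ w ∈ C v, f w ∈ L w) ∧ Set.InjOn f (C v) := by
    intro v hv
    refine clique_list_coloring (C v) L fun R hR => hall R (hR.trans (Finset.filter_subset _ _)) ?_
    exact (hC v hv).subset (by exact_mod_cast hR)
  have hex' : ∀ D : Finset V, (∃ v ∈ X, D = C v) →
      ∃ f : V → α, (∀ w ∈ D, f w ∈ L w) ∧ Set.InjOn f D := by
    rintro D ⟨v, hv, rfl⟩
    exact hex v hv
  choose! F hF1 hF2 using hex'
  refine ⟨fun v => F (C v) v, ?_, ?_⟩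
  · intro v hv
    exact hF1 _ ⟨v, hv, rfl⟩ v (by simp [C, hv])
  · intro u hu v hv huv
    have hCC : C u = C v := by
      ext w
      simp only [C, Finset.mem_filter, and_congr_right_iff]
      intro hw
      constructor
      · rintro (rfl | h)
        · exact Or.inr huv.symm
        · by_cases hwv : w = v
          · exact Or.inl hwv
          · exact Or.inr (htrans v hv u hu w hw huv.symm h (Ne.symm hwv))
      · rintro (rfl | h)
        · exact Or.inr huv
        · by_cases hwv : w = u
          · exact Or.inl hwv
          · exact Or.inr (htrans u hu v hv w hw huv h (Ne.symm hwv))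
    show F (C u) u ≠ F (C v) v
    rw [hCC]
    intro h
    exact huv.ne (hF2 _ ⟨v, hv, rfl⟩ (by simp [C, hu, huv.symm]) (by simp [C, hv]) h)

theorem colorable_of_proper {α : Type*} (P : Finset α) (f : V → α) (hf : ∀ v, f v ∈ P)
    (hne : ∀ u v, G.Adj u v → f u ≠ f v) : G.Colorable P.card := by
  have C : G.Coloring {x // x ∈ P} :=
    Coloring.mk (fun v => ⟨f v, hf v⟩) (fun {u v} h h' => hne u v h (by simpa using h'))
  simpa using C.colorable

end Coloring

/-- `K` is a maximum clique of the `(P2 + P3, gem)`-free graph `G`. -/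
structure MaxCliqueFrame {V : Type*} (G : SimpleGraph V) (K : Finset V) : Prop where
  p2p3 : NoP2P3 G
  gem : NoGem G
  clique : ∀ a ∈ K, ∀ b ∈ K, a ≠ b → G.Adj a b
  max : ∀ R : Finset V, G.IsClique (R : Set V) → R.card ≤ K.card

/-- `m` is a vertex outside `K` whose only non-neighbour in `K` is `a`. -/
def IsNear {V : Type*} (G : SimpleGraph V) (K : Finset V) (m a : V) : Prop :=
  m ∉ K ∧ a ∈ K ∧ ∀ k ∈ K, G.Adj m k ↔ k ≠ a

/-- `u` is a vertex outside `K` with at least two non-neighbours in `K`. -/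
def IsRest {V : Type*} (G : SimpleGraph V) (K : Finset V) (u : V) : Prop :=
  u ∉ K ∧ ∃ a ∈ K, ∃ b ∈ K, a ≠ b ∧ ¬ G.Adj u a ∧ ¬ G.Adj u b

/-- The neighbours of `u` in `K`. -/
noncomputable def nbrIn {V : Type*} (G : SimpleGraph V) (K : Finset V) (u : V) : Finset V :=
  open Classical in K.filter (G.Adj u)

@[simp] theorem mem_nbrIn {V : Type*} {G : SimpleGraph V} {K : Finset V} {u a : V} :
    a ∈ nbrIn G K u ↔ a ∈ K ∧ G.Adj u a := by
  classical
  simp [nbrIn]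

theorem nbrIn_subset {V : Type*} {G : SimpleGraph V} {K : Finset V} {u : V} :
    nbrIn G K u ⊆ K := fun _ ha => (mem_nbrIn.1 ha).1

namespace MaxCliqueFrame
variable {V : Type*} {G : SimpleGraph V} {K : Finset V}

theorem isClique (F : MaxCliqueFrame G K) : G.IsClique (K : Set V) :=
  fun a ha b hb hab => F.clique a ha b hb hab

theorem exists_not_adj (F : MaxCliqueFrame G K) {u : V} (hu : u ∉ K) :
    ∃ a ∈ K, ¬ G.Adj u a := by
  classical
  by_contra! h
  have := F.max (insert u K) (by
    rw [Finset.coe_insert]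
    exact F.isClique.insert fun b hb _ => h b hb)
  rw [Finset.card_insert_of_notMem hu] at this
  omega

theorem near_or_rest (F : MaxCliqueFrame G K) {u : V} (hu : u ∉ K) :
    (∃ a, IsNear G K u a) ∨ IsRest G K u := by
  obtain ⟨a, ha, hua⟩ := F.exists_not_adj hu
  by_cases h : ∃ b ∈ K, b ≠ a ∧ ¬ G.Adj u b
  · obtain ⟨b, hb, hba, hub⟩ := h
    exact Or.inr ⟨hu, a, ha, b, hb, hba.symm, hua, hub⟩
  · push Not at h
    exact Or.inl ⟨a, hu, ha, fun k hk => ⟨by rintro h1 rfl; exact hua h1, h k hk⟩⟩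

theorem eq_or_cover (F : MaxCliqueFrame G K) {u v a : V}
    (huv : G.Adj u v) (ha : a ∈ K) (hua : G.Adj u a) (hva : G.Adj v a) :
    (∀ k ∈ K, G.Adj u k ↔ G.Adj v k) ∨ (∀ k ∈ K, G.Adj u k ∨ G.Adj v k) := by
  by_contra! h
  obtain ⟨⟨q, hq, hq'⟩, p, hp, hup, hvp⟩ := h
  have hc := F.clique
  have hap := hc a ha p hp (by rintro rfl; exact hup hua)
  have hpq := hc p hp q hq (by rintro rfl; tauto)
  rcases hq' with ⟨h1, h2⟩ | ⟨h1, h2⟩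
  · have haq := hc a ha q hq (by rintro rfl; exact h2 hva)
    exact F.gem a p q u v hap haq hua.symm hva.symm hpq h1.symm huv
      (fun h => hup h.symm) (fun h => hvp h.symm) (fun h => h2 h.symm)
  · have haq := hc a ha q hq (by rintro rfl; exact h1 hua)
    exact F.gem a p q v u hap haq hva.symm hua.symm hpq h2.symm huv.symm
      (fun h => hvp h.symm) (fun h => hup h.symm) (fun h => h1 h.symm)

theorem nested (F : MaxCliqueFrame G K) {u v a : V} (huv : ¬ G.Adj u v)
    (ha : a ∈ K) (hua : G.Adj u a) (hva : G.Adj v a) :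
    (∀ k ∈ K, G.Adj u k → G.Adj v k) ∨ (∀ k ∈ K, G.Adj v k → G.Adj u k) := by
  by_contra! h
  obtain ⟨⟨b, hb, hub, hvb⟩, c, hc, hvc, huc⟩ := h
  have hK := F.clique
  exact F.gem a u b c v hua.symm (hK a ha b hb (by rintro rfl; exact hvb hva))
    (hK a ha c hc (by rintro rfl; exact huc hua)) hva.symm hub
    (hK b hb c hc (by rintro rfl; exact hvb hvc)) hvc.symm huc huv (fun h => hvb h.symm)

theorem near_not_adj (F : MaxCliqueFrame G K) {m m' a : V} (hm : IsNear G K m a)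
    (hm' : IsNear G K m' a) : ¬ G.Adj m m' := by
  classical
  intro h
  have := F.max (insert m (insert m' (K.erase a))) (by
    simp only [Finset.coe_insert]
    refine IsClique.insert (IsClique.insert ?_ ?_) ?_
    · exact F.isClique.subset (by simp)
    · intro b hb _
      simp only [Finset.coe_erase, Set.mem_sdiff, Set.mem_singleton_iff, Finset.mem_coe] at hb
      exact (hm'.2.2 b hb.1).2 hb.2
    · intro b hb hne
      simp only [Finset.coe_erase, Set.mem_sdiff, Set.mem_singleton_iff, Finset.mem_coe,
        Set.mem_insert_iff] at hb
      rcases hb with rfl | hb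
      · exact h
      · exact (hm.2.2 b hb.1).2 hb.2)
  rw [Finset.card_insert_of_notMem, Finset.card_insert_of_notMem, Finset.card_erase_of_mem hm.2.1]
    at this
  · have := Finset.card_pos.2 ⟨a, hm.2.1⟩
    omega
  · simp [hm'.1]
  · simp [hm.1, h.ne]

theorem rest_not_adj_near (F : MaxCliqueFrame G K) {u m a s : V} (hu : IsRest G K u)
    (hs : s ∈ K) (hus : G.Adj u s) (hua : ¬ G.Adj u a) (hm : IsNear G K m a) : ¬ G.Adj u m := by
  intro h
  obtain ⟨-, p, hp, q, hq, hpq, hup, huq⟩ := hu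
  obtain ⟨-, ha, hma⟩ := hm
  have := F.eq_or_cover h hs hus ((hma s hs).2 (by rintro rfl; exact hua hus))
  grind

theorem rest_adj_near (F : MaxCliqueFrame G K) {u m a s : V} (hu : IsRest G K u)
    (hs : s ∈ K) (hus : G.Adj u s) (hsa : s ≠ a) (hua : G.Adj u a) (hm : IsNear G K m a) :
    G.Adj u m := by
  by_contra h
  obtain ⟨-, p, hp, q, hq, hpq, hup, huq⟩ := hu
  obtain ⟨-, ha, hma⟩ := hm
  have := F.nested h hs hus ((hma s hs).2 hsa)
  grind

theorem near_adj_near (F : MaxCliqueFrame G K) (h3 : 3 ≤ K.card) {m m' a b : V}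
    (hm : IsNear G K m a) (hm' : IsNear G K m' b) (hab : a ≠ b) : G.Adj m m' := by
  classical
  obtain ⟨c, hc, hca, hcb⟩ : ∃ c ∈ K, c ≠ a ∧ c ≠ b := by
    by_contra! h
    have : K ⊆ {a, b} := by
      intro c hc
      by_cases hca : c = a
      · simp [hca]
      · simp [h c hc hca]
    have := (Finset.card_le_card this).trans Finset.card_le_two
    omega
  by_contra h
  obtain ⟨-, ha, hma⟩ := hm
  obtain ⟨-, hb, hmb⟩ := hm'
  have := F.nested h hc ((hma c hc).2 hca) ((hmb c hc).2 hcb)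
  grind

/-- Vertices missing two common vertices of `K` induce a disjoint union of cliques. -/
theorem adj_trans (F : MaxCliqueFrame G K) {a b x y z : V} (ha : a ∈ K) (hb : b ∈ K)
    (hab : a ≠ b) (hax : ¬ G.Adj x a) (hay : ¬ G.Adj y a) (haz : ¬ G.Adj z a)
    (hbx : ¬ G.Adj x b) (hby : ¬ G.Adj y b) (hbz : ¬ G.Adj z b)
    (hxy : G.Adj x y) (hyz : G.Adj y z) (hxz : x ≠ z) : G.Adj x z := by
  by_contra h
  have hK := F.clique a ha b hb hab
  simp only [G.adj_comm x a, G.adj_comm y a, G.adj_comm z a, G.adj_comm x b, G.adj_comm y b,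
    G.adj_comm z b] at *
  exact F.p2p3 a b x y z hK hxy hyz hxz h hax hay haz hbx hby hbz

theorem rest_not_near (_F : MaxCliqueFrame G K) {u a : V} (hu : IsRest G K u) :
    ¬ IsNear G K u a := by
  rintro ⟨-, ha, h⟩
  obtain ⟨-, p, hp, q, hq, hpq, hup, huq⟩ := hu
  grind

/-- A colouring of the vertices with at least two non-neighbours in `K` by the vertices of `K`
and `h` additional colours extends to the whole graph. -/
theorem colorable_of_rest [Fintype V] (F : MaxCliqueFrame G K) (h : ℕ) (f : V → V ⊕ ℕ)
    (hmem : ∀ u, IsRest G K u → (∃ a ∈ K, f u = Sum.inl a) ∨ ∃ i < h, f u = Sum.inr i)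
    (hK : ∀ u a, IsRest G K u → f u = Sum.inl a → ¬ G.Adj u a)
    (hnear : ∀ u a m, IsRest G K u → f u = Sum.inl a → (∀ k ∈ K, ¬ G.Adj u k) →
      IsNear G K m a → ¬ G.Adj u m)
    (hne : ∀ u v, IsRest G K u → IsRest G K v → G.Adj u v → f u ≠ f v) :
    G.Colorable (K.card + h) := by
  classical
  let g : V → V ⊕ ℕ := fun u =>
    if u ∈ K then Sum.inl u else if hu : ∃ a, IsNear G K u a then Sum.inl hu.choose else f u
  have g1 : ∀ u ∈ K, g u = Sum.inl u := fun u hu => by simp [g, hu]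
  have g2 : ∀ u, (∃ a, IsNear G K u a) → ∃ a, IsNear G K u a ∧ g u = Sum.inl a := by
    intro u hu
    refine ⟨hu.choose, hu.choose_spec, ?_⟩
    have : u ∉ K := hu.choose_spec.1
    simp [g, this, hu]
  have g3 : ∀ u, IsRest G K u → g u = f u := by
    intro u hu
    have : ¬ ∃ a, IsNear G K u a := fun ⟨a, ha⟩ => F.rest_not_near hu ha
    simp [g, hu.1, this]
  have hcases : ∀ u, (u ∈ K ∧ g u = Sum.inl u) ∨ (∃ a, IsNear G K u a ∧ g u = Sum.inl a) ∨
      (IsRest G K u ∧ g u = f u) := by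
    intro u
    by_cases hu : u ∈ K
    · exact Or.inl ⟨hu, g1 u hu⟩
    · rcases F.near_or_rest hu with h' | h'
      · exact Or.inr (Or.inl (g2 u h'))
      · exact Or.inr (Or.inr ⟨h', g3 u h'⟩)
  have hrn : ∀ u m a, IsRest G K u → f u = Sum.inl a → IsNear G K m a → ¬ G.Adj u m := by
    intro u m a hu hfu hm
    by_cases hs : ∃ s ∈ K, G.Adj u s
    · obtain ⟨s, hs, hus⟩ := hs
      exact F.rest_not_adj_near hu hs hus (hK u a hu hfu) hm
    · push Not at hs
      exact hnear u a m hu hfu hs hm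
  have main := colorable_of_proper (G := G) (K.disjSum (Finset.range h)) g (by
    intro u
    rcases hcases u with ⟨hu, hg⟩ | ⟨a, ha, hg⟩ | ⟨hu, hg⟩
    · simp [hg, hu]
    · simp [hg, ha.2.1]
    · rcases hmem u hu with ⟨a, ha, hf⟩ | ⟨i, hi, hf⟩
      · simp [hg, hf, ha]
      · simp [hg, hf, hi]) (by
    intro u v huv heq
    rcases hcases u with ⟨hu, hg⟩ | ⟨a, ha, hg⟩ | ⟨hu, hg⟩ <;>
    rcases hcases v with ⟨hv, hg'⟩ | ⟨b, hb, hg'⟩ | ⟨hv, hg'⟩ <;> rw [hg, hg'] at heq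
    · exact huv.ne (by simpa using heq)
    · obtain rfl : u = b := by simpa using heq
      exact ((hb.2.2 u hu).1 huv.symm) rfl
    · exact hK v u hv heq.symm huv.symm
    · obtain rfl : a = v := by simpa using heq
      exact ((ha.2.2 a hv).1 huv) rfl
    · obtain rfl : a = b := by simpa using heq
      exact F.near_not_adj ha hb huv
    · exact hrn v u a hv heq.symm ha huv.symm
    · exact hK u v hu heq huv
    · exact hrn u v b hu heq hb huv
    · exact hne u v hu hv huv heq)
  simpa [Finset.card_disjSum] using main

theorem isClique_union {R Q : Finset V} [DecidableEq V] (hR : G.IsClique (R : Set V))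
    (hQ : G.IsClique (Q : Set V)) (h : ∀ x ∈ R, ∀ y ∈ Q, x ≠ y → G.Adj x y) :
    G.IsClique ((R ∪ Q : Finset V) : Set V) := by
  intro x hx y hy hxy
  simp only [Finset.coe_union, Set.mem_union, Finset.mem_coe] at hx hy
  rcases hx with hx | hx <;> rcases hy with hy | hy
  · exact hR hx hy hxy
  · exact h x hx y hy hxy
  · exact (h y hy x hx hxy.symm).symm
  · exact hQ hx hy hxy

theorem card_add_card_le (F : MaxCliqueFrame G K) {R Q : Finset V}
    (hR : G.IsClique (R : Set V)) (hQ : G.IsClique (Q : Set V))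
    (h : ∀ x ∈ R, ∀ y ∈ Q, G.Adj x y) : R.card + Q.card ≤ K.card := by
  classical
  have hd : Disjoint R Q := Finset.disjoint_left.2 fun x hx hx' => (h x hx x hx').ne rfl
  rw [← Finset.card_union_of_disjoint hd]
  exact F.max _ (isClique_union hR hQ fun x hx y hy _ => h x hx y hy)

theorem not_clique_of_lt (F : MaxCliqueFrame G K) {R : Finset V} (hR : K.card < R.card) :
    ¬ G.IsClique (R : Set V) := fun h => absurd (F.max R h) (by omega)

theorem colorable_one (F : MaxCliqueFrame G K) (h1 : K.card = 1) : G.Colorable 1 := by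
  classical
  refine ⟨Coloring.mk (fun _ => 0) ?_⟩
  intro u v huv
  refine absurd ?_ (F.not_clique_of_lt (R := {u, v}) ?_)
  · simp [huv]
  · rw [Finset.card_pair huv.ne]; omega

theorem colorable_four [Fintype V] (F : MaxCliqueFrame G K) (h2 : K.card = 2) :
    G.Colorable 4 := by
  classical
  obtain ⟨a, b, hab, rfl⟩ := Finset.card_eq_two.1 h2
  have hrest : ∀ u, IsRest G {a, b} u → ¬ G.Adj u a ∧ ¬ G.Adj u b := by
    rintro u ⟨-, p, hp, q, hq, hpq, hup, huq⟩
    simp only [Finset.mem_insert, Finset.mem_singleton] at hp hq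
    grind
  obtain ⟨f, hf, hf'⟩ := cluster_list_coloring (G := G) (α := V ⊕ ℕ)
    (Finset.univ.filter (IsRest G {a, b})) (by
      simp only [Finset.mem_filter_univ]
      intro x hx y hy z hz
      exact F.adj_trans (a := a) (b := b) (by simp) (by simp) hab (hrest x hx).1 (hrest y hy).1
        (hrest z hz).1 (hrest x hx).2 (hrest y hy).2 (hrest z hz).2)
    (fun _ => {Sum.inr 0, Sum.inr 1}) (by
      intro R hR hcl
      rcases R.eq_empty_or_nonempty with rfl | hne
      · simp
      · obtain ⟨x, hx⟩ := hne
        refine (F.max R hcl).trans (le_trans ?_ (Finset.card_le_card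
          (Finset.subset_biUnion_of_mem (fun _ => {Sum.inr 0, Sum.inr 1}) hx)))
        simp [hab])
  simp only [Finset.mem_filter_univ, Finset.mem_insert, Finset.mem_singleton] at hf hf'
  have := F.colorable_of_rest 2 f (by
      intro u hu
      rcases hf u hu with h | h
      · exact Or.inr ⟨0, by omega, h⟩
      · exact Or.inr ⟨1, by omega, h⟩) (by
      intro u a hu h
      have := hf u hu
      simp [h] at this) (by
      intro u a m hu h
      have := hf u hu
      simp [h] at this) (fun u v hu hv => hf' u hu v hv)
  simpa [hab] using this

theorem edge_dominates (F : MaxCliqueFrame G K) {x y u s p : V} (hxy : G.Adj x y)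
    (hs : s ∈ K) (hp : p ∈ K) (hus : G.Adj u s) (hup : ¬ G.Adj u p)
    (hxs : ¬ G.Adj x s) (hys : ¬ G.Adj y s) (hxp : ¬ G.Adj x p) (hyp : ¬ G.Adj y p)
    (hu : u ∉ K) : G.Adj x u ∨ G.Adj y u := by
  by_contra! h
  have hsp := F.clique s hs p hp (by rintro rfl; exact hup hus)
  exact F.p2p3 x y u s p hxy hus hsp (by rintro rfl; exact hu hp) hup h.1 hxs hxp h.2 hys hyp

theorem not_both_triangles (F : MaxCliqueFrame G K) {a b c t n n' r r' : V}
    (h3 : K.card = 3)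
    (hab : G.Adj a b) (hac : G.Adj a c) (htb : ¬ G.Adj t b)
    (hnn : G.Adj n n') (hrr : G.Adj r r') (htn : G.Adj t n) (htn' : G.Adj t n')
    (htr : G.Adj t r) (htr' : G.Adj t r')
    (hna : ¬ G.Adj n a) (hnb : G.Adj n b) (hnc : ¬ G.Adj n c)
    (hna' : ¬ G.Adj n' a) (hnb' : G.Adj n' b) (hnc' : ¬ G.Adj n' c)
    (hra : ¬ G.Adj r a) (hrb : ¬ G.Adj r b) (hrc : G.Adj r c)
    (hra' : ¬ G.Adj r' a) (hrb' : ¬ G.Adj r' b) (hrc' : G.Adj r' c) : False := by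
  classical
  have dom : ∀ r, G.Adj r c → ¬ G.Adj r a → ¬ G.Adj r b → G.Adj r n ∨ G.Adj r n' := by
    intro r h1 h2 h3
    have := F.p2p3 n n' r c a
    grind [G.adj_comm]
  have dom' : ∀ n, G.Adj n b → ¬ G.Adj n a → ¬ G.Adj n c → G.Adj n r ∨ G.Adj n r' := by
    clear dom
    intro n h1 h2 h3
    have := F.p2p3 r r' n b a
    grind [G.adj_comm]
  have hK4 : ∀ x y z w, G.Adj x y → G.Adj x z → G.Adj x w → G.Adj y z → G.Adj y w →
      G.Adj z w → False := by
    intro x y z w h1 h2 h3 h4 h5 h6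
    refine absurd ?_ (F.not_clique_of_lt (R := {x, y, z, w}) ?_)
    · simp [h1, h2, h3, h4, h5, h6]
    · rw [Finset.card_insert_of_notMem, Finset.card_insert_of_notMem, Finset.card_pair h6.ne]
      · omega
      · simp [h4.ne, h5.ne]
      · simp [h1.ne, h2.ne, h3.ne]
  have h1 := dom r hrc hra hrb
  have h2 := dom r' hrc' hra' hrb'
  have h3 := dom' n hnb hna hnc
  have h4 := dom' n' hnb' hna' hnc'
  have h5 := hK4 t n r r'
  have h6 := hK4 t n' r r'
  have h7 := hK4 t n n' r
  have h8 := hK4 t n n' r'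
  clear hK4 dom dom'
  have h9 := F.gem n b n' t r
  have h10 := F.gem n b n' t r'
  grind [G.adj_comm]

/-- `u` lies outside `K` and has no neighbour in `K`. -/
def _root_.IsIsolatedFrom {V : Type*} (G : SimpleGraph V) (K : Finset V) (u : V) : Prop :=
  u ∉ K ∧ ∀ k ∈ K, ¬ G.Adj u k

/-- `u` is a vertex outside `K` with a neighbour and at least two non-neighbours in `K`. -/
def _root_.IsFar {V : Type*} (G : SimpleGraph V) (K : Finset V) (u : V) : Prop :=
  IsRest G K u ∧ ∃ k ∈ K, G.Adj u k

theorem _root_.IsRest.isolated_or_far {u : V} (h : IsRest G K u) :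
    IsIsolatedFrom G K u ∨ IsFar G K u := by
  by_cases h' : ∃ k ∈ K, G.Adj u k
  · exact Or.inr ⟨h, h'⟩
  · push Not at h'
    exact Or.inl ⟨h.1, h'⟩

theorem _root_.IsIsolatedFrom.not_far {u : V} (h : IsIsolatedFrom G K u) : ¬ IsFar G K u := by
  rintro ⟨-, k, hk, h'⟩
  exact h.2 k hk h'

theorem isolated_edge_far (F : MaxCliqueFrame G K) {x y u : V} (hx : IsIsolatedFrom G K x)
    (hy : IsIsolatedFrom G K y) (hxy : G.Adj x y) (hu : IsRest G K u) (hxu : G.Adj x u)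
    (hne : y ≠ u) : G.Adj y u := by
  obtain ⟨-, p, hp, q, hq, hpq, hup, huq⟩ := hu
  exact F.adj_trans hp hq hpq (hy.2 p hp) (hx.2 p hp) hup (hy.2 q hq) (hx.2 q hq) huq
    hxy.symm hxu hne

/-- A vertex outside `K` with a neighbour in `K` has a neighbour on every edge that is
anticomplete to `K`. -/
theorem isolated_edge_dominates (F : MaxCliqueFrame G K) {x y u s : V}
    (hx : IsIsolatedFrom G K x) (hy : IsIsolatedFrom G K y) (hxy : G.Adj x y) (hu : u ∉ K)
    (hs : s ∈ K) (hus : G.Adj u s) : G.Adj x u ∨ G.Adj y u := by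
  obtain ⟨p, hp, hup⟩ := F.exists_not_adj hu
  exact F.edge_dominates hxy hs hp hus hup (hx.2 s hs) (hy.2 s hs) (hx.2 p hp) (hy.2 p hp) hu

theorem far_complete_isolated_edge (F : MaxCliqueFrame G K) {x y u : V}
    (hx : IsIsolatedFrom G K x) (hy : IsIsolatedFrom G K y) (hxy : G.Adj x y) (hu : IsFar G K u) :
    G.Adj x u := by
  obtain ⟨hu, s, hs, hus⟩ := hu
  rcases F.isolated_edge_dominates hx hy hxy hu.1 hs hus with h | h
  · exact h
  · exact F.isolated_edge_far hy hx hxy.symm hu h (by rintro rfl; exact hx.2 s hs hus)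

theorem colorable_six_of_isolated_edge [Fintype V] (F : MaxCliqueFrame G K) (h3 : K.card = 3)
    {x y : V} (hx : IsIsolatedFrom G K x) (hy : IsIsolatedFrom G K y) (hxy : G.Adj x y) :
    G.Colorable 6 := by
  classical
  have hfar : ∀ u v, IsFar G K u → IsFar G K v → ¬ G.Adj u v := by
    intro u v hu hv huv
    have h1 := F.far_complete_isolated_edge hx hy hxy hu
    have h2 := F.far_complete_isolated_edge hx hy hxy hv
    have h3 := F.far_complete_isolated_edge hy hx hxy.symm hu
    have h4 := F.far_complete_isolated_edge hy hx hxy.symm hv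
    have := F.card_add_card_le (R := {x, y}) (Q := {u, v}) (by simp [hxy]) (by simp [huv])
      (by simp [h1, h2, h3, h4])
    rw [Finset.card_pair hxy.ne, Finset.card_pair huv.ne] at this
    omega
  obtain ⟨a, b, ha, hb, hab⟩ := Finset.one_lt_card_iff.1 (show 1 < K.card by omega)
  let L : Finset (V ⊕ ℕ) := if ∃ u, IsFar G K u then {Sum.inr 1, Sum.inr 2} else
    {Sum.inr 0, Sum.inr 1, Sum.inr 2}
  obtain ⟨f, hf, hf'⟩ := cluster_list_coloring (G := G) (α := V ⊕ ℕ)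
    (Finset.univ.filter (IsIsolatedFrom G K)) (by
      simp only [Finset.mem_filter_univ]
      intro x hx y hy z hz
      exact F.adj_trans ha hb hab (hx.2 a ha) (hy.2 a ha) (hz.2 a ha)
        (hx.2 b hb) (hy.2 b hb) (hz.2 b hb))
    (fun _ => L) (by
      intro R hR hcl
      rcases R.eq_empty_or_nonempty with rfl | ⟨r, hr⟩
      · simp
      · refine le_trans ?_ (Finset.card_le_card (Finset.subset_biUnion_of_mem (fun _ => L) hr))
        by_cases hex : ∃ u, IsFar G K u
        · obtain ⟨u, hu⟩ := hex
          have hLc : L.card = 2 := by simp only [L, if_pos (⟨u, hu⟩ : ∃ u, IsFar G K u)]; simp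
          rw [hLc]
          by_contra! h2
          have := F.card_add_card_le (R := R) (Q := {u}) hcl (by simp) (by
            intro t ht w hw
            obtain rfl := Finset.mem_singleton.1 hw
            obtain ⟨t', ht', hne⟩ := Finset.exists_mem_ne (show 1 < R.card by omega) t
            have h1 := (Finset.mem_filter_univ _).1 (hR ht)
            have h2 := (Finset.mem_filter_univ _).1 (hR ht')
            exact F.far_complete_isolated_edge h1 h2 (hcl ht ht' hne.symm) hu)
          simp at this
          omega
        · have hLc : L.card = 3 := by simp only [L, if_neg hex]; simp
          rw [hLc, ← h3]
          exact F.max R hcl)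
  simp only [Finset.mem_filter_univ] at hf hf'
  have hL : ∀ c ∈ L, (c = Sum.inr 0 ∨ c = Sum.inr 1 ∨ c = Sum.inr 2) ∧
      ((∃ u, IsFar G K u) → c ≠ Sum.inr 0) := by
    intro c hc
    simp only [L] at hc
    split_ifs at hc with h <;> simp at hc
    · grind
    · grind
  have hcol : ∀ u, IsRest G K u →
      ((if IsFar G K u then Sum.inr 0 else f u : V ⊕ ℕ) = Sum.inr 0 ∨
      (if IsFar G K u then Sum.inr 0 else f u : V ⊕ ℕ) = Sum.inr 1 ∨
      (if IsFar G K u then Sum.inr 0 else f u : V ⊕ ℕ) = Sum.inr 2) := by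
    intro u hu
    rcases hu.isolated_or_far with h | h
    · rw [if_neg h.not_far]
      exact (hL _ (hf u h)).1
    · simp [h]
  have := F.colorable_of_rest 3 (fun u => if IsFar G K u then Sum.inr 0 else f u) (by
      intro u hu
      have := hcol u hu
      rcases this with h | h | h
      · exact Or.inr ⟨0, by omega, h⟩
      · exact Or.inr ⟨1, by omega, h⟩
      · exact Or.inr ⟨2, by omega, h⟩) (by
      intro u a hu h
      have := hcol u hu
      simp [h] at this) (by
      intro u a m hu h
      have := hcol u hu
      simp [h] at this) (by
      intro u v hu hv huv
      rcases hu.isolated_or_far with h | h <;> rcases hv.isolated_or_far with h' | h'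
      · simp only [h.not_far, h'.not_far, if_false]
        exact hf' u h v h' huv
      · simp only [h.not_far, h', if_false, if_true]
        exact (hL _ (hf u h)).2 ⟨v, h'⟩
      · simp only [h, h'.not_far, if_false, if_true]
        exact ((hL _ (hf v h')).2 ⟨u, h⟩).symm
      · exact absurd huv (hfar u v h h'))
  simpa [h3] using this

end MaxCliqueFrame

theorem cluster_coloring {V : Type*} [Fintype V] {G : SimpleGraph V} {α : Type*} [DecidableEq α]
    [Nonempty α] (X : Finset V)
    (htrans : ∀ x ∈ X, ∀ y ∈ X, ∀ z ∈ X, G.Adj x y → G.Adj y z → x ≠ z → G.Adj x z)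
    (L : Finset α)
    (hall : ∀ R ⊆ X, G.IsClique (R : Set V) → R.card ≤ L.card) :
    ∃ f : V → α, (∀ v ∈ X, f v ∈ L) ∧ ∀ u ∈ X, ∀ v ∈ X, G.Adj u v → f u ≠ f v := by
  refine cluster_list_coloring X htrans (fun _ => L) fun R hR hcl => ?_
  rcases R.eq_empty_or_nonempty with rfl | ⟨x, hx⟩
  · simp
  · exact (hall R hR hcl).trans
      (Finset.card_le_card (Finset.subset_biUnion_of_mem (fun _ => L) hx))

namespace MaxCliqueFrame
variable {V : Type*} {G : SimpleGraph V} {K : Finset V}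

theorem card_add_one_le (F : MaxCliqueFrame G K) {R : Finset V} {v : V}
    (hR : G.IsClique (R : Set V)) (h : ∀ x ∈ R, G.Adj x v) : R.card + 1 ≤ K.card := by
  have := F.card_add_card_le (R := R) (Q := {v}) hR (by simp) (by simpa using h)
  simpa using this

theorem colorable_six_of_isolated_stable [Fintype V] (F : MaxCliqueFrame G K) (h3 : K.card = 3)
    (hst : ∀ x y, IsIsolatedFrom G K x → IsIsolatedFrom G K y → ¬ G.Adj x y) :
    G.Colorable 6 := by
  classical
  obtain ⟨a, b, c, hab, hac, hbc, rfl⟩ := Finset.card_eq_three.1 h3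
  have hKab : G.Adj a b := F.clique a (by simp) b (by simp) hab
  have hKac : G.Adj a c := F.clique a (by simp) c (by simp) hac
  set K : Finset V := {a, b, c} with hK
  have ha : a ∈ K := by simp [hK]
  have hb : b ∈ K := by simp [hK]
  have hc : c ∈ K := by simp [hK]
  have hrest : ∀ u, IsRest G K u → (¬ G.Adj u a ∧ ¬ G.Adj u b) ∨ (¬ G.Adj u a ∧ ¬ G.Adj u c) ∨
      (¬ G.Adj u b ∧ ¬ G.Adj u c) := by
    rintro u ⟨-, p, hp, q, hq, hpq, hup, huq⟩
    simp only [hK, Finset.mem_insert, Finset.mem_singleton] at hp hq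
    grind
  have eA : ∀ u, IsRest G K u → G.Adj u a → ¬ G.Adj u b ∧ ¬ G.Adj u c := by
    intro u hu h
    rcases hrest u hu with h' | h' | h'
    · exact absurd h h'.1
    · exact absurd h h'.1
    · exact h'
  have eB : ∀ u, IsRest G K u → G.Adj u b → ¬ G.Adj u a ∧ ¬ G.Adj u c := by
    intro u hu h
    rcases hrest u hu with h' | h' | h'
    · exact absurd h h'.2
    · exact h'
    · exact absurd h h'.1
  have eC : ∀ u, IsRest G K u → G.Adj u c → ¬ G.Adj u a ∧ ¬ G.Adj u b := by
    intro u hu h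
    rcases hrest u hu with h' | h' | h'
    · exact h'
    · exact absurd h h'.2
    · exact absurd h h'.2
  have hiso : ∀ u, IsRest G K u → ¬ G.Adj u a → ¬ G.Adj u b → ¬ G.Adj u c →
      IsIsolatedFrom G K u := by
    intro u hu h1 h2 h3
    refine ⟨hu.1, ?_⟩
    simp [hK, h1, h2, h3]
  have hiso' : ∀ u, IsIsolatedFrom G K u → ¬ G.Adj u a ∧ ¬ G.Adj u b ∧ ¬ G.Adj u c :=
    fun u hu => ⟨hu.2 a ha, hu.2 b hb, hu.2 c hc⟩
  let T1 : V → Prop := fun t => IsIsolatedFrom G K t ∧ ∃ r r', IsRest G K r ∧ IsRest G K r' ∧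
    G.Adj r c ∧ G.Adj r' c ∧ G.Adj r r' ∧ G.Adj t r ∧ G.Adj t r'
  have hT1 : ∀ t n n', T1 t → IsRest G K n → IsRest G K n' → G.Adj n b → G.Adj n' b →
      G.Adj n n' → G.Adj t n → G.Adj t n' → False := by
    rintro t n n' ⟨ht, r, r', hr, hr', hrc, hrc', hrr, htr, htr'⟩ hn hn' hnb hnb' hnn htn htn'
    have h1 := eB n hn hnb
    have h2 := eB n' hn' hnb'
    have h3' := eC r hr hrc
    have h4 := eC r' hr' hrc'
    have h5 := hiso' t ht
    exact F.not_both_triangles h3 hKab hKac h5.2.1 hnn hrr htn htn' htr htr'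
      h1.1 hnb h1.2 h2.1 hnb' h2.2 h3'.1 h3'.2 hrc h4.1 h4.2 hrc'
  let XA := Finset.univ.filter fun u => IsRest G K u ∧ G.Adj u a
  let XB := Finset.univ.filter fun u => IsRest G K u ∧ (G.Adj u b ∨ T1 u)
  let XC := Finset.univ.filter fun u => IsRest G K u ∧ ¬ G.Adj u a ∧ ¬ G.Adj u b ∧ ¬ T1 u
  have mA : ∀ u, u ∈ XA ↔ IsRest G K u ∧ G.Adj u a := by simp [XA]
  have mB : ∀ u, u ∈ XB ↔ IsRest G K u ∧ (G.Adj u b ∨ T1 u) := by simp [XB]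
  have mC : ∀ u, u ∈ XC ↔ IsRest G K u ∧ ¬ G.Adj u a ∧ ¬ G.Adj u b ∧ ¬ T1 u := by simp [XC]
  have hB : ∀ u ∈ XB, ¬ G.Adj u a ∧ ¬ G.Adj u c := by
    intro u hu
    rcases (mB u).1 hu with ⟨h, h' | h'⟩
    · exact eB u h h'
    · have := hiso' u h'.1
      exact ⟨this.1, this.2.2⟩
  -- a clique meets the stable set of isolated vertices at most once
  have hone : ∀ R : Finset V, G.IsClique (R : Set V) → (∀ t ∈ R, IsIsolatedFrom G K t) →
      R.card ≤ 1 := by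
    intro R hcl h
    by_contra! h2
    obtain ⟨x, hx, y, hy, hxy⟩ := Finset.one_lt_card.1 h2
    exact hst x y (h x hx) (h y hy) (hcl hx hy hxy)
  have htwo : ∀ k, ∀ R : Finset V, G.IsClique (R : Set V) → (∀ t ∈ R, G.Adj t k) →
      R.card ≤ 2 := by
    intro k R hcl h
    have := F.card_add_one_le hcl h
    omega
  have hsplit : ∀ k : V, ∀ R : Finset V, (R.filter (fun t => G.Adj t k)).card +
      (R.filter (fun t => ¬ G.Adj t k)).card = R.card := fun k R =>
    Finset.card_filter_add_card_filter_not _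
  obtain ⟨fA, hfA, hfA'⟩ := cluster_coloring (G := G) (α := V ⊕ ℕ) XA (by
      intro x hx y hy z hz
      have h1 := eA x ((mA x).1 hx).1 ((mA x).1 hx).2
      have h2 := eA y ((mA y).1 hy).1 ((mA y).1 hy).2
      have h3 := eA z ((mA z).1 hz).1 ((mA z).1 hz).2
      exact F.adj_trans hb hc hbc h1.1 h2.1 h3.1 h1.2 h2.2 h3.2)
    {Sum.inl b, Sum.inl c} (by
      intro R hR hcl
      refine (htwo a R hcl fun t ht => ((mA t).1 (hR ht)).2).trans ?_
      simp [hbc])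
  obtain ⟨fB, hfB, hfB'⟩ := cluster_list_coloring (G := G) (α := V ⊕ ℕ) XB (by
      intro x hx y hy z hz
      exact F.adj_trans ha hc hac (hB x hx).1 (hB y hy).1 (hB z hz).1 (hB x hx).2 (hB y hy).2
        (hB z hz).2)
    (fun u => if G.Adj u b then {Sum.inl a, Sum.inr 0} else {Sum.inr 0}) (by
      intro R hR hcl
      have hT : ∀ t ∈ R, ¬ G.Adj t b → T1 t := by
        intro t ht htb
        exact (((mB t).1 (hR ht)).2).resolve_left htb
      have h1 : (R.filter (fun t => ¬ G.Adj t b)).card ≤ 1 :=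
        hone _ (hcl.subset (Finset.coe_subset.2 (Finset.filter_subset _ _))) (by
          intro t ht
          simp only [Finset.mem_filter] at ht
          exact (hT t ht.1 ht.2).1)
      have h2 : (R.filter (fun t => G.Adj t b)).card ≤ 2 :=
        htwo b _ (hcl.subset (Finset.coe_subset.2 (Finset.filter_subset _ _))) (by simp)
      by_cases h0 : ∃ n ∈ R, G.Adj n b
      · obtain ⟨n, hn, hnb⟩ := h0
        refine le_trans ?_ (Finset.card_le_card (Finset.subset_biUnion_of_mem _ hn))
        have : R.card ≤ 2 := by
          rw [← hsplit b R]
          by_contra! h3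
          obtain ⟨t, ht⟩ := Finset.card_pos.1
            (show 0 < (R.filter (fun t => ¬ G.Adj t b)).card by omega)
          obtain ⟨n, hn, n', hn', hnn⟩ := Finset.one_lt_card.1
            (show 1 < (R.filter (fun t => G.Adj t b)).card by omega)
          simp only [Finset.mem_filter] at ht hn hn'
          exact hT1 t n n' (hT t ht.1 ht.2) ((mB n).1 (hR hn.1)).1 ((mB n').1 (hR hn'.1)).1
            hn.2 hn'.2 (hcl hn.1 hn'.1 hnn)
            (hcl ht.1 hn.1 (by rintro rfl; exact ht.2 hn.2))
            (hcl ht.1 hn'.1 (by rintro rfl; exact ht.2 hn'.2))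
        simpa [hnb] using this
      · push Not at h0
        have hR1 : R.card ≤ 1 := by
          rw [Finset.filter_true_of_mem h0] at h1
          exact h1
        rcases R.eq_empty_or_nonempty with rfl | ⟨n, hn⟩
        · simp
        · refine le_trans hR1 (le_trans ?_
            (Finset.card_le_card (Finset.subset_biUnion_of_mem _ hn)))
          simp [h0 n hn])
  obtain ⟨fC, hfC, hfC'⟩ := cluster_coloring (G := G) (α := V ⊕ ℕ) XC (by
      intro x hx y hy z hz
      have h4 := (mC x).1 hx
      have h5 := (mC y).1 hy
      have h6 := (mC z).1 hz
      exact F.adj_trans ha hb hab h4.2.1 h5.2.1 h6.2.1 h4.2.2.1 h5.2.2.1 h6.2.2.1)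
    {Sum.inr 1, Sum.inr 2} (by
      intro R hR hcl
      have hT : ∀ t ∈ R, ¬ G.Adj t c → IsIsolatedFrom G K t := by
        intro t ht htc
        have := (mC t).1 (hR ht)
        exact hiso t this.1 this.2.1 this.2.2.1 htc
      have h1 : (R.filter (fun t => ¬ G.Adj t c)).card ≤ 1 :=
        hone _ (hcl.subset (Finset.coe_subset.2 (Finset.filter_subset _ _))) (by
          intro t ht
          simp only [Finset.mem_filter] at ht
          exact hT t ht.1 ht.2)
      have h2 : (R.filter (fun t => G.Adj t c)).card ≤ 2 :=
        htwo c _ (hcl.subset (Finset.coe_subset.2 (Finset.filter_subset _ _))) (by simp)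
      rw [← hsplit c R]
      by_contra! h3
      simp only [ne_eq, not_false_eq_true, Finset.card_pair, Sum.inr.injEq,
        OfNat.one_ne_ofNat] at h3
      obtain ⟨t, ht⟩ := Finset.card_pos.1
        (show 0 < (R.filter (fun t => ¬ G.Adj t c)).card by omega)
      obtain ⟨n, hn, n', hn', hnn⟩ := Finset.one_lt_card.1
        (show 1 < (R.filter (fun t => G.Adj t c)).card by omega)
      simp only [Finset.mem_filter] at ht hn hn'
      refine ((mC t).1 (hR ht.1)).2.2.2 ⟨hT t ht.1 ht.2, n, n', ((mC n).1 (hR hn.1)).1,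
        ((mC n').1 (hR hn'.1)).1, hn.2, hn'.2, hcl hn.1 hn'.1 hnn,
        hcl ht.1 hn.1 (by rintro rfl; exact ht.2 hn.2),
        hcl ht.1 hn'.1 (by rintro rfl; exact ht.2 hn'.2)⟩)
  let f : V → V ⊕ ℕ := fun u => if u ∈ XA then fA u else if u ∈ XB then fB u else fC u
  have hcase : ∀ u, IsRest G K u → (u ∈ XA ∧ f u = fA u ∧ (f u = Sum.inl b ∨ f u = Sum.inl c)) ∨
      (u ∈ XB ∧ f u = fB u ∧ ((f u = Sum.inl a ∧ G.Adj u b) ∨ f u = Sum.inr 0)) ∨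
      (u ∈ XC ∧ f u = fC u ∧ (f u = Sum.inr 1 ∨ f u = Sum.inr 2)) := by
    intro u hu
    by_cases h1 : u ∈ XA
    · left
      have := hfA u h1
      simp [f, h1] at this ⊢
      exact this
    · by_cases h2 : u ∈ XB
      · right; left
        have := hfB u h2
        simp only [f, h1, h2, if_true, if_false, true_and]
        split_ifs at this with h
        · simp only [Finset.mem_insert, Finset.mem_singleton] at this
          exact this.imp_left fun h3 => ⟨h3, h⟩
        · simp only [Finset.mem_singleton] at this
          exact Or.inr this
      · right; right
        have h3 : u ∈ XC := by
          refine (mC u).2 ⟨hu, fun h => h1 ((mA u).2 ⟨hu, h⟩),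
            fun h => h2 ((mB u).2 ⟨hu, Or.inl h⟩), fun h => h2 ((mB u).2 ⟨hu, Or.inr h⟩)⟩
        have := hfC u h3
        simp [f, h1, h2, h3] at this ⊢
        exact this
  have key := F.colorable_of_rest 3 f (by
      intro u hu
      rcases hcase u hu with ⟨-, -, h | h⟩ | ⟨-, -, h | h⟩ | ⟨-, -, h | h⟩
      · exact Or.inl ⟨b, hb, h⟩
      · exact Or.inl ⟨c, hc, h⟩
      · exact Or.inl ⟨a, ha, h.1⟩
      · exact Or.inr ⟨0, by omega, h⟩
      · exact Or.inr ⟨1, by omega, h⟩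
      · exact Or.inr ⟨2, by omega, h⟩) (by
      intro u k hu h
      have hBu := hB u
      rcases hcase u hu with ⟨h1, -, h2 | h2⟩ | ⟨h1, -, h2 | h2⟩ | ⟨h1, -, h2 | h2⟩
      · rw [h2] at h; obtain rfl : b = k := by simpa using h
        exact (eA u hu ((mA u).1 h1).2).1
      · rw [h2] at h; obtain rfl : c = k := by simpa using h
        exact (eA u hu ((mA u).1 h1).2).2
      · rw [h2.1] at h; obtain rfl : a = k := by simpa using h
        exact (hBu h1).1
      all_goals simp [h2] at h) (by
      intro u k m hu h hk
      exfalso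
      rcases hcase u hu with ⟨h1, -, h2 | h2⟩ | ⟨h1, -, h2 | h2⟩ | ⟨h1, -, h2 | h2⟩
      · exact hk a ha ((mA u).1 h1).2
      · exact hk a ha ((mA u).1 h1).2
      · exact hk b hb h2.2
      all_goals simp [h2] at h) (by
      intro u v hu hv huv
      rcases hcase u hu with ⟨h1, h2, h3⟩ | ⟨h1, h2, h3⟩ | ⟨h1, h2, h3⟩ <;>
      rcases hcase v hv with ⟨h1', h2', h3'⟩ | ⟨h1', h2', h3'⟩ | ⟨h1', h2', h3'⟩
      · rw [h2, h2']; exact hfA' u h1 v h1' huv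
      · clear hfA hfB hfC hfA' hfB' hfC'; grind
      · clear hfA hfB hfC hfA' hfB' hfC'; grind
      · clear hfA hfB hfC hfA' hfB' hfC'; grind
      · rw [h2, h2']; exact hfB' u h1 v h1' huv
      · clear hfA hfB hfC hfA' hfB' hfC'; grind
      · clear hfA hfB hfC hfA' hfB' hfC'; grind
      · clear hfA hfB hfC hfA' hfB' hfC'; grind
      · rw [h2, h2']; exact hfC' u h1 v h1' huv)
  rwa [h3] at key

theorem colorable_six [Fintype V] (F : MaxCliqueFrame G K) (h3 : K.card = 3) :
    G.Colorable 6 := by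
  by_cases h : ∃ x y, IsIsolatedFrom G K x ∧ IsIsolatedFrom G K y ∧ G.Adj x y
  · obtain ⟨x, y, hx, hy, hxy⟩ := h
    exact F.colorable_six_of_isolated_edge h3 hx hy hxy
  · push Not at h
    exact F.colorable_six_of_isolated_stable h3 h

open Classical in
/-- The colours available to a vertex with at least two non-neighbours in `K`, when each vertex
of `K`, together with the vertices near to it, forms a colour class, and there is one additional
colour which is only used on vertices without neighbours in `K`. -/
noncomputable def _root_.freeColors (G : SimpleGraph V) (K : Finset V) (u : V) : Finset (V ⊕ ℕ) :=
  if IsFar G K u then (K.filter fun a => ¬ G.Adj u a).disjSum ∅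
  else (K.filter fun a => ∀ m, IsNear G K m a → ¬ G.Adj u m).disjSum {0}

theorem _root_.IsFar.inl_mem_freeColors {u a : V} (h : IsFar G K u) :
    Sum.inl a ∈ freeColors G K u ↔ a ∈ K ∧ ¬ G.Adj u a := by
  rw [freeColors, if_pos h]
  simp

theorem _root_.IsIsolatedFrom.inl_mem_freeColors {u a : V} (h : IsIsolatedFrom G K u) :
    Sum.inl a ∈ freeColors G K u ↔ a ∈ K ∧ ∀ m, IsNear G K m a → ¬ G.Adj u m := by
  rw [freeColors, if_neg h.not_far]
  simp

theorem _root_.IsIsolatedFrom.inr_mem_freeColors {u : V} (h : IsIsolatedFrom G K u) :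
    Sum.inr 0 ∈ freeColors G K u := by
  rw [freeColors, if_neg h.not_far]
  simp

theorem colorable_of_freeColors [Fintype V] (F : MaxCliqueFrame G K) (f : V → V ⊕ ℕ)
    (hf : ∀ u, IsRest G K u → f u ∈ freeColors G K u)
    (hne : ∀ u v, IsRest G K u → IsRest G K v → G.Adj u v → f u ≠ f v) :
    G.Colorable (K.card + 1) := by
  refine F.colorable_of_rest 1 f ?_ ?_ ?_ hne
  · intro u hu
    have := hf u hu
    rw [freeColors] at this
    split_ifs at this
    · simp only [Finset.mem_disjSum] at this
      grind
    · simp only [Finset.mem_disjSum] at this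
      grind
  · intro u a hu h
    have := hf u hu
    rw [h] at this
    rcases hu.isolated_or_far with hu' | hu'
    · rw [hu'.inl_mem_freeColors] at this
      exact hu'.2 a this.1
    · rw [hu'.inl_mem_freeColors] at this
      exact this.2
  · intro u a m hu h hk hm
    have := hf u hu
    rw [h] at this
    rcases hu.isolated_or_far with hu' | hu'
    · rw [hu'.inl_mem_freeColors] at this
      exact this.2 m hm
    · obtain ⟨-, s, hs, hus⟩ := hu'
      exact absurd hus (hk s hs)

theorem card_far_clique_le [Fintype V] (F : MaxCliqueFrame G K) [DecidableEq V] {R : Finset V}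
    (hcl : G.IsClique (R : Set V)) (hfar : ∀ u ∈ R, IsFar G K u) :
    R.card ≤ (R.biUnion (freeColors G K)).card := by
  classical
  let S := K.filter fun k => ∀ u ∈ R, G.Adj u k
  have h1 : R.card + S.card ≤ K.card := by
    refine F.card_add_card_le hcl
      (F.isClique.subset (Finset.coe_subset.2 (Finset.filter_subset _ _)))
      fun x hx y hy => ?_
    simp only [S, Finset.mem_filter] at hy
    exact hy.2 x hx
  have h2 : (K \ S).disjSum (∅ : Finset ℕ) ⊆ R.biUnion (freeColors G K) := by
    intro c hc
    simp only [Finset.mem_disjSum, Finset.notMem_empty, false_and, exists_false, or_false,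
      Finset.mem_sdiff, S, Finset.mem_filter, not_and, not_forall] at hc
    obtain ⟨k, ⟨hk, h⟩, rfl⟩ := hc
    obtain ⟨u, hu, huk⟩ := h hk
    exact Finset.mem_biUnion.2 ⟨u, hu, ((hfar u hu).inl_mem_freeColors).2 ⟨hk, huk⟩⟩
  have h3 := Finset.card_le_card h2
  have hSK : S ⊆ K := Finset.filter_subset _ _
  rw [Finset.card_disjSum, Finset.card_empty, Finset.card_sdiff_of_subset hSK] at h3
  have h4 := Finset.card_le_card hSK
  omega

theorem card_isolated_clique_le [Fintype V] (F : MaxCliqueFrame G K) [DecidableEq V]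
    (h3 : 3 ≤ K.card) {R : Finset V}
    (hcl : G.IsClique (R : Set V)) (hiso : ∀ u ∈ R, IsIsolatedFrom G K u) :
    R.card ≤ (R.biUnion (freeColors G K)).card := by
  classical
  rcases R.eq_empty_or_nonempty with rfl | ⟨t₀, ht₀⟩
  · simp
  let B := K.filter fun a => ∀ t ∈ R, ∃ m, IsNear G K m a ∧ G.Adj t m
  have hBK : B ⊆ K := Finset.filter_subset _ _
  have hsub : (K \ B).disjSum {0} ⊆ R.biUnion (freeColors G K) := by
    intro c hc
    simp only [Finset.mem_disjSum, Finset.mem_sdiff, B, Finset.mem_filter, not_and, not_forall,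
      Finset.mem_singleton] at hc
    rcases hc with ⟨k, ⟨hk, h⟩, rfl⟩ | ⟨i, rfl, rfl⟩
    · obtain ⟨t, ht, h⟩ := h hk
      exact Finset.mem_biUnion.2 ⟨t, ht, ((hiso t ht).inl_mem_freeColors).2
        ⟨hk, fun m hm htm => h ⟨m, hm, htm⟩⟩⟩
    · exact Finset.mem_biUnion.2 ⟨t₀, ht₀, (hiso t₀ ht₀).inr_mem_freeColors⟩
  have hcard := Finset.card_le_card hsub
  rw [Finset.card_disjSum, Finset.card_singleton, Finset.card_sdiff_of_subset hBK] at hcard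
  have hBle := Finset.card_le_card hBK
  suffices R.card + B.card ≤ K.card + 1 by omega
  rcases B.eq_empty_or_nonempty with hB | ⟨a₀, ha₀⟩
  · have := F.max R hcl
    rw [hB]
    simp
    omega
  have hm : ∀ a, ∃ m, a ∈ B → IsNear G K m a ∧ G.Adj t₀ m := by
    intro a
    by_cases ha : a ∈ B
    · obtain ⟨m, hm⟩ := (Finset.mem_filter.1 ha).2 t₀ ht₀
      exact ⟨m, fun _ => hm⟩
    · exact ⟨a, fun h => absurd h ha⟩
  choose m hm using hm
  have hinj : Set.InjOn m B := by
    intro a ha b hb hab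
    by_contra hne
    have h1 := (hm a ha).1
    have h2 := (hm b hb).1
    rw [hab] at h1
    exact (h1.2.2 a h1.2.1).1 ((h2.2.2 a h1.2.1).2 hne) rfl
  have hsame : ∀ a ∈ B, ∀ b ∈ B, ∀ y ∈ R, G.Adj (m b) y → G.Adj (m a) y := by
    intro a ha b hb y hy hby
    by_contra hay
    have hab : a ≠ b := by rintro rfl; exact hay hby
    obtain ⟨k, hk, hka, hkb⟩ : ∃ k ∈ K, k ≠ a ∧ k ≠ b := by
      by_contra! h
      have : K ⊆ {a, b} := by
        intro c hc
        by_cases hca : c = a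
        · simp [hca]
        · simp [h c hc hca]
      have := (Finset.card_le_card this).trans Finset.card_le_two
      omega
    obtain ⟨hma, hta⟩ := hm a ha
    obtain ⟨hmb, htb⟩ := hm b hb
    have hne : t₀ ≠ y := by rintro rfl; exact hay hta.symm
    exact F.gem (m b) k (m a) t₀ y ((hmb.2.2 k hk).2 hkb) (F.near_adj_near h3 hmb hma hab.symm)
      htb.symm hby ((hma.2.2 k hk).2 hka).symm hta.symm (hcl ht₀ hy hne)
      (fun h => (hiso t₀ ht₀).2 k hk h.symm) (fun h => (hiso y hy).2 k hk h.symm) hay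
  have h1 := F.card_add_card_le (R := R.filter (G.Adj (m a₀))) (Q := B.image m)
    (hcl.subset (Finset.coe_subset.2 (Finset.filter_subset _ _))) (by
      intro x hx y hy hxy
      simp only [Finset.coe_image, Set.mem_image, Finset.mem_coe] at hx hy
      obtain ⟨a, ha, rfl⟩ := hx
      obtain ⟨b, hb, rfl⟩ := hy
      exact F.near_adj_near h3 (hm a ha).1 (hm b hb).1 (by rintro rfl; exact hxy rfl)) (by
      intro x hx y hy
      simp only [Finset.mem_image, Finset.mem_filter] at hx hy
      obtain ⟨b, hb, rfl⟩ := hy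
      exact (hsame b hb a₀ ha₀ x hx.1 hx.2).symm)
  rw [Finset.card_image_of_injOn hinj] at h1
  have h2 : (R.filter fun t => ¬ G.Adj (m a₀) t).card ≤ 1 := by
    by_contra! h
    obtain ⟨x, hx, y, hy, hxy⟩ := Finset.one_lt_card.1 h
    simp only [Finset.mem_filter] at hx hy
    have hma := (hm a₀ ha₀).1
    obtain ⟨k, hk, hka⟩ := Finset.exists_mem_ne (show 1 < K.card by omega) a₀
    have := F.isolated_edge_dominates (hiso x hx.1) (hiso y hy.1) (hcl hx.1 hy.1 hxy) hma.1 hk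
      ((hma.2.2 k hk).2 hka)
    simp only [G.adj_comm x, G.adj_comm y] at this
    exact this.elim hx.2 hy.2
  have h5 := Finset.card_filter_add_card_filter_not (s := R) (G.Adj (m a₀))
  omega

/-! ### Vertices far from `K` in the presence of an edge anticomplete to `K` -/

theorem far_cover_of_not_adj (F : MaxCliqueFrame G K) {x y v w p q : V}
    (hx : IsIsolatedFrom G K x) (hy : IsIsolatedFrom G K y) (hxy : G.Adj x y)
    (hv : IsFar G K v) (hw : IsFar G K w) (hne : v ≠ w) (hvw : ¬ G.Adj v w)
    (hp : p ∈ K) (hq : q ∈ K) (hpq : p ≠ q) (hvp : ¬ G.Adj v p) (hvq : ¬ G.Adj v q)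
    (hwp : ¬ G.Adj w p) (hwq : ¬ G.Adj w q) : False := by
  have h1 := F.far_complete_isolated_edge hx hy hxy hv
  have h2 := F.far_complete_isolated_edge hx hy hxy hw
  exact hvw (F.adj_trans hp hq hpq hvp (hx.2 p hp) hwp hvq (hx.2 q hq) hwq h1.symm h2 hne)

theorem far_disjoint_of_not_adj (F : MaxCliqueFrame G K) {x y v w k : V}
    (hx : IsIsolatedFrom G K x) (hy : IsIsolatedFrom G K y) (hxy : G.Adj x y)
    (hv : IsFar G K v) (hw : IsFar G K w) (hne : v ≠ w) (hvw : ¬ G.Adj v w)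
    (hk : k ∈ K) (hvk : G.Adj v k) (hwk : G.Adj w k) : False := by
  rcases F.nested hvw hk hvk hwk with h | h
  · obtain ⟨p, hp, q, hq, hpq, hwp, hwq⟩ := hw.1.2
    exact F.far_cover_of_not_adj hx hy hxy hv hw hne hvw hp hq hpq (fun h' => hwp (h p hp h'))
      (fun h' => hwq (h q hq h')) hwp hwq
  · obtain ⟨p, hp, q, hq, hpq, hwp, hwq⟩ := hv.1.2
    exact F.far_cover_of_not_adj hx hy hxy hv hw hne hvw hp hq hpq hwp hwq
      (fun h' => hwp (h p hp h')) (fun h' => hwq (h q hq h'))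

theorem isolated_not_adj_near (F : MaxCliqueFrame G K) {t u a b m : V}
    (ht : IsIsolatedFrom G K t) (hu : IsFar G K u) (htu : G.Adj t u) (ha : a ∈ K) (hb : b ∈ K)
    (hab : a ≠ b) (hua : G.Adj u a) (hub : G.Adj u b) (hm : IsNear G K m a) : ¬ G.Adj t m := by
  intro htm
  exact F.gem u a b m t hua hub (F.rest_adj_near hu.1 hb hub hab.symm hua hm) htu.symm
    (F.clique a ha b hb hab) ((hm.2.2 b hb).2 hab.symm).symm htm.symm
    (fun h => (hm.2.2 a ha).1 h.symm rfl) (fun h => ht.2 a ha h.symm) (fun h => ht.2 b hb h.symm)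

/-- Far vertices of the same type have the same neighbours among far vertices of a disjoint
type. -/
theorem far_adj_of_same_type (F : MaxCliqueFrame G K) {x y q q' r : V}
    (hx : IsIsolatedFrom G K x) (hy : IsIsolatedFrom G K y) (hxy : G.Adj x y)
    (hq : IsFar G K q) (hq' : IsFar G K q') (hr : IsFar G K r)
    (hsame : ∀ k ∈ K, G.Adj q k ↔ G.Adj q' k) (hdis : ∀ k ∈ K, G.Adj q k → ¬ G.Adj r k)
    (hqr : G.Adj q r) : G.Adj q' r := by
  by_contra h
  obtain ⟨s, hs, hqs⟩ := hq.2
  have hne : q ≠ q' := by rintro rfl; exact h hqr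
  have hqq : G.Adj q q' := by
    by_contra h'
    exact F.far_disjoint_of_not_adj hx hy hxy hq hq' hne h' hs hqs ((hsame s hs).1 hqs)
  have h1 := F.far_complete_isolated_edge hx hy hxy hq
  have h2 := F.far_complete_isolated_edge hx hy hxy hq'
  have h3 := F.far_complete_isolated_edge hx hy hxy hr
  exact F.gem q s q' x r hqs hqq h1.symm hqr ((hsame s hs).1 hqs).symm h2.symm h3
    (fun h' => hx.2 s hs h'.symm) (fun h' => hdis s hs hqs h'.symm) h

theorem isolated_complete_far (F : MaxCliqueFrame G K) {x y t w u : V}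
    (hx : IsIsolatedFrom G K x) (hy : IsIsolatedFrom G K y) (hxy : G.Adj x y)
    (ht : IsIsolatedFrom G K t) (hw : IsRest G K w) (htw : G.Adj t w) (hu : IsFar G K u) :
    G.Adj t u := by
  rcases hw.isolated_or_far with hw' | hw'
  · exact F.far_complete_isolated_edge ht hw' htw hu
  · have hxw := F.far_complete_isolated_edge hx hy hxy hw'
    by_cases hxt : x = t
    · exact hxt ▸ F.far_complete_isolated_edge hx hy hxy hu
    · obtain ⟨p, hp, q, hq, hpq, hwp, hwq⟩ := hw.2
      have := F.adj_trans hp hq hpq (hx.2 p hp) hwp (ht.2 p hp) (hx.2 q hq) hwq (ht.2 q hq)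
        hxw htw.symm hxt
      exact F.far_complete_isolated_edge ht hx this.symm hu

theorem card_mixed_clique_le [Fintype V] (F : MaxCliqueFrame G K) [DecidableEq V] {R : Finset V}
    (hcl : G.IsClique (R : Set V)) {u t : V} (hu : IsFar G K u) (ht : IsIsolatedFrom G K t)
    (huR : u ∈ R) (htR : t ∈ R) : R.card ≤ (R.biUnion (freeColors G K)).card := by
  have htu : G.Adj t u := hcl htR huR (by rintro rfl; exact ht.not_far hu)
  obtain ⟨s, hs, hus⟩ := hu.2
  have hsub : (K.erase s).disjSum {0} ⊆ R.biUnion (freeColors G K) := by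
    intro c hc
    simp only [Finset.mem_disjSum, Finset.mem_erase, Finset.mem_singleton] at hc
    rcases hc with ⟨k, ⟨hks, hk⟩, rfl⟩ | ⟨i, rfl, rfl⟩
    · by_cases huk : G.Adj u k
      · exact Finset.mem_biUnion.2 ⟨t, htR, (ht.inl_mem_freeColors).2
          ⟨hk, fun m hm => F.isolated_not_adj_near ht hu htu hk hs hks huk hus hm⟩⟩
      · exact Finset.mem_biUnion.2 ⟨u, huR, (hu.inl_mem_freeColors).2 ⟨hk, huk⟩⟩
    · exact Finset.mem_biUnion.2 ⟨t, htR, ht.inr_mem_freeColors⟩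
  have h1 := Finset.card_le_card hsub
  rw [Finset.card_disjSum, Finset.card_singleton, Finset.card_erase_add_one hs] at h1
  exact (F.max R hcl).trans h1

theorem colorable_succ_of_far_clique [Fintype V] (F : MaxCliqueFrame G K) (h3 : 3 ≤ K.card)
    {x y : V} (hx : IsIsolatedFrom G K x) (hy : IsIsolatedFrom G K y) (hxy : G.Adj x y)
    (hfar : ∀ u v, IsFar G K u → IsFar G K v → u ≠ v → G.Adj u v) : G.Colorable (K.card + 1) := by
  classical
  obtain ⟨f, hf, hf'⟩ := cluster_list_coloring (G := G) (Finset.univ.filter (IsRest G K)) (by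
      simp only [Finset.mem_filter_univ]
      intro a ha b hb c hc hab hbc hac
      rcases ha.isolated_or_far with ha' | ha' <;> rcases hc.isolated_or_far with hc' | hc'
      · obtain ⟨p, hp, q, hq, hpq, hbp, hbq⟩ := hb.2
        exact F.adj_trans hp hq hpq (ha'.2 p hp) hbp (hc'.2 p hp) (ha'.2 q hq) hbq (hc'.2 q hq)
          hab hbc hac
      · exact F.isolated_complete_far hx hy hxy ha' hb hab hc'
      · exact (F.isolated_complete_far hx hy hxy hc' hb hbc.symm ha').symm
      · exact hfar a c ha' hc' hac)
    (freeColors G K) (by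
      intro R hR hcl
      have hR' : ∀ v ∈ R, IsRest G K v := fun v hv => (Finset.mem_filter_univ _).1 (hR hv)
      by_cases h1 : ∃ u ∈ R, IsFar G K u
      · obtain ⟨u, huR, hu⟩ := h1
        by_cases h2 : ∃ t ∈ R, IsIsolatedFrom G K t
        · obtain ⟨t, htR, ht⟩ := h2
          exact F.card_mixed_clique_le hcl hu ht huR htR
        · push Not at h2
          exact F.card_far_clique_le hcl fun v hv =>
            (hR' v hv).isolated_or_far.resolve_left (h2 v hv)
      · push Not at h1
        exact F.card_isolated_clique_le h3 hcl fun v hv =>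
          (hR' v hv).isolated_or_far.resolve_right (h1 v hv))
  simp only [Finset.mem_filter_univ] at hf hf'
  exact F.colorable_of_freeColors f hf fun u v hu hv => hf' u hu v hv

end MaxCliqueFrame

/-- A palette for two cliques of sizes `q` and `r` which may share up to `h` colours. -/
theorem exists_shared_palettes {V : Type*} [DecidableEq V] {A B : Finset V} {q r h : ℕ}
    (hq : q ≤ A.card + h)
    (hr : r ≤ B.card + h) : ∃ P Q : Finset (V ⊕ ℕ), P ⊆ A.disjSum (Finset.range h) ∧
      Q ⊆ B.disjSum (Finset.range h) ∧ P.card = q ∧ Q.card = r ∧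
      (P ∪ Q).card ≤ (q - min q h) + (r - min r h) + max (min q h) (min r h) := by
  obtain ⟨A', hA', hA'c⟩ := Finset.exists_subset_card_eq (show q - min q h ≤ A.card by omega)
  obtain ⟨B', hB', hB'c⟩ := Finset.exists_subset_card_eq (show r - min r h ≤ B.card by omega)
  refine ⟨A'.disjSum (Finset.range (min q h)), B'.disjSum (Finset.range (min r h)), ?_, ?_, ?_, ?_,
    ?_⟩
  · exact Finset.disjSum_mono hA' (Finset.range_mono (min_le_right _ _))
  · exact Finset.disjSum_mono hB' (Finset.range_mono (min_le_right _ _))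
  · rw [Finset.card_disjSum, hA'c, Finset.card_range]; omega
  · rw [Finset.card_disjSum, hB'c, Finset.card_range]; omega
  · have : A'.disjSum (Finset.range (min q h)) ∪ B'.disjSum (Finset.range (min r h)) ⊆
        (A' ∪ B').disjSum (Finset.range (max (min q h) (min r h))) := by
      refine Finset.union_subset ?_ ?_
      · exact Finset.disjSum_mono Finset.subset_union_left (Finset.range_mono (le_max_left _ _))
      · exact Finset.disjSum_mono Finset.subset_union_right (Finset.range_mono (le_max_right _ _))
    refine (Finset.card_le_card this).trans ?_
    rw [Finset.card_disjSum, Finset.card_range]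
    have := Finset.card_union_le A' B'
    omega

/-- A clique can be coloured injectively from any palette that is large enough. -/
theorem exists_clique_coloring {V α : Type*} [Nonempty α] {C : Finset V} {L : Finset α}
    (h : C.card ≤ L.card) : ∃ f : V → α, (∀ v ∈ C, f v ∈ L) ∧ Set.InjOn f C := by
  classical
  obtain ⟨L', hL', hc⟩ := Finset.exists_subset_card_eq h
  have e := Finset.equivOfCardEq hc.symm
  refine ⟨fun v => if h : v ∈ C then e ⟨v, h⟩ else Classical.arbitrary α, ?_, ?_⟩
  · intro v hv
    simpa [hv] using hL' (e ⟨v, hv⟩).2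
  · intro u hu v hv huv
    have hu' : u ∈ C := hu
    have hv' : v ∈ C := hv
    simp only [hu', hv', dif_pos] at huv
    simpa using e.injective (Subtype.ext huv)

namespace MaxCliqueFrame
variable {V : Type*} {G : SimpleGraph V} {K : Finset V}

/-- If two non-adjacent far vertices jointly cover `K`, every far vertex has the type of one of
them. -/
theorem type_eq_of_cover (F : MaxCliqueFrame G K) {x y u v w : V}
    (hx : IsIsolatedFrom G K x) (hy : IsIsolatedFrom G K y) (hxy : G.Adj x y)
    (hu : IsFar G K u) (hv : IsFar G K v) (hw : IsFar G K w)
    (huv : ¬ G.Adj u v) (hne : u ≠ v) (hcov : ∀ k ∈ K, G.Adj u k ∨ G.Adj v k) :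
    (∀ k ∈ K, G.Adj w k ↔ G.Adj u k) ∨ (∀ k ∈ K, G.Adj w k ↔ G.Adj v k) := by
  have hdis : ∀ k ∈ K, G.Adj u k → ¬ G.Adj v k := fun k hk h h' =>
    F.far_disjoint_of_not_adj hx hy hxy hu hv hne huv hk h h'
  by_cases hwu : w = u
  · left; simp [hwu]
  by_cases hwv : w = v
  · right; simp [hwv]
  have key : ∀ a b : V, IsFar G K a → IsFar G K b → (∀ k ∈ K, G.Adj a k ∨ G.Adj b k) →
      w ≠ a → w ≠ b → ¬ G.Adj w a → (∀ k ∈ K, G.Adj w k ↔ G.Adj b k) := by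
    intro a b ha hb hc h1 h2 hwa
    have hd : ∀ k ∈ K, G.Adj w k → ¬ G.Adj a k := fun k hk h h' =>
      F.far_disjoint_of_not_adj hx hy hxy hw ha h1 hwa hk h h'
    obtain ⟨s, hs, hws⟩ := hw.2
    have hbs := (hc s hs).resolve_left (hd s hs hws)
    by_cases hwb : G.Adj w b
    · rcases F.eq_or_cover hwb hs hws hbs with h | h
      · exact h
      · obtain ⟨p, hp, q, hq, hpq, hbp, hbq⟩ := hb.1.2
        exact absurd ((hc p hp).resolve_right hbp) (hd p hp ((h p hp).resolve_right hbp))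
    · exact (F.far_disjoint_of_not_adj hx hy hxy hw hb h2 hwb hs hws hbs).elim
  by_cases h1 : G.Adj w u
  · by_cases h2 : G.Adj w v
    · have key2 : ∀ a b : V, IsFar G K b → G.Adj w a → G.Adj w b →
          (∀ k ∈ K, G.Adj a k → ¬ G.Adj b k) → ∀ k ∈ K, G.Adj w k → G.Adj a k →
          ∀ k ∈ K, G.Adj w k ↔ G.Adj a k := by
        intro a b hb hwa hwb hd k hk hwk hak
        refine (F.eq_or_cover hwa hk hwk hak).resolve_right fun h => ?_
        obtain ⟨p, hp, q, hq, hpq, hwp, hwq⟩ := hw.1.2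
        obtain ⟨s, hs, hbs⟩ := hb.2
        have hws := (h s hs).resolve_right fun h => hd s hs h hbs
        rcases F.eq_or_cover hwb hs hws hbs with h' | h'
        · exact hd k hk hak ((h' k hk).1 hwk)
        · exact hd p hp ((h p hp).resolve_left hwp) ((h' p hp).resolve_left hwp)
      obtain ⟨s, hs, hws⟩ := hw.2
      rcases hcov s hs with h | h
      · exact Or.inl (key2 u v hv h1 h2 hdis s hs hws h)
      · exact Or.inr (key2 v u hu h2 h1 (fun k hk h h' => hdis k hk h' h) s hs hws h)
    · exact Or.inl (key v u hv hu (fun k hk => (hcov k hk).symm) hwv hwu h2)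
  · exact Or.inr (key u v hu hv hcov hwu hwv h1)

theorem not_near_of_cover (F : MaxCliqueFrame G K) {x y u v m a : V}
    (hx : IsIsolatedFrom G K x) (hy : IsIsolatedFrom G K y) (hxy : G.Adj x y)
    (hu : IsFar G K u) (hv : IsFar G K v) (hcov : ∀ k ∈ K, G.Adj u k ∨ G.Adj v k) :
    ¬ IsNear G K m a := by
  intro hm
  have key : ∀ c d : V, IsFar G K c → IsFar G K d → (∀ k ∈ K, G.Adj c k ∨ G.Adj d k) →
      ¬ G.Adj c a := by
    intro c d hc hd hcd hca
    obtain ⟨p, hp, q, hq, hpq, hdp, hdq⟩ := hd.1.2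
    obtain ⟨b, hb, hba, hcb⟩ : ∃ b ∈ K, b ≠ a ∧ G.Adj c b := by
      by_cases hpa : p = a
      · exact ⟨q, hq, fun h => hpq (hpa.trans h.symm), (hcd q hq).resolve_right hdq⟩
      · exact ⟨p, hp, hpa, (hcd p hp).resolve_right hdp⟩
    have h1 := F.isolated_not_adj_near hx hc (F.far_complete_isolated_edge hx hy hxy hc)
      hm.2.1 hb hba.symm hca hcb hm
    have h2 := F.isolated_not_adj_near hy hc (F.far_complete_isolated_edge hy hx hxy.symm hc)
      hm.2.1 hb hba.symm hca hcb hm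
    exact (F.isolated_edge_dominates hx hy hxy hm.1 hb ((hm.2.2 b hb).2 hba)).elim h1 h2
  rcases hcov a hm.2.1 with h | h
  · exact key u v hu hv hcov h
  · exact key v u hv hu (fun k hk => (hcov k hk).symm) h

theorem colorable_of_far_cover [Fintype V] (F : MaxCliqueFrame G K) {x y u v : V} {h : ℕ}
    (h1 : 1 ≤ h) (hh : K.card ≤ 4 * h + 1)
    (hx : IsIsolatedFrom G K x) (hy : IsIsolatedFrom G K y) (hxy : G.Adj x y)
    (hu : IsFar G K u) (hv : IsFar G K v) (hne : u ≠ v) (huv : ¬ G.Adj u v)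
    (hcov : ∀ k ∈ K, G.Adj u k ∨ G.Adj v k) : G.Colorable (K.card + h) := by
  classical
  have hdis : ∀ k ∈ K, G.Adj u k → ¬ G.Adj v k := fun k hk h h' =>
    F.far_disjoint_of_not_adj hx hy hxy hu hv hne huv hk h h'
  let N : V → Finset V := fun a =>
    Finset.univ.filter fun w => IsFar G K w ∧ ∀ k ∈ K, G.Adj w k ↔ G.Adj a k
  have hN : ∀ a w, w ∈ N a ↔ IsFar G K w ∧ ∀ k ∈ K, G.Adj w k ↔ G.Adj a k := by simp [N]
  let D := Finset.univ.filter fun t => IsIsolatedFrom G K t ∧ G.Adj t u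
  have hD : ∀ w, w ∈ D ↔ IsIsolatedFrom G K w ∧ G.Adj w u := by simp [D]
  have hfarN : ∀ w, IsFar G K w → w ∈ N u ∨ w ∈ N v := fun w hw => by
    simp only [hN]
    exact (F.type_eq_of_cover hx hy hxy hu hv hw huv hne hcov).imp (⟨hw, ·⟩) (⟨hw, ·⟩)
  have hNcl : ∀ a, IsFar G K a → G.IsClique (N a : Set V) := by
    intro a ha b hb c hc hbc
    obtain ⟨hb, hba⟩ := (hN a b).1 hb
    obtain ⟨hc, hca⟩ := (hN a c).1 hc
    by_contra h'
    obtain ⟨s, hs, has⟩ := ha.2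
    exact F.far_disjoint_of_not_adj hx hy hxy hb hc hbc h' hs ((hba s hs).2 has) ((hca s hs).2 has)
  have hanti : ∀ a ∈ N u, ∀ b ∈ N v, ¬ G.Adj a b := by
    intro a ha b hb hab
    obtain ⟨ha, hau⟩ := (hN u a).1 ha
    obtain ⟨hb, hbv⟩ := (hN v b).1 hb
    have e1 := F.far_adj_of_same_type hx hy hxy ha hu hb hau
      (fun k hk h h' => hdis k hk ((hau k hk).1 h) ((hbv k hk).1 h')) hab
    have e2 := F.far_adj_of_same_type hx hy hxy hb hv hu hbv
      (fun k hk h h' => hdis k hk h' ((hbv k hk).1 h)) e1.symm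
    exact huv e2.symm
  have hDfar : ∀ t w, t ∈ D → IsFar G K w → G.Adj t w := by
    intro t w ht hw
    obtain ⟨ht, htu⟩ := (hD t).1 ht
    exact F.isolated_complete_far hx hy hxy ht hu.1 htu hw
  have hDcl : G.IsClique (D : Set V) := by
    intro a ha b hb hab
    obtain ⟨ha, hau⟩ := (hD a).1 ha
    obtain ⟨hb, hbu⟩ := (hD b).1 hb
    obtain ⟨p, hp, q, hq, hpq, hup, huq⟩ := hu.1.2
    exact F.adj_trans hp hq hpq (ha.2 p hp) hup (hb.2 p hp) (ha.2 q hq) huq (hb.2 q hq)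
      hau hbu.symm hab
  have hNK : ∀ a, IsFar G K a → (N a).card + (K.filter (G.Adj a)).card ≤ K.card := fun a ha =>
    F.card_add_card_le (hNcl a ha)
      (F.isClique.subset (Finset.coe_subset.2 (Finset.filter_subset _ _))) (by
        intro b hb c hc
        simp only [Finset.mem_filter] at hc
        exact (((hN a b).1 hb).2 c hc.1).2 hc.2)
  have hND : ∀ a, IsFar G K a → (N a).card + D.card ≤ K.card := fun a ha =>
    F.card_add_card_le (hNcl a ha) hDcl fun b hb t ht =>
      (hDfar t b ht ((hN a b).1 hb).1).symm
  have hsplit : (K.filter (G.Adj u)).card + (K.filter (G.Adj v)).card = K.card := by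
    rw [← Finset.card_union_of_disjoint]
    · congr 1
      ext k
      simp only [Finset.mem_union, Finset.mem_filter]
      grind
    · rw [Finset.disjoint_left]
      simp only [Finset.mem_filter]
      grind
  have e1 := hNK u hu
  have e2 := hNK v hv
  have e3 := hND u hu
  have e4 := hND v hv
  obtain ⟨P, Q, hP, hQ, hPc, hQc, hPQ⟩ := exists_shared_palettes (A := K.filter (G.Adj v))
    (B := K.filter (G.Adj u)) (q := (N u).card) (r := (N v).card) (h := h) (by omega) (by omega)
  obtain ⟨fu, hfu, hfu'⟩ := exists_clique_coloring hPc.ge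
  obtain ⟨fv, hfv, hfv'⟩ := exists_clique_coloring hQc.ge
  obtain ⟨fd, hfd, hfd'⟩ := exists_clique_coloring (C := D)
    (L := K.disjSum (Finset.range h) \ (P ∪ Q)) (by
      have := Finset.le_card_sdiff (P ∪ Q) (K.disjSum (Finset.range h))
      rw [Finset.card_disjSum, Finset.card_range] at this
      omega)
  let f : V → V ⊕ ℕ := fun w =>
    if w ∈ N u then fu w else if w ∈ N v then fv w else if w ∈ D then fd w else Sum.inr 0
  have huvN : ∀ w ∈ N v, w ∉ N u := by
    intro w hw hw'
    obtain ⟨s, hs, hus⟩ := hu.2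
    exact hdis s hs hus ((((hN v w).1 hw).2 s hs).1 ((((hN u w).1 hw').2 s hs).2 hus))
  have hisoN : ∀ a w, IsIsolatedFrom G K w → w ∉ N a := fun a w hw hw' =>
    hw.not_far ((hN a w).1 hw').1
  have hcases : ∀ w, IsRest G K w → (w ∈ N u ∧ f w = fu w) ∨ (w ∈ N v ∧ f w = fv w) ∨
      (w ∈ D ∧ f w = fd w) ∨ ((∀ z, IsRest G K z → ¬ G.Adj w z) ∧ f w = Sum.inr 0) := by
    intro w hw
    rcases hw.isolated_or_far with hw' | hw'
    · right; right
      by_cases hwD : w ∈ D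
      · left
        simp [f, hisoN _ w hw', hwD]
      · right
        refine ⟨fun z hz hwz => hwD ((hD w).2 ⟨hw', F.isolated_complete_far hx hy hxy hw' hz hwz
          hu⟩), ?_⟩
        simp [f, hisoN _ w hw', hwD]
    · rcases hfarN w hw' with h' | h'
      · left
        simp [f, h']
      · right; left
        simp [f, h', huvN w h']
  refine F.colorable_of_rest h f ?_ ?_ ?_ ?_
  · intro w hw
    rcases hcases w hw with ⟨hw', e⟩ | ⟨hw', e⟩ | ⟨hw', e⟩ | ⟨-, e⟩
    · have := hP (hfu w hw')
      rw [e]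
      simp only [Finset.mem_disjSum, Finset.mem_filter, Finset.mem_range] at this
      grind
    · have := hQ (hfv w hw')
      rw [e]
      simp only [Finset.mem_disjSum, Finset.mem_filter, Finset.mem_range] at this
      grind
    · have := (Finset.mem_sdiff.1 (hfd w hw')).1
      rw [e]
      simp only [Finset.mem_disjSum, Finset.mem_range] at this
      grind
    · exact Or.inr ⟨0, h1, e⟩
  · intro w a hw hwa
    rcases hcases w hw with ⟨hw', e⟩ | ⟨hw', e⟩ | ⟨hw', e⟩ | ⟨-, e⟩
    · have := hP (hfu w hw')
      rw [← e, hwa] at this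
      simp only [Finset.inl_mem_disjSum, Finset.mem_filter] at this
      exact fun h' => hdis a this.1 ((((hN u w).1 hw').2 a this.1).1 h') this.2
    · have := hQ (hfv w hw')
      rw [← e, hwa] at this
      simp only [Finset.inl_mem_disjSum, Finset.mem_filter] at this
      exact fun h' => hdis a this.1 this.2 ((((hN v w).1 hw').2 a this.1).1 h')
    · have := (Finset.mem_sdiff.1 (hfd w hw')).1
      rw [← e, hwa] at this
      exact ((hD w).1 hw').1.2 a (Finset.inl_mem_disjSum.1 this)
    · rw [e] at hwa
      cases hwa
  · intro w a m _ _ _ hm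
    exact absurd hm (F.not_near_of_cover hx hy hxy hu hv hcov)
  · intro w z hw hz hwz heq
    have hDn : ∀ t ∈ D, ∀ b ∈ N u, fd t ≠ fu b := by
      intro t ht b hb h'
      have := (Finset.mem_sdiff.1 (hfd t ht)).2
      exact this (Finset.mem_union_left _ (h' ▸ hfu b hb))
    have hDn' : ∀ t ∈ D, ∀ b ∈ N v, fd t ≠ fv b := by
      intro t ht b hb h'
      have := (Finset.mem_sdiff.1 (hfd t ht)).2
      exact this (Finset.mem_union_right _ (h' ▸ hfv b hb))
    rcases hcases w hw with ⟨hw', e⟩ | ⟨hw', e⟩ | ⟨hw', e⟩ | ⟨hn, e⟩ <;>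
    rcases hcases z hz with ⟨hz', e'⟩ | ⟨hz', e'⟩ | ⟨hz', e'⟩ | ⟨hn', e'⟩ <;>
    first
    | exact hn z hz hwz
    | exact hn' w hw hwz.symm
    | (rw [e, e'] at heq
       first
       | exact hwz.ne (hfu' hw' hz' heq)
       | exact hwz.ne (hfv' hw' hz' heq)
       | exact hwz.ne (hfd' hw' hz' heq)
       | exact hanti _ hw' _ hz' hwz
       | exact hanti _ hz' _ hw' hwz.symm
       | exact hDn _ hw' _ hz' heq
       | exact hDn _ hz' _ hw' heq.symm
       | exact hDn' _ hw' _ hz' heq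
       | exact hDn' _ hz' _ hw' heq.symm)

/-- Two non-adjacent far vertices which miss exactly one common vertex of `K` are the only far
vertices of their types. -/
theorem eq_of_same_type (F : MaxCliqueFrame G K) {x y u v w e : V}
    (hx : IsIsolatedFrom G K x) (hy : IsIsolatedFrom G K y) (hxy : G.Adj x y)
    (hu : IsFar G K u) (hv : IsFar G K v) (hw : IsFar G K w)
    (huv : ¬ G.Adj u v) (hdis : ∀ k ∈ K, G.Adj u k → ¬ G.Adj v k)
    (he : e ∈ K) (hue : ¬ G.Adj u e) (hve : ¬ G.Adj v e)
    (hwu : ∀ k ∈ K, G.Adj w k ↔ G.Adj u k) : w = u := by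
  by_contra hne
  obtain ⟨r, hr, hur⟩ := hu.2
  obtain ⟨s, hs, hvs⟩ := hv.2
  have hus : ¬ G.Adj u s := fun h => hdis s hs h hvs
  have h1 : G.Adj w u := by
    by_contra h
    exact F.far_disjoint_of_not_adj hx hy hxy hw hu hne h hr ((hwu r hr).2 hur) hur
  have h2 : G.Adj w v := (F.edge_dominates h1 hs he hvs hve (fun h => hus ((hwu s hs).1 h)) hus
    (fun h => hue ((hwu e he).1 h)) hue hv.1.1).resolve_right huv
  exact huv (F.far_adj_of_same_type hx hy hxy hw hu hv hwu
    (fun k hk h => hdis k hk ((hwu k hk).1 h)) h2)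

theorem type_eq_singleton (F : MaxCliqueFrame G K) {x y u v w e : V}
    (hx : IsIsolatedFrom G K x) (hy : IsIsolatedFrom G K y) (hxy : G.Adj x y)
    (hu : IsFar G K u) (hv : IsFar G K v) (hw : IsFar G K w) (hne : u ≠ v)
    (huv : ¬ G.Adj u v) (he : e ∈ K) (hue : ¬ G.Adj u e) (hve : ¬ G.Adj v e)
    (hcov : ∀ k ∈ K, k ≠ e → G.Adj u k ∨ G.Adj v k) (hwu : w ≠ u) (hwv : w ≠ v) :
    ∀ k ∈ K, G.Adj w k ↔ k = e := by
  have hdis : ∀ k ∈ K, G.Adj u k → ¬ G.Adj v k := fun k hk h h' =>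
    F.far_disjoint_of_not_adj hx hy hxy hu hv hne huv hk h h'
  suffices h : ∀ k ∈ K, G.Adj w k → k = e by
    obtain ⟨s, hs, hws⟩ := hw.2
    intro k hk
    refine ⟨h k hk, ?_⟩
    rintro rfl
    exact h s hs hws ▸ hws
  have key : ∀ a b : V, IsFar G K a → IsFar G K b → ¬ G.Adj a b → a ≠ b →
      (∀ k ∈ K, G.Adj a k → ¬ G.Adj b k) → ¬ G.Adj a e → ¬ G.Adj b e → w ≠ a → w ≠ b →
      ∀ k ∈ K, G.Adj w k → ¬ G.Adj a k := by
    intro a b ha hb hab hne' hd hae hbe hwa hwb k hk hwk hak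
    have h1 : G.Adj w a := by
      by_contra h
      exact F.far_disjoint_of_not_adj hx hy hxy hw ha hwa h hk hwk hak
    rcases F.eq_or_cover h1 hk hwk hak with h | h
    · exact hwa (F.eq_of_same_type hx hy hxy ha hb hw hab hd he hae hbe h)
    · obtain ⟨s, hs, hbs⟩ := hb.2
      have hws := (h s hs).resolve_right fun h => hd s hs h hbs
      have hwe := (h e he).resolve_right hae
      have h2 : G.Adj w b := by
        by_contra h
        exact F.far_disjoint_of_not_adj hx hy hxy hw hb hwb h hs hws hbs
      rcases F.eq_or_cover h2 hs hws hbs with h' | h'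
      · exact hbe ((h' e he).1 hwe)
      · obtain ⟨p, hp, q, hq, hpq, hwp, hwq⟩ := hw.1.2
        exact hd p hp ((h p hp).resolve_left hwp) ((h' p hp).resolve_left hwp)
  intro k hk hwk
  by_contra hke
  rcases hcov k hk hke with h | h
  · exact key u v hu hv huv hne hdis hue hve hwu hwv k hk hwk h
  · exact key v u hv hu (fun h => huv h.symm) hne.symm (fun k hk h h' => hdis k hk h' h) hve hue
      hwv hwu k hk hwk h

theorem exists_unique_blocked (F : MaxCliqueFrame G K) (h4 : 4 ≤ K.card) {x y u v e : V}
    (hx : IsIsolatedFrom G K x) (hy : IsIsolatedFrom G K y) (hxy : G.Adj x y)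
    (hu : IsFar G K u) (hv : IsFar G K v)
    (hcov : ∀ k ∈ K, k ≠ e → G.Adj u k ∨ G.Adj v k) :
    ∃ b ∈ K, ∀ a ∈ K, a ≠ e → a ≠ b → ∀ m, IsNear G K m a → ¬ G.Adj x m := by
  classical
  have hxu := F.far_complete_isolated_edge hx hy hxy hu
  have hxv := F.far_complete_isolated_edge hx hy hxy hv
  have key : ∀ c d : V, IsFar G K c → IsFar G K d → G.Adj x c → G.Adj x d →
      (∀ k ∈ K, k ≠ e → G.Adj c k ∨ G.Adj d k) →
      (∃ s ∈ K, ∃ s' ∈ K, s ≠ s' ∧ G.Adj c s ∧ G.Adj c s') →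
      ∃ b ∈ K, ∀ a ∈ K, a ≠ e → a ≠ b → ∀ m, IsNear G K m a → ¬ G.Adj x m := by
    rintro c d hc hd hxc hxd hcd ⟨s, hs, s', hs', hss, hcs, hcs'⟩
    obtain ⟨b, hb, hdb⟩ := hd.2
    refine ⟨b, hb, fun a ha hae hab m hm => ?_⟩
    rcases hcd a ha hae with h | h
    · by_cases hsa : a = s
      · exact F.isolated_not_adj_near hx hc hxc ha hs' (hsa ▸ hss) h hcs' hm
      · exact F.isolated_not_adj_near hx hc hxc ha hs hsa h hcs hm
    · exact F.isolated_not_adj_near hx hd hxd ha hb hab h hdb hm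
  by_cases h : ∃ s ∈ K, ∃ s' ∈ K, s ≠ s' ∧ G.Adj u s ∧ G.Adj u s'
  · exact key u v hu hv hxu hxv hcov h
  · refine key v u hv hu hxv hxu (fun k hk hke => (hcov k hk hke).symm) ?_
    obtain ⟨s, hs, hus⟩ := hu.2
    have h1 : 1 < (K \ {e, s}).card := by
      have := Finset.le_card_sdiff {e, s} K
      have := Finset.card_le_two (a := e) (b := s)
      omega
    obtain ⟨p, hp, q, hq, hpq⟩ := Finset.one_lt_card.1 h1
    simp only [Finset.mem_sdiff, Finset.mem_insert, Finset.mem_singleton, not_or] at hp hq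
    refine ⟨p, hp.1, q, hq.1, hpq, ?_, ?_⟩
    · exact (hcov p hp.1 hp.2.1).resolve_left fun h' => h ⟨s, hs, p, hp.1, Ne.symm hp.2.2, hus, h'⟩
    · exact (hcov q hq.1 hq.2.1).resolve_left fun h' => h ⟨s, hs, q, hq.1, Ne.symm hq.2.2, hus, h'⟩

theorem colorable_succ_of_far_defect [Fintype V] (F : MaxCliqueFrame G K) (h4 : 4 ≤ K.card)
    {x y u v e : V} (hx : IsIsolatedFrom G K x) (hy : IsIsolatedFrom G K y) (hxy : G.Adj x y)
    (hu : IsFar G K u) (hv : IsFar G K v) (hne : u ≠ v)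
    (huv : ¬ G.Adj u v) (he : e ∈ K) (hue : ¬ G.Adj u e) (hve : ¬ G.Adj v e)
    (hcov : ∀ k ∈ K, k ≠ e → G.Adj u k ∨ G.Adj v k) : G.Colorable (K.card + 1) := by
  classical
  have htype : ∀ w, IsFar G K w → w ≠ u → w ≠ v → ∀ k ∈ K, G.Adj w k ↔ k = e := fun w hw =>
    F.type_eq_singleton hx hy hxy hu hv hw hne huv he hue hve hcov
  let X := Finset.univ.filter fun w => IsRest G K w ∧ w ≠ u ∧ w ≠ v
  have hX : ∀ w, w ∈ X ↔ IsRest G K w ∧ w ≠ u ∧ w ≠ v := by simp [X]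
  have hmiss : ∀ w ∈ X, ∀ k ∈ K, k ≠ e → ¬ G.Adj w k := by
    intro w hw k hk hke
    obtain ⟨hw, hwu, hwv⟩ := (hX w).1 hw
    rcases hw.isolated_or_far with h | h
    · exact h.2 k hk
    · exact fun h' => hke ((htype w h hwu hwv k hk).1 h')
  have hKe : (K.erase e).card + 1 = K.card := Finset.card_erase_add_one he
  obtain ⟨p, hp, q, hq, hpq⟩ := Finset.one_lt_card.1 (show 1 < (K.erase e).card by omega)
  simp only [Finset.mem_erase] at hp hq
  obtain ⟨f, hf, hf'⟩ := cluster_list_coloring (G := G) X (by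
      intro a ha b hb c hc
      exact F.adj_trans hp.2 hq.2 hpq (hmiss a ha p hp.2 hp.1) (hmiss b hb p hp.2 hp.1)
        (hmiss c hc p hp.2 hp.1) (hmiss a ha q hq.2 hq.1) (hmiss b hb q hq.2 hq.1)
        (hmiss c hc q hq.2 hq.1))
    (fun w => (freeColors G K w).erase (Sum.inl e)) (by
      intro R hR hcl
      have hfarlist : ∀ w ∈ R, IsFar G K w → ∀ k ∈ K, k ≠ e →
          Sum.inl k ∈ (freeColors G K w).erase (Sum.inl e) := by
        intro w hw hwf k hk hke
        refine Finset.mem_erase.2 ⟨by simpa using hke, hwf.inl_mem_freeColors.2 ⟨hk, ?_⟩⟩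
        exact hmiss w (hR hw) k hk hke
      have hisolist : ∀ t, IsIsolatedFrom G K t →
          Sum.inr 0 ∈ (freeColors G K t).erase (Sum.inl e) := fun t ht =>
        Finset.mem_erase.2 ⟨by simp, ht.inr_mem_freeColors⟩
      by_cases h1 : ∃ w ∈ R, IsFar G K w
      · obtain ⟨w, hwR, hw⟩ := h1
        by_cases h2 : ∃ t ∈ R, IsIsolatedFrom G K t
        · obtain ⟨t, htR, ht⟩ := h2
          have hsub : (K.erase e).disjSum {0} ⊆
              R.biUnion fun w => (freeColors G K w).erase (Sum.inl e) := by
            intro c hc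
            simp only [Finset.mem_disjSum, Finset.mem_erase, Finset.mem_singleton] at hc
            rcases hc with ⟨k, ⟨hke, hk⟩, rfl⟩ | ⟨i, rfl, rfl⟩
            · exact Finset.mem_biUnion.2 ⟨w, hwR, hfarlist w hwR hw k hk hke⟩
            · exact Finset.mem_biUnion.2 ⟨t, htR, hisolist t ht⟩
          have h3 := Finset.card_le_card hsub
          rw [Finset.card_disjSum, Finset.card_singleton] at h3
          have := F.max R hcl
          omega
        · push Not at h2
          have hsub : (K.erase e).disjSum (∅ : Finset ℕ) ⊆
              R.biUnion fun w => (freeColors G K w).erase (Sum.inl e) := by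
            intro c hc
            simp only [Finset.mem_disjSum, Finset.mem_erase, Finset.notMem_empty, false_and,
              exists_false, or_false] at hc
            obtain ⟨k, ⟨hke, hk⟩, rfl⟩ := hc
            exact Finset.mem_biUnion.2 ⟨w, hwR, hfarlist w hwR hw k hk hke⟩
          have h3 := Finset.card_le_card hsub
          rw [Finset.card_disjSum, Finset.card_empty] at h3
          have := F.card_add_one_le hcl (v := e) fun z hz => by
            obtain ⟨hz', hzu, hzv⟩ := (hX z).1 (hR hz)
            have hzf := hz'.isolated_or_far.resolve_left (h2 z hz)
            exact (htype z hzf hzu hzv e he).2 rfl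
          omega
      · push Not at h1
        have hiso : ∀ t ∈ R, IsIsolatedFrom G K t := fun t ht =>
          ((hX t).1 (hR ht)).1.isolated_or_far.resolve_right (h1 t ht)
        rcases R.eq_empty_or_nonempty with rfl | ⟨t, htR⟩
        · simp
        by_cases hone : ∃ t' ∈ R, t' ≠ t
        · obtain ⟨t', ht'R, htt⟩ := hone
          obtain ⟨b, hb, hblock⟩ := F.exists_unique_blocked h4 (hiso t htR) (hiso t' ht'R)
            (hcl htR ht'R htt.symm) hu hv hcov
          have hsub : ((K.erase e).erase b).disjSum {0} ⊆
              R.biUnion fun w => (freeColors G K w).erase (Sum.inl e) := by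
            intro c hc
            simp only [Finset.mem_disjSum, Finset.mem_erase, Finset.mem_singleton] at hc
            rcases hc with ⟨k, ⟨hkb, hke, hk⟩, rfl⟩ | ⟨i, rfl, rfl⟩
            · exact Finset.mem_biUnion.2 ⟨t, htR, Finset.mem_erase.2 ⟨by simpa using hke,
                ((hiso t htR).inl_mem_freeColors).2 ⟨hk, hblock k hk hke hkb⟩⟩⟩
            · exact Finset.mem_biUnion.2 ⟨t, htR, hisolist t (hiso t htR)⟩
          have h3 := Finset.card_le_card hsub
          rw [Finset.card_disjSum, Finset.card_singleton] at h3
          have h5 := Finset.pred_card_le_card_erase (s := K.erase e) (a := b)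
          have := F.card_add_one_le hcl (v := u) fun z hz => by
            by_cases hzt : z = t
            · exact hzt ▸ F.far_complete_isolated_edge (hiso t htR) (hiso t' ht'R)
                (hcl htR ht'R htt.symm) hu
            · exact F.far_complete_isolated_edge (hiso z hz) (hiso t htR) (hcl hz htR hzt) hu
          omega
        · push Not at hone
          have : R.card ≤ 1 := Finset.card_le_one.2 fun a ha b hb =>
            (hone a ha).trans (hone b hb).symm
          refine this.trans (Finset.card_pos.2 ⟨Sum.inr 0, ?_⟩)
          exact Finset.mem_biUnion.2 ⟨t, htR, hisolist t (hiso t htR)⟩)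
  refine F.colorable_of_freeColors (fun w => if w = u ∨ w = v then Sum.inl e else f w) ?_ ?_
  · intro w hw
    by_cases h : w = u ∨ w = v
    · simp only [h, if_true]
      rcases h with rfl | rfl
      · exact hu.inl_mem_freeColors.2 ⟨he, hue⟩
      · exact hv.inl_mem_freeColors.2 ⟨he, hve⟩
    · simp only [h, if_false]
      push Not at h
      exact Finset.mem_of_mem_erase (hf w ((hX w).2 ⟨hw, h⟩))
  · intro w z hw hz hwz
    have hsep : ∀ w, IsRest G K w → ¬ (w = u ∨ w = v) → f w ≠ Sum.inl e := by
      intro w hw h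
      push Not at h
      exact Finset.ne_of_mem_erase (hf w ((hX w).2 ⟨hw, h⟩))
    by_cases h : w = u ∨ w = v <;> by_cases h' : z = u ∨ z = v <;>
      simp only [h, h', if_true, if_false]
    · exfalso
      rcases h with rfl | rfl <;> rcases h' with rfl | rfl
      · exact hwz.ne rfl
      · exact huv hwz
      · exact huv hwz.symm
      · exact hwz.ne rfl
    · exact (hsep z hz h').symm
    · exact hsep w hw h
    · push Not at h h'
      exact hf' w ((hX w).2 ⟨hw, h⟩) z ((hX z).2 ⟨hz, h'⟩) hwz

theorem colorable_of_isolated_edge [Fintype V] (F : MaxCliqueFrame G K) {x y : V} {h : ℕ}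
    (h4 : 4 ≤ K.card) (h1 : 1 ≤ h) (hh : K.card ≤ 4 * h + 1)
    (hx : IsIsolatedFrom G K x) (hy : IsIsolatedFrom G K y) (hxy : G.Adj x y) :
    G.Colorable (K.card + h) := by
  classical
  by_cases hfar : ∀ u v, IsFar G K u → IsFar G K v → u ≠ v → G.Adj u v
  · exact (F.colorable_succ_of_far_clique (by omega) hx hy hxy hfar).mono (by omega)
  push Not at hfar
  obtain ⟨u, v, hu, hv, hne, huv⟩ := hfar
  by_cases hcov : ∀ k ∈ K, G.Adj u k ∨ G.Adj v k
  · exact F.colorable_of_far_cover h1 hh hx hy hxy hu hv hne huv hcov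
  · push Not at hcov
    obtain ⟨e, he, hue, hve⟩ := hcov
    refine (F.colorable_succ_of_far_defect h4 hx hy hxy hu hv hne huv he hue hve ?_).mono (by omega)
    intro k hk hke
    by_contra! hcon
    exact F.far_cover_of_not_adj hx hy hxy hu hv hne huv he hk hke.symm hue hcon.1 hve hcon.2

theorem type_trichotomy (F : MaxCliqueFrame G K) {x v : V}
    (hmax : (nbrIn G K v).card ≤ (nbrIn G K x).card) :
    (∀ k ∈ K, G.Adj v k → G.Adj x k) ∨ (∀ k ∈ K, G.Adj v k → ¬ G.Adj x k) ∨
      ∀ k ∈ K, ¬ G.Adj x k → G.Adj v k := by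
  by_cases h : ∃ k ∈ K, G.Adj v k ∧ G.Adj x k
  · obtain ⟨k, hk, hvk, hxk⟩ := h
    by_cases hvx : G.Adj v x
    · rcases F.eq_or_cover hvx hk hvk hxk with h | h
      · exact Or.inl fun k hk => (h k hk).1
      · exact Or.inr (Or.inr fun k hk hxk => (h k hk).resolve_right hxk)
    · rcases F.nested hvx hk hvk hxk with h | h
      · exact Or.inl h
      · have hsub : nbrIn G K x ⊆ nbrIn G K v := fun k hk => by
          rw [mem_nbrIn] at hk ⊢
          exact ⟨hk.1, h k hk.1 hk.2⟩
        have heq := Finset.eq_of_subset_of_card_le hsub hmax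
        refine Or.inl fun k hk hvk => ?_
        have : k ∈ nbrIn G K x := heq ▸ mem_nbrIn.2 ⟨hk, hvk⟩
        exact (mem_nbrIn.1 this).2
  · push Not at h
    exact Or.inr (Or.inl h)

/-- Two adjacent vertices whose types are contained in the type of `x` either both have the type
of `x`, or their types partition the type of `x`. -/
theorem edge_within_type (F : MaxCliqueFrame G K) {x c c' : V} (hx : IsFar G K x)
    (hc : IsFar G K c) (hc' : IsFar G K c') (hcx : ∀ k ∈ K, G.Adj c k → G.Adj x k)
    (hcx' : ∀ k ∈ K, G.Adj c' k → G.Adj x k) (hcc : G.Adj c c') :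
    (∀ k ∈ K, G.Adj x k → G.Adj c k ∧ G.Adj c' k) ∨
      ∀ k ∈ K, G.Adj x k → (G.Adj c k ↔ ¬ G.Adj c' k) := by
  obtain ⟨p, hp, -, -, -, hxp, -⟩ := hx.1.2
  have hcp : ¬ G.Adj c p := fun h => hxp (hcx p hp h)
  have hcp' : ¬ G.Adj c' p := fun h => hxp (hcx' p hp h)
  have hsub : ∀ b : V, IsFar G K b → (∀ k ∈ K, G.Adj b k → G.Adj x k) → G.Adj b x →
      ∀ k ∈ K, G.Adj x k → G.Adj b k := by
    intro b hb hbx hadj k hk hxk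
    obtain ⟨s, hs, hbs⟩ := hb.2
    rcases F.eq_or_cover hadj hs hbs (hbx s hs hbs) with h | h
    · exact (h k hk).2 hxk
    · exact absurd ((h p hp).resolve_right hxp) fun h => hxp (hbx p hp h)
  have hdom : ∀ k ∈ K, G.Adj x k → ¬ G.Adj c k → ¬ G.Adj c' k → False := by
    intro k hk hxk hck hck'
    rcases F.edge_dominates hcc hk hp hxk hxp hck hck' hcp hcp' hx.1.1 with h | h
    · exact hck (hsub c hc hcx h k hk hxk)
    · exact hck' (hsub c' hc' hcx' h k hk hxk)
  by_cases hcom : ∃ k ∈ K, G.Adj c k ∧ G.Adj c' k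
  · obtain ⟨s, hs, hcs, hcs'⟩ := hcom
    left
    intro k hk hxk
    have h1 : ∀ k ∈ K, G.Adj c k ↔ G.Adj c' k := by
      refine (F.eq_or_cover hcc hs hcs hcs').resolve_right fun h => ?_
      exact (h p hp).elim hcp hcp'
    have := hdom k hk hxk
    have := h1 k hk
    grind
  · push Not at hcom
    right
    intro k hk hxk
    have := hdom k hk hxk
    have := hcom k hk
    grind

/-- A clique of at least three vertices whose types are disjoint from the type of `x` and do not
cover the complement is complete to every edge between vertices of types contained in the type of
`x`. -/
theorem clique_complete_edge (F : MaxCliqueFrame G K) {x c c' d₀ : V} {D : Finset V}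
    (hx : IsFar G K x) (hc : IsFar G K c) (hc' : IsFar G K c')
    (hcx : ∀ k ∈ K, G.Adj c k → G.Adj x k) (hcx' : ∀ k ∈ K, G.Adj c' k → G.Adj x k)
    (hcc : G.Adj c c') (hD : G.IsClique (D : Set V)) (hD3 : 3 ≤ D.card)
    (hfar : ∀ d ∈ D, IsFar G K d) (hdx : ∀ d ∈ D, ∀ k ∈ K, G.Adj d k → ¬ G.Adj x k)
    (hpr : ∀ d ∈ D, ∃ p ∈ K, ¬ G.Adj x p ∧ ¬ G.Adj d p) (hd₀ : d₀ ∈ D) : G.Adj c d₀ := by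
  classical
  -- one end of the edge is adjacent to each vertex of the clique
  have hone : ∀ d ∈ D, G.Adj c d ∨ G.Adj c' d := by
    intro d hd
    obtain ⟨s, hs, hds⟩ := (hfar d hd).2
    obtain ⟨p, hp, hxp, hdp⟩ := hpr d hd
    have hxs := hdx d hd s hs hds
    exact F.edge_dominates hcc hs hp hds hdp (fun h => hxs (hcx s hs h))
      (fun h => hxs (hcx' s hs h))
      (fun h => hxp (hcx p hp h)) (fun h => hxp (hcx' p hp h)) (hfar d hd).1.1
  have hthird : ∀ d e, ∃ t ∈ D, t ≠ d ∧ t ≠ e := by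
    intro d e
    by_contra! h
    have : D ⊆ {d, e} := by
      intro t ht
      by_cases htd : t = d
      · simp [htd]
      · simp [h t ht htd]
    have := (Finset.card_le_card this).trans Finset.card_le_two
    omega
  have hdd : ∀ d ∈ D, ∀ e ∈ D, d ≠ e → G.Adj d e := fun d hd e he h => hD hd he h
  -- distinct types are disjoint
  have hdis : ∀ d ∈ D, ∀ e ∈ D, d ≠ e → (∀ k ∈ K, G.Adj d k ↔ G.Adj e k) ∨
      ∀ k ∈ K, G.Adj d k → ¬ G.Adj e k := by
    intro d hd e he hde
    by_contra! h
    obtain ⟨h1, k, hk, hdk, hek⟩ := h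
    rcases F.eq_or_cover (hdd d hd e he hde) hk hdk hek with h' | h'
    · obtain ⟨q, hq, hq'⟩ := h1
      have := h' q hq
      grind
    · obtain ⟨s, hs, hxs⟩ := hx.2
      exact (h' s hs).elim (fun h => hdx d hd s hs h hxs) (fun h => hdx e he s hs h hxs)
  -- two vertices of the clique missed by an end of the edge cover the complement of its type
  have htwo : ∀ b : V, IsFar G K b → ∀ d ∈ D, ∀ e ∈ D, d ≠ e →
      ¬ G.Adj b d → ¬ G.Adj b e → ∀ p ∈ K, ¬ G.Adj x p → ¬ G.Adj b p →
      (∀ k ∈ K, G.Adj b k → G.Adj x k) → G.Adj d p ∨ G.Adj e p := by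
    intro b hb d hd e he hde hbd hbe p hp hxp hbp hbx
    by_contra! h
    obtain ⟨s, hs, hbs⟩ := hb.2
    rcases F.edge_dominates (hdd d hd e he hde) hs hp hbs hbp
      (fun h => hdx d hd s hs h (hbx s hs hbs)) (fun h => hdx e he s hs h (hbx s hs hbs)) h.1 h.2
      hb.1.1 with hadj | hadj
    · exact hbd hadj.symm
    · exact hbe hadj.symm
  -- an end of the edge never misses a vertex whose type occurs twice in the clique
  have htypes : ∀ b b' : V, IsFar G K b → IsFar G K b' → (∀ k ∈ K, G.Adj b k → G.Adj x k) →
      (∀ k ∈ K, G.Adj b' k → G.Adj x k) → G.Adj b b' → (∀ d ∈ D, G.Adj b d ∨ G.Adj b' d) →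
      ∀ d ∈ D, ¬ G.Adj b d → ∀ e ∈ D, e ≠ d → ∀ k ∈ K, G.Adj d k → ¬ G.Adj e k := by
    intro b b' hb hb' hbx hbx' hbb hone d hd hbd e he hed
    by_contra hcon
    have hsame := (hdis d hd e he hed.symm).resolve_right hcon
    obtain ⟨s, hs, hds⟩ := (hfar d hd).2
    have hes := (hsame s hs).1 hds
    have hxs := hdx d hd s hs hds
    have hbs : ¬ G.Adj b s := fun h => hxs (hbx s hs h)
    have hbs' : ¬ G.Adj b' s := fun h => hxs (hbx' s hs h)
    have hbd' := (hone d hd).resolve_left hbd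
    have hdup : ∀ a : V, IsFar G K a → (∀ k ∈ K, G.Adj a k → G.Adj x k) → ∀ y ∈ D, ∀ z ∈ D,
        y ≠ z → (∀ k ∈ K, G.Adj y k ↔ G.Adj z k) → ¬ G.Adj a y → G.Adj a z := by
      intro a ha hax y hy z hz hyz hs hay
      by_contra haz
      obtain ⟨p, hp, hxp, hyp⟩ := hpr y hy
      rcases htwo a ha y hy z hz hyz hay haz p hp hxp (fun h => hxp (hax p hp h)) hax with h | h
      · exact hyp h
      · exact hyp ((hs p hp).2 h)
    have hbe := hdup b hb hbx d hd e he hed.symm hsame hbd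
    have hgem : ∀ e' ∈ D, e' ≠ d → G.Adj e' s → G.Adj b e' → ¬ G.Adj b' e' := by
      intro e' he' hne' hes' hbe' hbe''
      exact F.gem e' b b' d s hbe'.symm hbe''.symm (hdd e' he' d hd hne') hes' hbb hbd' hds hbd hbs
        hbs'
    have hbe' := hgem e he hed hes hbe
    obtain ⟨t, ht, htd, hte⟩ := hthird d e
    rcases hdis d hd t ht htd.symm with h | h
    · have hbt := hdup b hb hbx d hd t ht htd.symm h hbd
      have hbt' := hgem t ht htd ((h s hs).1 hds) hbt
      exact hbt' (hdup b' hb' hbx' e he t ht hte.symm (fun k hk => (hsame k hk).symm.trans (h k hk))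
        hbe')
    · have hts := h s hs hds
      rcases hone t ht with hbt | hbt'
      · exact F.gem e b t d s hbe.symm (hdd e he t ht hte.symm) (hdd e he d hd hed) hes hbt
          (hdd t ht d hd htd) hds hbd hbs hts
      · exact F.gem d b' t e s hbd'.symm (hdd d hd t ht htd.symm) (hdd d hd e he hed.symm) hds hbt'
          (hdd t ht e he hte) hes hbe' hbs' hts
  -- an end of the edge misses at most one vertex of the clique
  have hmiss : ∀ b b' : V, IsFar G K b → IsFar G K b' → (∀ k ∈ K, G.Adj b k → G.Adj x k) →
      (∀ k ∈ K, G.Adj b' k → G.Adj x k) → G.Adj b b' → (∀ d ∈ D, G.Adj b d ∨ G.Adj b' d) →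
      ∀ d ∈ D, ¬ G.Adj b d → ∀ e ∈ D, e ≠ d → G.Adj b e := by
    intro b b' hb hb' hbx hbx' hbb hone d hd hbd e he hed
    by_contra hbe
    have h1 := htypes b b' hb hb' hbx hbx' hbb hone d hd hbd
    have h2 := htypes b b' hb hb' hbx hbx' hbb hone e he hbe
    obtain ⟨t, ht, htd, hte⟩ := hthird d e
    obtain ⟨q, hq, htq⟩ := (hfar t ht).2
    have hxq := hdx t ht q hq htq
    rcases htwo b hb d hd e he hed.symm hbd hbe q hq hxq (fun h => hxq (hbx q hq h)) hbx with h | h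
    · exact h1 t ht htd q hq h htq
    · exact h2 t ht hte q hq h htq
  by_contra hcd
  have hcd' := (hone d₀ hd₀).resolve_left hcd
  have hone' : ∀ d ∈ D, G.Adj c' d ∨ G.Adj c d := fun d hd => (hone d hd).symm
  have hm := hmiss c c' hc hc' hcx hcx' hcc hone d₀ hd₀ hcd
  obtain ⟨d₁, hd₁, hne, hcd₁, hcd₁'⟩ : ∃ d₁ ∈ D, d₁ ≠ d₀ ∧ G.Adj c d₁ ∧ G.Adj c' d₁ := by
    obtain ⟨e, he, hed, -⟩ := hthird d₀ d₀
    by_cases h : G.Adj c' e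
    · exact ⟨e, he, hed, hm e he hed, h⟩
    · obtain ⟨t, ht, htd, hte⟩ := hthird d₀ e
      exact ⟨t, ht, htd, hm t ht htd,
        hmiss c' c hc' hc hcx' hcx hcc.symm hone' e he h t ht hte⟩
  have hdd₁ := hdd d₁ hd₁ d₀ hd₀ hne
  by_cases hcom : ∃ a ∈ K, G.Adj c a ∧ G.Adj c' a
  · obtain ⟨a, ha, hca, hca'⟩ := hcom
    have hxa := hcx a ha hca
    exact F.gem c' d₀ d₁ c a hcd' hcd₁' hcc.symm hca' hdd₁.symm hcd₁.symm hca
      (fun h => hcd h.symm) (fun h => hdx d₀ hd₀ a ha h hxa) (fun h => hdx d₁ hd₁ a ha h hxa)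
  · push Not at hcom
    obtain ⟨a, ha, hca⟩ := hc.2
    obtain ⟨a', ha', hca'⟩ := hc'.2
    have hnot : ∀ b : V, (∀ k ∈ K, G.Adj b k → G.Adj x k) → ∀ s ∈ K, G.Adj b s → ∀ t ∈ K,
        G.Adj x t → ¬ G.Adj b t → ¬ G.Adj b x := by
      intro b hbx s hs hbs t ht hxt hbt hadj
      rcases F.eq_or_cover hadj hs hbs (hbx s hs hbs) with h | h
      · exact hbt ((h t ht).2 hxt)
      · obtain ⟨p, hp, -, -, -, hxp, -⟩ := hx.1.2
        exact hxp ((h p hp).elim (hbx p hp) id)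
    have hca'' : ¬ G.Adj c a' := fun h => hcom a' ha' h hca'
    have hcx₁ := hnot c hcx a ha hca a' ha' (hcx' a' ha' hca') hca''
    have hcx₂ := hnot c' hcx' a' ha' hca' a ha (hcx a ha hca) (hcom a ha hca)
    have hadj : ∀ b : V, (∀ k ∈ K, G.Adj b k → G.Adj x k) → ∀ s ∈ K, G.Adj x s → ¬ G.Adj b s →
        ¬ G.Adj b x → ∀ d ∈ D, G.Adj b d → G.Adj d x := by
      intro b hbx s hs hxs hbs hbx' d hd hbd
      obtain ⟨p, hp, hxp, hdp⟩ := hpr d hd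
      exact (F.edge_dominates hbd hs hp hxs hxp hbs (fun h => hdx d hd s hs h hxs)
        (fun h => hxp (hbx p hp h)) hdp hx.1.1).resolve_left hbx'
    have e1 := hadj c hcx a' ha' (hcx' a' ha' hca') hca'' hcx₁ d₁ hd₁ hcd₁
    have e0 := hadj c' hcx' a ha (hcx a ha hca) (hcom a ha hca) hcx₂ d₀ hd₀ hcd'
    exact F.gem d₁ c c' d₀ x hcd₁.symm hcd₁'.symm hdd₁ e1 hcc hcd' e0 hcd hcx₁ hcx₂

/-- If the vertices anticomplete to `K` form a stable set, a list colouring of the far vertices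
extends with one additional colour. -/
theorem colorable_succ_of_far_coloring [Fintype V] (F : MaxCliqueFrame G K)
    (hst : ∀ s t, IsIsolatedFrom G K s → IsIsolatedFrom G K t → ¬ G.Adj s t) (g : V → V)
    (hg : ∀ u, IsFar G K u → g u ∈ K ∧ ¬ G.Adj u (g u))
    (hne : ∀ u v, IsFar G K u → IsFar G K v → G.Adj u v → g u ≠ g v) :
    G.Colorable (K.card + 1) := by
  classical
  let f : V → V ⊕ ℕ := fun u => if IsFar G K u then Sum.inl (g u) else Sum.inr 0
  have hfar : ∀ u, IsFar G K u → f u = Sum.inl (g u) := fun u hu => by simp [f, hu]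
  have hiso : ∀ u, IsIsolatedFrom G K u → f u = Sum.inr 0 := fun u hu => by simp [f, hu.not_far]
  refine F.colorable_of_rest 1 f ?_ ?_ ?_ ?_
  · intro u hu
    rcases hu.isolated_or_far with h | h
    · exact Or.inr ⟨0, one_pos, hiso u h⟩
    · exact Or.inl ⟨g u, (hg u h).1, hfar u h⟩
  · intro u a hu hua
    rcases hu.isolated_or_far with h | h
    · rw [hiso u h] at hua
      cases hua
    · rw [hfar u h] at hua
      cases hua
      exact (hg u h).2
  · intro u a m hu hua hk
    rw [hiso u ⟨hu.1, hk⟩] at hua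
    cases hua
  · intro u v hu hv huv
    rcases hu.isolated_or_far with h | h <;> rcases hv.isolated_or_far with h' | h'
    · exact absurd huv (hst u v h h')
    · rw [hiso u h, hfar v h']
      exact Sum.inr_ne_inl
    · rw [hfar u h, hiso v h']
      exact Sum.inl_ne_inr
    · rw [hfar u h, hfar v h']
      exact fun h'' => hne u v h h' huv (Sum.inl_injective h'')

theorem card_add_card_nbrIn_le (F : MaxCliqueFrame G K) {R : Finset V} {u : V}
    (hR : G.IsClique (R : Set V)) (h : ∀ r ∈ R, ∀ k ∈ K, G.Adj u k → G.Adj r k) :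
    R.card + (nbrIn G K u).card ≤ K.card :=
  F.card_add_card_le hR (F.isClique.subset (Finset.coe_subset.2 nbrIn_subset)) fun r hr k hk =>
    h r hr k (mem_nbrIn.1 hk).1 (mem_nbrIn.1 hk).2

theorem card_nbrIn_add_two_le (_F : MaxCliqueFrame G K) {u : V} (hu : IsRest G K u) :
    (nbrIn G K u).card + 2 ≤ K.card := by
  classical
  obtain ⟨-, p, hp, q, hq, hpq, hup, huq⟩ := hu
  have h1 : ({p, q} : Finset V) ⊆ K \ nbrIn G K u := by
    intro k hk
    simp only [Finset.mem_insert, Finset.mem_singleton] at hk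
    rcases hk with rfl | rfl <;> simp [*]
  have h2 := Finset.card_le_card h1
  rw [Finset.card_pair hpq, Finset.card_sdiff_of_subset nbrIn_subset] at h2
  omega

theorem card_within_type_le (F : MaxCliqueFrame G K) {x : V} {C : Finset V} (hx : IsFar G K x)
    (hC : G.IsClique (C : Set V)) (hfar : ∀ c ∈ C, IsFar G K c)
    (hcx : ∀ c ∈ C, ∀ k ∈ K, G.Adj c k → G.Adj x k) :
    C.card + (nbrIn G K x).card ≤ K.card := by
  by_cases h : ∀ c ∈ C, ∀ k ∈ K, G.Adj x k → G.Adj c k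
  · exact F.card_add_card_nbrIn_le hC h
  · push Not at h
    obtain ⟨c, hc, k, hk, hxk, hck⟩ := h
    have h2 : C.card ≤ 2 := by
      classical
      by_contra! h3
      have h4 : 1 < (C.erase c).card := by
        rw [Finset.card_erase_of_mem hc]
        omega
      obtain ⟨d, hd, e, he, hde⟩ := Finset.one_lt_card.1 h4
      obtain ⟨hdc, hd⟩ := Finset.mem_erase.1 hd
      obtain ⟨hec, he⟩ := Finset.mem_erase.1 he
      obtain ⟨s, hs, hcs⟩ := (hfar c hc).2
      have hxs := hcx c hc s hs hcs
      have h1 := F.edge_within_type hx (hfar c hc) (hfar d hd) (hcx c hc) (hcx d hd)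
        (hC hc hd hdc.symm)
      have h2 := F.edge_within_type hx (hfar c hc) (hfar e he) (hcx c hc) (hcx e he)
        (hC hc he hec.symm)
      have h3 := F.edge_within_type hx (hfar d hd) (hfar e he) (hcx d hd) (hcx e he) (hC hd he hde)
      have h1' := h1.resolve_left fun h => hck (h k hk hxk).1
      have h2' := h2.resolve_left fun h => hck (h k hk hxk).1
      have e1 := (h1' s hs hxs).1 hcs
      have e2 := (h2' s hs hxs).1 hcs
      rcases h3 with h3 | h3
      · exact e1 (h3 s hs hxs).1
      · exact e1 ((h3 s hs hxs).2 e2)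
    have := F.card_nbrIn_add_two_le hx.1
    omega

theorem card_add_card_within_type_le (F : MaxCliqueFrame G K) {x : V} {C D : Finset V}
    (hst : ∀ L, MaxCliqueFrame G L → ∀ s t, IsIsolatedFrom G L s → IsIsolatedFrom G L t →
      ¬ G.Adj s t)
    (hx : IsFar G K x) (hx2 : 2 ≤ (nbrIn G K x).card)
    (hC : G.IsClique (C : Set V)) (hCfar : ∀ c ∈ C, IsFar G K c)
    (hcx : ∀ c ∈ C, ∀ k ∈ K, G.Adj c k → G.Adj x k)
    (hD : G.IsClique (D : Set V)) (hD3 : 3 ≤ D.card)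
    (hDfar : ∀ d ∈ D, IsFar G K d) (hdx : ∀ d ∈ D, ∀ k ∈ K, G.Adj d k → ¬ G.Adj x k)
    (hpr : ∀ d ∈ D, ∃ p ∈ K, ¬ G.Adj x p ∧ ¬ G.Adj d p) : D.card + C.card ≤ K.card := by
  by_cases hC2 : 1 < C.card
  · refine F.card_add_card_le hD hC fun d hd c hc => ?_
    obtain ⟨c', hc', hne⟩ := Finset.exists_mem_ne hC2 c
    exact (F.clique_complete_edge hx (hCfar c hc) (hCfar c' hc') (hcx c hc) (hcx c' hc')
      (hC hc hc' hne.symm) hD hD3 hDfar hdx hpr hd).symm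
  · by_contra! hlt
    have hDK := F.max D hD
    obtain ⟨s, hs, t, ht, hst'⟩ := Finset.one_lt_card.1 hx2
    rw [mem_nbrIn] at hs ht
    have hD' : MaxCliqueFrame G D :=
      ⟨F.p2p3, F.gem, fun a ha b hb hab => hD ha hb hab, fun R hR => (F.max R hR).trans (by omega)⟩
    refine hst D hD' s t ⟨fun h => (hDfar s h).1.1 hs.1, fun d hd h => hdx d hd s hs.1 h.symm hs.2⟩
      ⟨fun h => (hDfar t h).1.1 ht.1, fun d hd h => hdx d hd t ht.1 h.symm ht.2⟩
      (F.clique s hs.1 t ht.1 hst')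

/-- Vertices of types disjoint from the type of `x`: two large same-type cliques of different
types are complete to each other. -/
theorem thick_complete (F : MaxCliqueFrame G K) {x : V} {R R' U U' : Finset V}
    (hx2 : 2 ≤ (nbrIn G K x).card) (hR : G.IsClique (R : Set V)) (hR' : G.IsClique (R' : Set V))
    (hfar : ∀ r ∈ R, IsFar G K r ∧ nbrIn G K r = U)
    (hfar' : ∀ r ∈ R', IsFar G K r ∧ nbrIn G K r = U')
    (hUx : ∀ k ∈ U, ¬ G.Adj x k) (hUx' : ∀ k ∈ U', ¬ G.Adj x k) (h2 : 2 ≤ R.card)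
    (h2' : 2 ≤ R'.card) (hUU : U ≠ U') : ∀ r ∈ R, ∀ r' ∈ R', G.Adj r r' := by
  obtain ⟨s, hs, t, ht, hst⟩ := Finset.one_lt_card.1 hx2
  rw [mem_nbrIn] at hs ht
  have key : ∀ A B X Y : Finset V, G.IsClique (A : Set V) → 2 ≤ A.card →
      (∀ r ∈ A, IsFar G K r ∧ nbrIn G K r = X) → (∀ r ∈ B, IsFar G K r ∧ nbrIn G K r = Y) →
      (∀ k ∈ X, ¬ G.Adj x k) → (∀ k ∈ Y, ¬ G.Adj x k) → ¬ Y ⊆ X →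
      ∀ a ∈ A, ∀ b ∈ B, G.Adj a b := by
    intro A B X Y hA hA2 hAX hBY hXx hYx hYX a ha b hb
    obtain ⟨k, hkY, hkX⟩ := Finset.not_subset.1 hYX
    have hX : ∀ a ∈ A, ∀ k, k ∈ X ↔ k ∈ K ∧ G.Adj a k := fun a ha k => by
      rw [← (hAX a ha).2, mem_nbrIn]
    have hY : ∀ b ∈ B, ∀ k, k ∈ Y ↔ k ∈ K ∧ G.Adj b k := fun b hb k => by
      rw [← (hBY b hb).2, mem_nbrIn]
    have hAs : ∀ a ∈ A, ∀ s ∈ K, G.Adj x s → ¬ G.Adj a s := fun a ha s hs hxs h =>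
      hXx s ((hX a ha s).2 ⟨hs, h⟩) hxs
    have hBs : ∀ s ∈ K, G.Adj x s → ¬ G.Adj b s := fun s hs hxs h =>
      hYx s ((hY b hb s).2 ⟨hs, h⟩) hxs
    have hk := (hY b hb k).1 hkY
    have hkA : ∀ a ∈ A, ¬ G.Adj a k := fun a ha h => hkX ((hX a ha k).2 ⟨hk.1, h⟩)
    obtain ⟨a', ha', hne⟩ := Finset.exists_mem_ne (by omega : 1 < A.card) a
    rcases F.edge_dominates (hA ha ha' hne.symm) hk.1 hs.1 hk.2 (hBs s hs.1 hs.2) (hkA a ha)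
      (hkA a' ha') (hAs a ha s hs.1 hs.2) (hAs a' ha' s hs.1 hs.2) (hBY b hb).1.1.1 with h | h
    · exact h
    · refine F.adj_trans hs.1 ht.1 hst (hAs a ha s hs.1 hs.2) (hAs a' ha' s hs.1 hs.2)
        (hBs s hs.1 hs.2) (hAs a ha t ht.1 ht.2) (hAs a' ha' t ht.1 ht.2) (hBs t ht.1 ht.2)
        (hA ha ha' hne.symm) h ?_
      rintro rfl
      exact hkA a ha hk.2
  intro r hr r' hr'
  by_cases h : U' ⊆ U
  · exact (key R' R U' U hR' h2' hfar' hfar hUx' hUx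
      (fun h' => hUU (h'.antisymm h)) r' hr' r hr).symm
  · exact key R R' U U' hR h2 hfar hfar' hUx hUx' h r hr r' hr'

end MaxCliqueFrame

theorem exists_max_clique_subset {V : Type*} (G : SimpleGraph V) (X : Finset V) :
    ∃ C ⊆ X, G.IsClique (C : Set V) ∧ ∀ R ⊆ X, G.IsClique (R : Set V) → R.card ≤ C.card := by
  classical
  obtain ⟨C, hC, hmax⟩ := Finset.exists_max_image
    (X.powerset.filter fun R : Finset V => G.IsClique (R : Set V)) Finset.card ⟨∅, by simp⟩
  rw [Finset.mem_filter, Finset.mem_powerset] at hC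
  exact ⟨C, hC.1, hC.2, fun R hR hcl =>
    hmax R (Finset.mem_filter.2 ⟨Finset.mem_powerset.2 hR, hcl⟩)⟩

namespace MaxCliqueFrame
variable {V : Type*} {G : SimpleGraph V} {K : Finset V}

/-- A palette for the vertices with types inside the type of `x` which leaves enough colours for
every large clique of vertices sharing a type disjoint from the type of `x`. -/
theorem exists_palette [DecidableEq V] (F : MaxCliqueFrame G K) {x : V} {γ : ℕ}
    (hx2 : 2 ≤ (nbrIn G K x).card)
    (hmax : ∀ u, IsFar G K u → (nbrIn G K u).card ≤ (nbrIn G K x).card)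
    (hγ : γ ≤ (K \ nbrIn G K x).card)
    (hD : ∀ D : Finset V, G.IsClique (D : Set V) → 3 ≤ D.card → (∀ d ∈ D, IsFar G K d) →
      (∀ d ∈ D, ∀ k ∈ K, G.Adj d k → ¬ G.Adj x k) →
      (∀ d ∈ D, ∃ p ∈ K, ¬ G.Adj x p ∧ ¬ G.Adj d p) → D.card + γ ≤ K.card) :
    ∃ P ⊆ K \ nbrIn G K x, P.card = γ ∧ ∀ R U : Finset V, G.IsClique (R : Set V) →
      (∀ r ∈ R, IsFar G K r ∧ nbrIn G K r = U) → (∀ k ∈ U, ¬ G.Adj x k) →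
      (nbrIn G K x).card < R.card → R.card + (P ∪ U).card ≤ K.card := by
  have hKS : (K \ nbrIn G K x).card = K.card - (nbrIn G K x).card :=
    Finset.card_sdiff_of_subset nbrIn_subset
  -- facts about large cliques of a common type
  have key : ∀ R U : Finset V, G.IsClique (R : Set V) →
      (∀ r ∈ R, IsFar G K r ∧ nbrIn G K r = U) → (∀ k ∈ U, ¬ G.Adj x k) →
      (nbrIn G K x).card < R.card → R.card + U.card ≤ K.card ∧ U ⊆ K \ nbrIn G K x ∧
      U.card ≤ (nbrIn G K x).card ∧ ∃ p ∈ K, ¬ G.Adj x p ∧ p ∉ U := by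
    intro R U hR hRU hUx hlt
    obtain ⟨r, hr⟩ := Finset.card_pos.1 (by omega : 0 < R.card)
    have h1 : R.card + U.card ≤ K.card := by
      rw [← (hRU r hr).2]
      refine F.card_add_card_nbrIn_le hR fun r' hr' k hk hrk => ?_
      have : k ∈ nbrIn G K r' := by
        rw [(hRU r' hr').2, ← (hRU r hr).2]
        exact mem_nbrIn.2 ⟨hk, hrk⟩
      exact (mem_nbrIn.1 this).2
    have h2 : U ⊆ K \ nbrIn G K x := by
      intro k hk
      have h' : k ∈ nbrIn G K r := (hRU r hr).2.symm ▸ hk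
      exact Finset.mem_sdiff.2 ⟨(mem_nbrIn.1 h').1, fun h => hUx k hk (mem_nbrIn.1 h).2⟩
    refine ⟨h1, h2, (hRU r hr).2 ▸ hmax r (hRU r hr).1, ?_⟩
    obtain ⟨p, hp, hpU⟩ := Finset.exists_mem_notMem_of_card_lt_card
      (by omega : U.card < (K \ nbrIn G K x).card)
    rw [Finset.mem_sdiff] at hp
    exact ⟨p, hp.1, fun h => hp.2 (mem_nbrIn.2 ⟨hp.1, h⟩), hpU⟩
  have hadj : ∀ R U : Finset V, (∀ r ∈ R, IsFar G K r ∧ nbrIn G K r = U) → ∀ r ∈ R, ∀ k ∈ K,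
      G.Adj r k → k ∈ U := fun R U hRU r hr k hk h => by
    rw [← (hRU r hr).2]
    exact mem_nbrIn.2 ⟨hk, h⟩
  by_cases hex : ∃ R U : Finset V, G.IsClique (R : Set V) ∧
      (∀ r ∈ R, IsFar G K r ∧ nbrIn G K r = U) ∧ (∀ k ∈ U, ¬ G.Adj x k) ∧
      (nbrIn G K x).card < R.card
  · obtain ⟨R₀, U₀, hR₀, hRU₀, hUx₀, hlt₀⟩ := hex
    obtain ⟨e1, e2, e3, p₀, hp₀, hxp₀, hpU₀⟩ := key R₀ U₀ hR₀ hRU₀ hUx₀ hlt₀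
    obtain ⟨P, hPs, hPc, hPU⟩ : ∃ P ⊆ K \ nbrIn G K x, P.card = γ ∧ (P ⊆ U₀ ∨ U₀ ⊆ P) := by
      rcases le_total γ U₀.card with h | h
      · obtain ⟨P, hP, hPc⟩ := Finset.exists_subset_card_eq h
        exact ⟨P, hP.trans e2, hPc, Or.inl hP⟩
      · obtain ⟨P, hP, hP', hPc⟩ := Finset.exists_subsuperset_card_eq e2 h hγ
        exact ⟨P, hP', hPc, Or.inr hP⟩
    refine ⟨P, hPs, hPc, fun R U hR hRU hUx hlt => ?_⟩
    obtain ⟨f1, f2, f3, p, hp, hxp, hpU⟩ := key R U hR hRU hUx hlt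
    by_cases hUU : U = U₀
    · subst hUU
      rcases hPU with h | h
      · rwa [Finset.union_eq_right.2 h]
      · rw [Finset.union_eq_left.2 h, hPc]
        refine hD R hR (by omega) (fun d hd => (hRU d hd).1)
          (fun d hd k hk h => hUx k (hadj R U hRU d hd k hk h))
          fun d hd => ⟨p, hp, hxp, fun h => ?_⟩
        exact hpU (hadj R U hRU d hd p hp h)
    · have hc := F.thick_complete hx2 hR hR₀ hRU hRU₀ hUx hUx₀ (by omega) (by omega) hUU
      have hdis : Disjoint R R₀ := Finset.disjoint_left.2 fun r hr hr₀ =>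
        hUU ((hRU r hr).2.symm.trans (hRU₀ r hr₀).2)
      have hcl : G.IsClique ((R ∪ R₀ : Finset V) : Set V) := by
        intro a ha b hb hab
        simp only [Finset.coe_union, Set.mem_union, Finset.mem_coe] at ha hb
        rcases ha with ha | ha <;> rcases hb with hb | hb
        · exact hR ha hb hab
        · exact hc a ha b hb
        · exact (hc b hb a ha).symm
        · exact hR₀ ha hb hab
      have hcard := Finset.card_union_of_disjoint hdis
      have := hD (R ∪ R₀) hcl (by omega) ?_ ?_ ?_
      · have := Finset.card_union_le P U
        omega
      · intro d hd
        rcases Finset.mem_union.1 hd with hd | hd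
        exacts [(hRU d hd).1, (hRU₀ d hd).1]
      · intro d hd k hk h
        rcases Finset.mem_union.1 hd with hd | hd
        exacts [hUx k (hadj R U hRU d hd k hk h), hUx₀ k (hadj R₀ U₀ hRU₀ d hd k hk h)]
      · intro d hd
        rcases Finset.mem_union.1 hd with hd | hd
        exacts [⟨p, hp, hxp, fun h => hpU (hadj R U hRU d hd p hp h)⟩,
          ⟨p₀, hp₀, hxp₀, fun h => hpU₀ (hadj R₀ U₀ hRU₀ d hd p₀ hp₀ h)⟩]
  · push Not at hex
    obtain ⟨P, hP, hPc⟩ := Finset.exists_subset_card_eq hγ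
    exact ⟨P, hP, hPc, fun R U hR hRU hUx hlt => absurd hlt (hex R U hR hRU hUx).not_gt⟩

/-- If some far vertex has at least two neighbours in `K`, one extra colour suffices. -/
theorem colorable_succ_of_two_le [Fintype V] (F : MaxCliqueFrame G K) {x : V}
    (hst : ∀ L, MaxCliqueFrame G L → ∀ s t, IsIsolatedFrom G L s → IsIsolatedFrom G L t →
      ¬ G.Adj s t)
    (hx : IsFar G K x) (hx2 : 2 ≤ (nbrIn G K x).card)
    (hmax : ∀ u, IsFar G K u → (nbrIn G K u).card ≤ (nbrIn G K x).card) :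
    G.Colorable (K.card + 1) := by
  classical
  have : Nonempty V := ⟨x⟩
  obtain ⟨p, hp, q, hq, hpq, hxp, hxq⟩ := hx.1.2
  obtain ⟨s, hs, t, ht, hst'⟩ := Finset.one_lt_card.1 hx2
  rw [mem_nbrIn] at hs ht
  set Z := Finset.univ.filter fun u => IsFar G K u ∧ ∀ k ∈ K, G.Adj u k → G.Adj x k with hZ
  set Y := Finset.univ.filter fun u => IsFar G K u ∧ (∀ k ∈ K, G.Adj u k → ¬ G.Adj x k) ∧
    ∃ p ∈ K, ¬ G.Adj x p ∧ ¬ G.Adj u p with hY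
  have hmemZ : ∀ u, u ∈ Z ↔ IsFar G K u ∧ ∀ k ∈ K, G.Adj u k → G.Adj x k := by simp [hZ]
  have hmemY : ∀ u, u ∈ Y ↔ IsFar G K u ∧ (∀ k ∈ K, G.Adj u k → ¬ G.Adj x k) ∧
    ∃ p ∈ K, ¬ G.Adj x p ∧ ¬ G.Adj u p := by simp [hY]
  clear_value Z Y
  -- every other far vertex is adjacent to all non-neighbours of `x` in `K`
  have hbig : ∀ u, IsFar G K u → u ∉ Z → u ∉ Y → ∀ k ∈ K, ¬ G.Adj x k → G.Adj u k := by
    intro u hu huZ huY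
    rcases F.type_trichotomy (hmax u hu) with h | h | h
    · exact absurd ((hmemZ u).2 ⟨hu, h⟩) huZ
    · by_contra! hcon
      exact huY ((hmemY u).2 ⟨hu, h, hcon⟩)
    · exact h
  obtain ⟨C, hCZ, hC, hCmax⟩ := exists_max_clique_subset G Z
  have hCfar : ∀ c ∈ C, IsFar G K c := fun c hc => ((hmemZ c).1 (hCZ hc)).1
  have hCx : ∀ c ∈ C, ∀ k ∈ K, G.Adj c k → G.Adj x k := fun c hc => ((hmemZ c).1 (hCZ hc)).2
  have hCcard := F.card_within_type_le hx hC hCfar hCx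
  have hD : ∀ D : Finset V, G.IsClique (D : Set V) → 3 ≤ D.card → (∀ d ∈ D, IsFar G K d) →
      (∀ d ∈ D, ∀ k ∈ K, G.Adj d k → ¬ G.Adj x k) →
      (∀ d ∈ D, ∃ p ∈ K, ¬ G.Adj x p ∧ ¬ G.Adj d p) → D.card + C.card ≤ K.card :=
    fun D h1 h2 h3 h4 h5 => F.card_add_card_within_type_le hst hx hx2 hC hCfar hCx h1 h2 h3 h4 h5
  obtain ⟨P, hPK, hPcard, hP⟩ := F.exists_palette hx2 hmax (γ := C.card) (by
    rw [Finset.card_sdiff_of_subset nbrIn_subset]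
    omega) hD
  have hPx : ∀ k ∈ P, k ∈ K ∧ ¬ G.Adj x k := by
    intro k hk
    have := Finset.mem_sdiff.1 (hPK hk)
    exact ⟨this.1, fun h => this.2 (mem_nbrIn.2 ⟨this.1, h⟩)⟩
  -- colouring of the vertices with types inside the type of `x`
  obtain ⟨fZ, hfZ, hfZ'⟩ := cluster_list_coloring (G := G) Z (by
    intro a ha b hb c hc hab hbc hac
    rw [hmemZ] at ha hb hc
    exact F.adj_trans hp hq hpq (fun h => hxp (ha.2 p hp h)) (fun h => hxp (hb.2 p hp h))
      (fun h => hxp (hc.2 p hp h)) (fun h => hxq (ha.2 q hq h)) (fun h => hxq (hb.2 q hq h))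
      (fun h => hxq (hc.2 q hq h)) hab hbc hac) (fun _ => P) (by
    intro R hR hcl
    rcases R.eq_empty_or_nonempty with rfl | ⟨r, hr⟩
    · simp
    · exact ((hCmax R hR hcl).trans_eq hPcard.symm).trans
        (Finset.card_le_card (Finset.subset_biUnion_of_mem (fun _ => P) hr)))
  -- colouring of the vertices with types disjoint from the type of `x`
  obtain ⟨fY, hfY, hfY'⟩ := cluster_list_coloring (G := G) Y (by
    intro a ha b hb c hc hab hbc hac
    rw [hmemY] at ha hb hc
    exact F.adj_trans hs.1 ht.1 hst' (fun h => ha.2.1 s hs.1 h hs.2) (fun h => hb.2.1 s hs.1 h hs.2)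
      (fun h => hc.2.1 s hs.1 h hs.2) (fun h => ha.2.1 t ht.1 h ht.2)
      (fun h => hb.2.1 t ht.1 h ht.2) (fun h => hc.2.1 t ht.1 h ht.2) hab hbc hac)
    (fun y => (K \ P) \ nbrIn G K y) (by
    intro R hR hcl
    rcases R.eq_empty_or_nonempty with rfl | ⟨r, hr⟩
    · simp
    have hRY : ∀ d ∈ R, _ := fun d hd => (hmemY d).1 (hR hd)
    have hsub := Finset.subset_biUnion_of_mem (fun y => (K \ P) \ nbrIn G K y) hr
    rcases le_or_gt R.card (nbrIn G K x).card with hle | hlt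
    · refine hle.trans ((Finset.card_le_card ?_).trans (Finset.card_le_card hsub))
      intro k hk
      rw [mem_nbrIn] at hk
      refine Finset.mem_sdiff.2 ⟨Finset.mem_sdiff.2 ⟨hk.1, fun h => (hPx k h).2 hk.2⟩, fun h => ?_⟩
      exact (hRY r hr).2.1 k hk.1 (mem_nbrIn.1 h).2 hk.2
    by_cases hsame : ∀ r' ∈ R, nbrIn G K r' = nbrIn G K r
    · refine le_trans ?_ (Finset.card_le_card hsub)
      have h1 := hP R (nbrIn G K r) hcl (fun r' hr' => ⟨(hRY r' hr').1, hsame r' hr'⟩)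
        (fun k hk => (hRY r hr).2.1 k (mem_nbrIn.1 hk).1 (mem_nbrIn.1 hk).2) hlt
      have h2 : ((K \ P) \ nbrIn G K r).card = K.card - (P ∪ nbrIn G K r).card := by
        rw [sdiff_sdiff_left, Finset.sup_eq_union, Finset.card_sdiff_of_subset]
        exact Finset.union_subset (fun k hk => (hPx k hk).1) nbrIn_subset
      omega
    · push Not at hsame
      obtain ⟨r', hr', hne⟩ := hsame
      have hsub' := Finset.subset_biUnion_of_mem (fun y => (K \ P) \ nbrIn G K y) hr'
      have h1 := hD R hcl (by omega) (fun d hd => (hRY d hd).1) (fun d hd => (hRY d hd).2.1)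
        fun d hd => (hRY d hd).2.2
      have h2 : (K \ P).card = K.card - C.card := by
        rw [Finset.card_sdiff_of_subset fun k hk => (hPx k hk).1, hPcard]
      have hrr : G.Adj r r' := hcl hr hr' fun h => hne (by rw [h])
      have h3 : K \ P ⊆ R.biUnion fun y => (K \ P) \ nbrIn G K y := by
        intro k hk
        by_cases hkr : k ∈ nbrIn G K r
        · refine hsub' (Finset.mem_sdiff.2 ⟨hk, fun hkr' => ?_⟩)
          rw [mem_nbrIn] at hkr hkr'
          rcases F.eq_or_cover hrr hkr.1 hkr.2 hkr'.2 with h | h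
          · refine hne (Finset.ext fun k => ?_)
            simp only [mem_nbrIn]
            exact and_congr_right fun hk => (h k hk).symm
          · exact (h s hs.1).elim (fun h => (hRY r hr).2.1 s hs.1 h hs.2)
              fun h => (hRY r' hr').2.1 s hs.1 h hs.2
        · exact hsub (Finset.mem_sdiff.2 ⟨hk, hkr⟩)
      have := Finset.card_le_card h3
      omega)
  -- colouring of the vertices of a fixed type
  have hfB : ∀ U : Finset V, ∃ f : V → V, (∀ v, IsFar G K v → nbrIn G K v = U → f v ∈ K \ U) ∧
      ∀ u v, IsFar G K u → nbrIn G K u = U → IsFar G K v → nbrIn G K v = U → G.Adj u v →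
        f u ≠ f v := by
    intro U
    have hm : ∀ u, u ∈ Finset.univ.filter (fun u => IsFar G K u ∧ nbrIn G K u = U) ↔
      IsFar G K u ∧ nbrIn G K u = U := by simp
    have hmiss : ∀ u w k, nbrIn G K u = U → nbrIn G K w = U → k ∈ K → ¬ G.Adj u k →
        ¬ G.Adj w k := by
      intro u w k hu hw hk huk hwk
      have : k ∈ nbrIn G K u := hu.trans hw.symm ▸ mem_nbrIn.2 ⟨hk, hwk⟩
      exact huk (mem_nbrIn.1 this).2
    obtain ⟨f, hf, hf'⟩ := cluster_list_coloring (G := G)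
      (Finset.univ.filter fun u => IsFar G K u ∧ nbrIn G K u = U) (by
        intro a ha b hb c hc hab hbc hac
        rw [hm] at ha hb hc
        obtain ⟨k, hk, l, hl, hkl, hak, hal⟩ := ha.1.1.2
        exact F.adj_trans hk hl hkl hak (hmiss a b k ha.2 hb.2 hk hak)
          (hmiss a c k ha.2 hc.2 hk hak) hal (hmiss a b l ha.2 hb.2 hl hal)
          (hmiss a c l ha.2 hc.2 hl hal) hab hbc hac) (fun _ => K \ U) (by
        intro R hR hcl
        rcases R.eq_empty_or_nonempty with rfl | ⟨r, hr⟩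
        · simp
        refine le_trans ?_ (Finset.card_le_card
          (Finset.subset_biUnion_of_mem (fun _ => K \ U) hr))
        have h1 := F.card_add_card_nbrIn_le hcl (u := r) (by
          intro r' hr' k hk hrk
          by_contra hcon
          exact hmiss r' r k ((hm _).1 (hR hr')).2 ((hm _).1 (hR hr)).2 hk hcon hrk)
        have h2 := ((hm _).1 (hR hr)).2
        rw [← h2, Finset.card_sdiff_of_subset nbrIn_subset]
        omega)
    exact ⟨f, fun v hv hU => hf v ((hm v).2 ⟨hv, hU⟩), fun u v hu hU hv hU' =>
      hf' u ((hm u).2 ⟨hu, hU⟩) v ((hm v).2 ⟨hv, hU'⟩)⟩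
  choose fB hfB hfB' using hfB
  have hBmem : ∀ u, IsFar G K u → fB (nbrIn G K u) u ∈ K ∧ ¬ G.Adj u (fB (nbrIn G K u) u) := by
    intro u hu
    have := Finset.mem_sdiff.1 (hfB _ u hu rfl)
    exact ⟨this.1, fun h => this.2 (mem_nbrIn.2 ⟨this.1, h⟩)⟩
  have hZY : ∀ u ∈ Z, ∀ v ∈ Y, fZ u ≠ fY v := by
    intro u hu v hv h
    have h1 := hfZ u hu
    have h2 := hfY v hv
    rw [← h, Finset.mem_sdiff, Finset.mem_sdiff] at h2
    exact h2.1.2 h1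
  have hZB : ∀ u ∈ Z, ∀ v, IsFar G K v → v ∉ Z → v ∉ Y → fZ u ≠ fB (nbrIn G K v) v := by
    intro u hu v hv hvZ hvY h
    have h1 := hPx _ (hfZ u hu)
    rw [h] at h1
    exact (hBmem v hv).2 (hbig v hv hvZ hvY _ h1.1 h1.2)
  have hYB : ∀ u ∈ Y, ∀ v, IsFar G K v → v ∉ Z → v ∉ Y → ¬ G.Adj u v := by
    intro u hu v hv hvZ hvY h
    rw [hmemY] at hu
    obtain ⟨hu, hux, p', hp', hxp', hup'⟩ := hu
    obtain ⟨k, hk, huk⟩ := hu.2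
    have hB := hbig v hv hvZ hvY
    rcases F.eq_or_cover h hk huk (hB k hk (hux k hk huk)) with h | h
    · exact hup' ((h p' hp').2 (hB p' hp' hxp'))
    · obtain ⟨a, ha, hva⟩ := F.exists_not_adj hv.1.1
      by_cases hxa : G.Adj x a
      · exact (h a ha).elim (fun h => hux a ha h hxa) hva
      · exact hva (hB a ha hxa)
  have hBB : ∀ u v, IsFar G K u → u ∉ Z → u ∉ Y → IsFar G K v → v ∉ Z → v ∉ Y → G.Adj u v →
      fB (nbrIn G K u) u ≠ fB (nbrIn G K v) v := by
    intro u v hu huZ huY hv hvZ hvY huv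
    rcases F.eq_or_cover huv hp (hbig u hu huZ huY p hp hxp) (hbig v hv hvZ hvY p hp hxp)
      with h | h
    · have he : nbrIn G K u = nbrIn G K v := Finset.ext fun k => by
        simp only [mem_nbrIn]
        exact and_congr_right fun hk => h k hk
      rw [he]
      exact hfB' _ u v hu he hv rfl huv
    · intro heq
      refine (h _ (hBmem u hu).1).elim (hBmem u hu).2 fun h' => ?_
      rw [heq] at h'
      exact (hBmem v hv).2 h'
  refine F.colorable_succ_of_far_coloring (hst K F)
    (fun u => if u ∈ Z then fZ u else if u ∈ Y then fY u else fB (nbrIn G K u) u) ?_ ?_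
  · intro u hu
    by_cases huZ : u ∈ Z
    · simp only [huZ, if_true]
      have h1 := hPx _ (hfZ u huZ)
      exact ⟨h1.1, fun h => h1.2 (((hmemZ u).1 huZ).2 _ h1.1 h)⟩
    by_cases huY : u ∈ Y
    · simp only [huZ, huY, if_true, if_false]
      have h1 := hfY u huY
      rw [Finset.mem_sdiff, Finset.mem_sdiff, mem_nbrIn] at h1
      exact ⟨h1.1.1, fun h => h1.2 ⟨h1.1.1, h⟩⟩
    · simp only [huZ, huY, if_false]
      exact hBmem u hu
  · intro u v hu hv huv
    by_cases huZ : u ∈ Z <;> by_cases hvZ : v ∈ Z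
    · simpa only [huZ, hvZ, if_true] using hfZ' u huZ v hvZ huv
    · by_cases hvY : v ∈ Y
      · simpa only [huZ, hvZ, hvY, if_true, if_false] using hZY u huZ v hvY
      · simpa only [huZ, hvZ, hvY, if_true, if_false] using hZB u huZ v hv hvZ hvY
    · by_cases huY : u ∈ Y
      · simpa only [huZ, hvZ, huY, if_true, if_false] using (hZY v hvZ u huY).symm
      · simpa only [huZ, hvZ, huY, if_true, if_false] using (hZB v hvZ u hu huZ huY).symm
    · by_cases huY : u ∈ Y <;> by_cases hvY : v ∈ Y
      · simpa only [huZ, hvZ, huY, hvY, if_true, if_false] using hfY' u huY v hvY huv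
      · exact absurd huv (hYB u huY v hv hvZ hvY)
      · exact absurd huv.symm (hYB v hvY u hu huZ huY)
      · simpa only [huZ, hvZ, huY, hvY, if_false] using hBB u v hu huZ huY hv hvZ hvY huv

theorem exists_pair_avoiding (h4 : 4 ≤ K.card) (a b : V) :
    ∃ c ∈ K, ∃ d ∈ K, c ≠ d ∧ c ≠ a ∧ c ≠ b ∧ d ≠ a ∧ d ≠ b := by
  classical
  have h1 := Finset.pred_card_le_card_erase (s := K) (a := a)
  have h2 := Finset.pred_card_le_card_erase (s := K.erase a) (a := b)
  obtain ⟨c, hc, d, hd, hcd⟩ := Finset.one_lt_card.1 (by omega : 1 < ((K.erase a).erase b).card)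
  simp only [Finset.mem_erase] at hc hd
  exact ⟨c, hc.2.2, d, hd.2.2, hcd, hc.2.1, hc.1, hd.2.1, hd.1⟩

/-- Vertices attached to one of two vertices of `K` induce a disjoint union of cliques. -/
theorem adj_trans_of_attached (F : MaxCliqueFrame G K) (h4 : 4 ≤ K.card) {τ : V → V}
    (hτ : ∀ u, IsFar G K u → τ u ∈ K ∧ ∀ k ∈ K, G.Adj u k ↔ k = τ u) {a b x y z : V}
    (hx : IsFar G K x) (hy : IsFar G K y) (hz : IsFar G K z) (hxa : τ x = a ∨ τ x = b)
    (hya : τ y = a ∨ τ y = b) (hza : τ z = a ∨ τ z = b) (hxy : G.Adj x y) (hyz : G.Adj y z)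
    (hxz : x ≠ z) : G.Adj x z := by
  obtain ⟨c, hc, d, hd, hcd, hca, hcb, hda, hdb⟩ := exists_pair_avoiding h4 a b
  have key : ∀ w, IsFar G K w → (τ w = a ∨ τ w = b) → ¬ G.Adj w c ∧ ¬ G.Adj w d := by
    intro w hw hwa
    rw [(hτ w hw).2 c hc, (hτ w hw).2 d hd]
    rcases hwa with h | h <;> rw [h] <;> exact ⟨‹_›, ‹_›⟩
  exact F.adj_trans hc hd hcd (key x hx hxa).1 (key y hy hya).1 (key z hz hza).1
    (key x hx hxa).2 (key y hy hya).2 (key z hz hza).2 hxy hyz hxz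

theorem adj_of_attached_edge (F : MaxCliqueFrame G K) (h4 : 4 ≤ K.card) {τ : V → V}
    (hτ : ∀ u, IsFar G K u → τ u ∈ K ∧ ∀ k ∈ K, G.Adj u k ↔ k = τ u) {v w w' : V}
    (hv : IsFar G K v) (hw : IsFar G K w) (hw' : IsFar G K w') (hww : τ w = τ w')
    (hadj : G.Adj w w') (hne : τ v ≠ τ w) : G.Adj v w := by
  obtain ⟨c, hc, -, -, -, hcv, hcw, -⟩ := exists_pair_avoiding h4 (τ v) (τ w)
  have hvK := (hτ v hv).1
  have hmiss : ∀ u k, IsFar G K u → k ∈ K → k ≠ τ u → ¬ G.Adj u k := fun u k hu hk h h' =>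
    h (((hτ u hu).2 k hk).1 h')
  have key := F.edge_dominates hadj hvK hc (((hτ v hv).2 _ hvK).2 rfl) (hmiss v c hv hc hcv)
    (hmiss w _ hw hvK hne) (hmiss w' _ hw' hvK (hww ▸ hne)) (hmiss w c hw hc hcw)
    (hmiss w' c hw' hc (hww ▸ hcw)) hv.1.1
  rcases key with h | h
  · exact h.symm
  · refine F.adj_trans_of_attached h4 hτ hv hw' hw (a := τ v) (b := τ w) (Or.inl rfl)
      (Or.inr hww.symm) (Or.inr rfl) h.symm hadj.symm ?_
    rintro rfl
    exact hne rfl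

theorem card_le_card_biUnion_erase [DecidableEq V] (F : MaxCliqueFrame G K) {τ : V → V}
    (hτ : ∀ u, IsFar G K u → τ u ∈ K ∧ ∀ k ∈ K, G.Adj u k ↔ k = τ u) {R : Finset V}
    (hR : G.IsClique (R : Set V)) (hfar : ∀ r ∈ R, IsFar G K r) :
    R.card ≤ (R.biUnion fun u => K.erase (τ u)).card := by
  rcases R.eq_empty_or_nonempty with rfl | ⟨r, hr⟩
  · simp
  have hsub := Finset.subset_biUnion_of_mem (fun u => K.erase (τ u)) hr
  by_cases h : ∀ r' ∈ R, τ r' = τ r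
  · refine le_trans ?_ (Finset.card_le_card hsub)
    rw [Finset.card_erase_of_mem (hτ r (hfar r hr)).1]
    have := F.card_add_one_le hR (v := τ r) fun r' hr' =>
      ((hτ r' (hfar r' hr')).2 _ (hτ r (hfar r hr)).1).2 (h r' hr').symm
    omega
  · push Not at h
    obtain ⟨r', hr', hne⟩ := h
    have hsub' := Finset.subset_biUnion_of_mem (fun u => K.erase (τ u)) hr'
    refine (F.max R hR).trans (Finset.card_le_card fun k hk => ?_)
    by_cases hkr : k = τ r
    · exact hsub' (Finset.mem_erase.2 ⟨fun h => hne (h.symm.trans hkr), hk⟩)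
    · exact hsub (Finset.mem_erase.2 ⟨hkr, hk⟩)

/-- Two non-adjacent vertices attached elsewhere than an edge force a small configuration. -/
theorem colorable_succ_of_attached_of_not_adj [Fintype V] (F : MaxCliqueFrame G K)
    (h4 : 4 ≤ K.card) (hst : ∀ s t, IsIsolatedFrom G K s → IsIsolatedFrom G K t → ¬ G.Adj s t)
    {τ : V → V} (hτ : ∀ u, IsFar G K u → τ u ∈ K ∧ ∀ k ∈ K, G.Adj u k ↔ k = τ u)
    {y₁ y₂ y y' : V} (hy₁ : IsFar G K y₁) (hy₂ : IsFar G K y₂) (hτ₁₂ : τ y₁ = τ y₂)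
    (h₁₂ : G.Adj y₁ y₂) (hy : IsFar G K y) (hy' : IsFar G K y') (hτy : τ y ≠ τ y₁)
    (hτy' : τ y' ≠ τ y₁) (hyy' : ¬ G.Adj y y') (hne : y ≠ y') : G.Colorable (K.card + 1) := by
  classical
  have : Nonempty V := ⟨y⟩
  -- every vertex attached elsewhere is adjacent to the edge
  have hdom : ∀ v, IsFar G K v → τ v ≠ τ y₁ → G.Adj v y₁ ∧ G.Adj v y₂ := fun v hv h =>
    ⟨F.adj_of_attached_edge h4 hτ hv hy₁ hy₂ hτ₁₂ h₁₂ h,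
      F.adj_of_attached_edge h4 hτ hv hy₂ hy₁ hτ₁₂.symm h₁₂.symm (hτ₁₂ ▸ h)⟩
  have hsame : ∀ v w, IsFar G K v → IsFar G K w → τ v ≠ τ y₁ → τ w = τ v → v ≠ w → G.Adj v w :=
    fun v w hv hw hvy hwv hvw => F.adj_trans_of_attached h4 hτ hv hy₁ hw (a := τ v) (b := τ y₁)
      (Or.inl rfl) (Or.inr rfl) (Or.inl hwv) (hdom v hv hvy).1 (hdom w hw (hwv ▸ hvy)).1.symm hvw
  have hbc : τ y ≠ τ y' := fun h => hyy' (hsame y y' hy hy' hτy h.symm hne)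
  have hub : ∀ v, IsFar G K v → τ v = τ y → v = y := by
    intro v hv h
    by_contra hvy
    exact hyy' (F.adj_of_attached_edge h4 hτ hy' hy hv h.symm
      (hsame y v hy hv hτy h (Ne.symm hvy)) hbc.symm).symm
  have huc : ∀ v, IsFar G K v → τ v = τ y' → v = y' := by
    intro v hv h
    by_contra hvy
    exact hyy' (F.adj_of_attached_edge h4 hτ hy hy' hv h.symm
      (hsame y' v hy' hv hτy' h (Ne.symm hvy)) hbc)
  -- `K` has exactly four vertices
  have hrest : ∀ d ∈ K, ∀ e ∈ K, d ≠ τ y₁ → d ≠ τ y → d ≠ τ y' → e ≠ τ y₁ → e ≠ τ y → e ≠ τ y' →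
      d = e := by
    intro d hd e he d1 d2 d3 e1 e2 e3
    by_contra hde
    have hmiss : ∀ u k, IsFar G K u → k ∈ K → k ≠ τ u → ¬ G.Adj u k := fun u k hu hk h h' =>
      h (((hτ u hu).2 k hk).1 h')
    exact hyy' (F.adj_trans hd he hde (hmiss y d hy hd d2) (hmiss y₁ d hy₁ hd d1)
      (hmiss y' d hy' hd d3) (hmiss y e hy he e2) (hmiss y₁ e hy₁ he e1) (hmiss y' e hy' he e3)
      (hdom y hy hτy).1 (hdom y' hy' hτy').1.symm hne)
  have hK4 : K.card = 4 := by
    have h0 : (((K.erase (τ y₁)).erase (τ y)).erase (τ y')).card ≤ 1 := by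
      refine Finset.card_le_one.2 fun d hd e he => ?_
      simp only [Finset.mem_erase] at hd he
      exact hrest d hd.2.2.2 e he.2.2.2 hd.2.2.1 hd.2.1 hd.1 he.2.2.1 he.2.1 he.1
    have h1 := Finset.pred_card_le_card_erase (s := K) (a := τ y₁)
    have h2 := Finset.pred_card_le_card_erase (s := K.erase (τ y₁)) (a := τ y)
    have h3 := Finset.pred_card_le_card_erase (s := (K.erase (τ y₁)).erase (τ y)) (a := τ y')
    omega
  -- at most one further vertex is attached to the fourth vertex of `K`
  have hud : ∀ v w, IsFar G K v → IsFar G K w → τ v ≠ τ y₁ → τ v ≠ τ y → τ v ≠ τ y' →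
      τ w ≠ τ y₁ → τ w ≠ τ y → τ w ≠ τ y' → v = w := by
    intro v w hv hw v1 v2 v3 w1 w2 w3
    by_contra hvw
    have htt := hrest _ (hτ w hw).1 _ (hτ v hv).1 w1 w2 w3 v1 v2 v3
    have hadj := hsame v w hv hw v1 htt hvw
    have e1 := F.adj_of_attached_edge h4 hτ hy hv hw htt.symm hadj v2.symm
    have e2 := F.adj_of_attached_edge h4 hτ hy hw hv htt hadj.symm w2.symm
    have hcl : G.IsClique (({y₁, y₂, v, w} : Finset V) : Set V) := by
      have := hdom v hv v1
      have := hdom w hw w1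
      intro p hp q hq hpq
      simp only [Finset.coe_insert, Finset.coe_singleton, Set.mem_insert_iff,
        Set.mem_singleton_iff] at hp hq
      rcases hp with rfl | rfl | rfl | rfl <;> rcases hq with rfl | rfl | rfl | rfl <;>
        first
        | exact absurd rfl hpq
        | grind [G.adj_comm]
    have h5 := F.card_add_one_le hcl (v := y) (by
      intro p hp
      simp only [Finset.mem_insert, Finset.mem_singleton] at hp
      rcases hp with rfl | rfl | rfl | rfl
      exacts [(hdom y hy hτy).1.symm, (hdom y hy hτy).2.symm, e1.symm, e2.symm])
    have h6 : ({y₁, y₂, v, w} : Finset V).card = 4 := by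
      rw [Finset.card_insert_of_notMem, Finset.card_insert_of_notMem,
        Finset.card_insert_of_notMem, Finset.card_singleton]
      · simpa using hvw
      · have := (hdom v hv v1).2.ne'
        have := (hdom w hw w1).2.ne'
        simp [*]
      · have := (hdom v hv v1).1.ne'
        have := (hdom w hw w1).1.ne'
        have := h₁₂.ne
        simp [*]
    omega
  have hWd : ∀ w, IsFar G K w → τ w ≠ τ y₁ → (G.Adj w y ∨ G.Adj w y') →
      τ w ≠ τ y ∧ τ w ≠ τ y' := by
    intro w hw hwy h
    constructor <;> intro h'
    · rw [hub w hw h'] at h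
      exact h.elim (fun h => G.irrefl h) hyy'
    · rw [huc w hw h'] at h
      exact h.elim (fun h => hyy' h.symm) fun h => G.irrefl h
  set X := Finset.univ.filter fun u => IsFar G K u ∧ (τ u ≠ τ y₁ → G.Adj u y ∨ G.Adj u y') with hX
  have hmX : ∀ u, u ∈ X ↔ IsFar G K u ∧ (τ u ≠ τ y₁ → G.Adj u y ∨ G.Adj u y') := by simp [hX]
  clear_value X
  have hXd : ∀ u ∈ X, ∀ w ∈ X, τ u ≠ τ y₁ → τ w ≠ τ y₁ → u = w := by
    intro u hu w hw hu1 hw1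
    rw [hmX] at hu hw
    have e1 := hWd u hu.1 hu1 (hu.2 hu1)
    have e2 := hWd w hw.1 hw1 (hw.2 hw1)
    exact hud u w hu.1 hw.1 hu1 e1.1 e1.2 hw1 e2.1 e2.2
  have htrans : ∀ u ∈ X, ∀ v ∈ X, ∀ w ∈ X, G.Adj u v → G.Adj v w → u ≠ w → G.Adj u w := by
    intro u hu v hv w hw huv hvw huw
    obtain ⟨d, hd⟩ : ∃ d, ∀ p ∈ X, τ p = τ y₁ ∨ τ p = d := by
      by_cases h : ∃ p ∈ X, τ p ≠ τ y₁
      · obtain ⟨p, hp, hp1⟩ := h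
        refine ⟨τ p, fun q hq => ?_⟩
        by_cases hq1 : τ q = τ y₁
        · exact Or.inl hq1
        · exact Or.inr (by rw [hXd q hq p hp hq1 hp1])
      · push Not at h
        exact ⟨τ y₁, fun p hp => Or.inl (h p hp)⟩
    exact F.adj_trans_of_attached h4 hτ ((hmX u).1 hu).1 ((hmX v).1 hv).1 ((hmX w).1 hw).1
      (hd u hu) (hd v hv) (hd w hw) huv hvw huw
  have hcard : ∀ R ⊆ X, G.IsClique (R : Set V) → (∃ r ∈ R, τ r = τ y₁) → R.card + 1 ≤ K.card := by
    intro R hR hcl hex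
    by_cases hall : ∀ r ∈ R, τ r = τ y₁
    · exact F.card_add_one_le hcl (v := τ y₁) fun r hr =>
        ((hτ r ((hmX r).1 (hR hr)).1).2 _ (hτ y₁ hy₁).1).2 (hall r hr).symm
    · push Not at hall
      obtain ⟨w, hw, hw1⟩ := hall
      have hwX := (hmX w).1 (hR hw)
      have key : ∀ z, IsFar G K z → τ z ≠ τ y₁ → G.Adj w z → ∀ r ∈ R, G.Adj r z := by
        intro z hz hz1 hwz r hr
        by_cases hr1 : τ r = τ y₁
        · have hrX := ((hmX r).1 (hR hr)).1
          have hrw : G.Adj r w := hcl hr hw fun h => hw1 (h ▸ hr1)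
          by_cases hry : r = y₁
          · rw [hry]
            exact (hdom z hz hz1).1.symm
          · have := F.adj_trans_of_attached h4 hτ hrX hwX.1 hy₁ (a := τ y₁) (b := τ w)
              (Or.inl hr1) (Or.inr rfl) (Or.inl rfl) hrw (hdom w hwX.1 hw1).1 hry
            exact (F.adj_of_attached_edge h4 hτ hz hrX hy₁ hr1 this (hr1 ▸ hz1)).symm
        · rw [hXd r (hR hr) w (hR hw) hr1 hw1]
          exact hwz
      rcases hwX.2 hw1 with h | h
      · exact F.card_add_one_le hcl (key y hy hτy h)
      · exact F.card_add_one_le hcl (key y' hy' hτy' h)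
  obtain ⟨f, hf, hf'⟩ := cluster_list_coloring (G := G) X htrans
    (fun u => (K.erase (τ y₁)).erase (if τ u = τ y₁ then y else τ u)) (by
    intro R hR hcl
    rcases R.eq_empty_or_nonempty with rfl | ⟨r, hr⟩
    · simp
    have hcK := Finset.card_erase_of_mem (hτ y₁ hy₁).1
    by_cases h : ∃ r ∈ R, τ r = τ y₁
    · have h0 := hcard R hR hcl h
      obtain ⟨r, hr, hr1⟩ := h
      refine le_trans ?_ (Finset.card_le_card (Finset.subset_biUnion_of_mem
        (fun u => (K.erase (τ y₁)).erase (if τ u = τ y₁ then y else τ u)) hr))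
      have hyK : y ∉ K.erase (τ y₁) := fun h => hy.1.1 (Finset.mem_of_mem_erase h)
      simp only [hr1, if_true, Finset.erase_eq_of_notMem hyK]
      omega
    · push Not at h
      have h1 : R.card ≤ 1 := Finset.card_le_one.2 fun u hu w hw =>
        hXd u (hR hu) w (hR hw) (h u hu) (h w hw)
      refine le_trans ?_ (Finset.card_le_card (Finset.subset_biUnion_of_mem
        (fun u => (K.erase (τ y₁)).erase (if τ u = τ y₁ then y else τ u)) hr))
      have := Finset.pred_card_le_card_erase (s := K.erase (τ y₁))
        (a := if τ r = τ y₁ then y else τ r)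
      omega)
  have hfK : ∀ u ∈ X, f u ∈ K ∧ f u ≠ τ y₁ ∧ f u ≠ τ u := by
    intro u hu
    have h := hf u hu
    rw [Finset.mem_erase, Finset.mem_erase] at h
    refine ⟨h.2.2, h.2.1, ?_⟩
    by_cases hu1 : τ u = τ y₁
    · rw [hu1]
      exact h.2.1
    · rw [if_neg hu1] at h
      exact h.1
  have hstable : ∀ u v, IsFar G K u → IsFar G K v → u ∉ X → v ∉ X → ¬ G.Adj u v := by
    intro u v hu hv huX hvX huv
    rw [hmX] at huX hvX
    push Not at huX hvX
    obtain ⟨u1, uy, uy'⟩ := huX hu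
    obtain ⟨v1, vy, vy'⟩ := hvX hv
    by_cases hu2 : τ u = τ y
    · rw [hub u hu hu2] at huv
      exact vy huv.symm
    by_cases hu3 : τ u = τ y'
    · rw [huc u hu hu3] at huv
      exact vy' huv.symm
    by_cases hv2 : τ v = τ y
    · rw [hub v hv hv2] at huv
      exact uy huv
    by_cases hv3 : τ v = τ y'
    · rw [huc v hv hv3] at huv
      exact uy' huv
    exact huv.ne (hud u v hu hv u1 hu2 hu3 v1 hv2 hv3)
  refine F.colorable_succ_of_far_coloring hst (fun u => if u ∈ X then f u else τ y₁) ?_ ?_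
  · intro u hu
    by_cases huX : u ∈ X
    · simp only [huX, if_true]
      exact ⟨(hfK u huX).1, fun h => (hfK u huX).2.2 (((hτ u hu).2 _ (hfK u huX).1).1 h)⟩
    · simp only [huX, if_false]
      refine ⟨(hτ y₁ hy₁).1, fun h => huX ((hmX u).2 ⟨hu, fun h' => ?_⟩)⟩
      exact absurd (((hτ u hu).2 _ (hτ y₁ hy₁).1).1 h).symm h'
  · intro u v hu hv huv
    by_cases huX : u ∈ X <;> by_cases hvX : v ∈ X
    · simpa only [huX, hvX, if_true] using hf' u huX v hvX huv
    · simpa only [huX, hvX, if_true, if_false] using (hfK u huX).2.1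
    · simpa only [huX, hvX, if_true, if_false] using (hfK v hvX).2.1.symm
    · exact absurd huv (hstable u v hu hv huX hvX)

/-- If every far vertex has exactly one neighbour in `K`, one extra colour suffices. -/
theorem colorable_succ_of_attached [Fintype V] (F : MaxCliqueFrame G K) (h4 : 4 ≤ K.card)
    (hst : ∀ s t, IsIsolatedFrom G K s → IsIsolatedFrom G K t → ¬ G.Adj s t)
    {τ : V → V} (hτ : ∀ u, IsFar G K u → τ u ∈ K ∧ ∀ k ∈ K, G.Adj u k ↔ k = τ u) :
    G.Colorable (K.card + 1) := by
  classical
  obtain ⟨k₀, hk₀⟩ := Finset.card_pos.1 (by omega : 0 < K.card)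
  have : Nonempty V := ⟨k₀⟩
  by_cases hedge : ∃ y₁ y₂, IsFar G K y₁ ∧ IsFar G K y₂ ∧ τ y₁ = τ y₂ ∧ G.Adj y₁ y₂
  · obtain ⟨y₁, y₂, hy₁, hy₂, hτ₁₂, h₁₂⟩ := hedge
    by_cases hY : ∃ y y', IsFar G K y ∧ IsFar G K y' ∧ τ y ≠ τ y₁ ∧ τ y' ≠ τ y₁ ∧
        ¬ G.Adj y y' ∧ y ≠ y'
    · obtain ⟨y, y', hy, hy', hτy, hτy', hyy', hne⟩ := hY
      exact F.colorable_succ_of_attached_of_not_adj h4 hst hτ hy₁ hy₂ hτ₁₂ h₁₂ hy hy' hτy hτy'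
        hyy' hne
    push Not at hY
    have hYcl : ∀ u v, IsFar G K u → IsFar G K v → τ u ≠ τ y₁ → τ v ≠ τ y₁ → u ≠ v → G.Adj u v :=
      fun u v hu hv hu1 hv1 huv => by
        by_contra h
        exact huv (hY u v hu hv hu1 hv1 h)
    -- a vertex attached like the edge with one neighbour attached elsewhere has all of them
    have hfull : ∀ u v w, IsFar G K u → IsFar G K v → IsFar G K w → τ u = τ y₁ → τ v ≠ τ y₁ →
        τ w ≠ τ y₁ → G.Adj u v → G.Adj w u := by
      intro u v w hu hv hw hu1 hv1 hw1 huv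
      by_cases huy : u = y₁
      · rw [huy]
        exact F.adj_of_attached_edge h4 hτ hw hy₁ hy₂ hτ₁₂ h₁₂ hw1
      · have hvy := F.adj_of_attached_edge h4 hτ hv hy₁ hy₂ hτ₁₂ h₁₂ hv1
        have := F.adj_trans_of_attached h4 hτ hu hv hy₁ (a := τ y₁) (b := τ v) (Or.inl hu1)
          (Or.inr rfl) (Or.inl rfl) huv hvy huy
        exact F.adj_of_attached_edge h4 hτ hw hu hy₁ hu1 this (hu1 ▸ hw1)
    have hm : ∀ u, u ∈ Finset.univ.filter (IsFar G K) ↔ IsFar G K u := by simp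
    obtain ⟨f, hf, hf'⟩ := cluster_list_coloring (G := G) (Finset.univ.filter (IsFar G K)) (by
      intro u hu v hv w hw huv hvw huw
      rw [hm] at hu hv hw
      by_cases hu1 : τ u = τ y₁ <;> by_cases hw1 : τ w = τ y₁
      · exact F.adj_trans_of_attached h4 hτ hu hv hw (a := τ y₁) (b := τ v) (Or.inl hu1)
          (Or.inr rfl) (Or.inl hw1) huv hvw huw
      · by_cases hv1 : τ v = τ y₁
        · exact (F.adj_of_attached_edge h4 hτ hw hu hv (hu1.trans hv1.symm) huv (hu1 ▸ hw1)).symm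
        · exact (hfull u v w hu hv hw hu1 hv1 hw1 huv).symm
      · by_cases hv1 : τ v = τ y₁
        · exact F.adj_of_attached_edge h4 hτ hu hw hv (hw1.trans hv1.symm) hvw.symm (hw1 ▸ hu1)
        · exact hfull w v u hw hv hu hw1 hv1 hu1 hvw.symm
      · exact hYcl u w hu hw hu1 hw1 huw) (fun u => K.erase (τ u))
      (fun R hR hcl => F.card_le_card_biUnion_erase hτ hcl fun r hr => (hm r).1 (hR hr))
    refine F.colorable_succ_of_far_coloring hst f (fun u hu => ?_) fun u v hu hv huv =>
      hf' u ((hm u).2 hu) v ((hm v).2 hv) huv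
    have := Finset.mem_erase.1 (hf u ((hm u).2 hu))
    exact ⟨this.2, fun h => this.1 (((hτ u hu).2 _ this.2).1 h)⟩
  · push Not at hedge
    obtain ⟨σ, hσ, hσ'⟩ := clique_list_coloring K (fun a => K.erase a) (by
      intro R hR
      rcases R.eq_empty_or_nonempty with rfl | ⟨r, hr⟩
      · simp
      have hsub := Finset.subset_biUnion_of_mem (fun a => K.erase a) hr
      by_cases h : R.card ≤ 1
      · refine le_trans ?_ (Finset.card_le_card hsub)
        have := Finset.card_erase_of_mem (hR hr)
        omega
      · obtain ⟨r', hr', hne⟩ := Finset.exists_mem_ne (by omega : 1 < R.card) r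
        have hsub' := Finset.subset_biUnion_of_mem (fun a => K.erase a) hr'
        refine (Finset.card_le_card hR).trans (Finset.card_le_card fun k hk => ?_)
        by_cases hkr : k = r
        · exact hsub' (Finset.mem_erase.2 ⟨fun h => hne (h.symm.trans hkr), hk⟩)
        · exact hsub (Finset.mem_erase.2 ⟨hkr, hk⟩))
    refine F.colorable_succ_of_far_coloring hst (fun u => σ (τ u)) (fun u hu => ?_)
      fun u v hu hv huv h => ?_
    · have := Finset.mem_erase.1 (hσ _ (hτ u hu).1)
      exact ⟨this.2, fun h => this.1 (((hτ u hu).2 _ this.2).1 h)⟩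
    · exact hedge u v hu hv (hσ' (hτ u hu).1 (hτ v hv).1 h) huv

/-- If no frame has an edge anticomplete to its clique, one extra colour suffices. -/
theorem colorable_succ [Fintype V] (F : MaxCliqueFrame G K) (h4 : 4 ≤ K.card)
    (hst : ∀ L, MaxCliqueFrame G L → ∀ s t, IsIsolatedFrom G L s → IsIsolatedFrom G L t →
      ¬ G.Adj s t) : G.Colorable (K.card + 1) := by
  classical
  obtain ⟨k₀, hk₀⟩ := Finset.card_pos.1 (by omega : 0 < K.card)
  have : Nonempty V := ⟨k₀⟩
  by_cases h : ∃ x, IsFar G K x ∧ 2 ≤ (nbrIn G K x).card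
  · obtain ⟨x₀, hx₀, h2⟩ := h
    obtain ⟨x, hx, hmax⟩ := Finset.exists_max_image (Finset.univ.filter (IsFar G K))
      (fun u => (nbrIn G K u).card) ⟨x₀, by simpa using hx₀⟩
    have hm : ∀ u, u ∈ Finset.univ.filter (IsFar G K) ↔ IsFar G K u := by simp
    exact F.colorable_succ_of_two_le hst ((hm x).1 hx) (h2.trans (hmax x₀ ((hm _).2 hx₀)))
      fun u hu => hmax u ((hm u).2 hu)
  · push Not at h
    have hex : ∀ u, IsFar G K u → ∃ a, a ∈ K ∧ ∀ k ∈ K, G.Adj u k ↔ k = a := by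
      intro u hu
      obtain ⟨a, ha, hua⟩ := hu.2
      refine ⟨a, ha, fun k hk => ⟨fun huk => ?_, fun h => h ▸ hua⟩⟩
      have := h u hu
      exact Finset.card_le_one.1 (by omega) k (mem_nbrIn.2 ⟨hk, huk⟩) a (mem_nbrIn.2 ⟨ha, hua⟩)
    choose! τ hτ using hex
    exact F.colorable_succ_of_attached h4 (hst K F) hτ

end MaxCliqueFrame

theorem phi_eq_add {n h : ℕ} (hn : 4 ≤ n) (h1 : n ≤ 4 * h + 1) (h2 : 4 * h ≤ n + 2) :
    phi n = n + h := by
  rw [phi, if_neg (by omega), if_neg (by omega), if_neg (by omega)]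
  have e1 : (n : ℚ) ≤ 4 * h + 1 := by exact_mod_cast h1
  have e2 : (4 * h : ℚ) ≤ n + 2 := by exact_mod_cast h2
  rw [Nat.ceil_eq_iff (by omega)]
  have : ((n + h - 1 : ℕ) : ℚ) = n + h - 1 := by
    rw [Nat.cast_sub (by omega)]
    push_cast
    ring
  rw [this]
  push_cast
  constructor <;> linarith

theorem colorable_phi {V : Type*} [Fintype V] {G : SimpleGraph V} {K : Finset V}
    (F : MaxCliqueFrame G K) (h0 : 0 < K.card) : G.Colorable (phi K.card) := by
  rcases (by omega : K.card = 1 ∨ K.card = 2 ∨ K.card = 3 ∨ 4 ≤ K.card) with h | h | h | h4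
  · rw [h, show phi 1 = 1 by simp [phi]]
    exact F.colorable_one h
  · rw [h, show phi 2 = 4 by simp [phi]]
    exact F.colorable_four h
  · rw [h, show phi 3 = 6 by simp [phi]]
    exact F.colorable_six h
  · rw [phi_eq_add (h := (K.card + 2) / 4) h4 (by omega) (by omega)]
    by_cases hst : ∀ L, MaxCliqueFrame G L → ∀ s t, IsIsolatedFrom G L s → IsIsolatedFrom G L t →
      ¬ G.Adj s t
    · exact (F.colorable_succ h4 hst).mono (by omega)
    · push Not at hst
      obtain ⟨L, hL, s, t, hs, ht, hadj⟩ := hst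
      have hc : L.card = K.card := le_antisymm (F.max L hL.isClique) (hL.max K F.isClique)
      rw [← hc]
      exact hL.colorable_of_isolated_edge (by omega) (by omega) (by omega) hs ht hadj

theorem chromaticNumber_le_phi_cliqueNum {V : Type*} [Fintype V] (G : SimpleGraph V) [Nonempty V]
    (h1 : IsFreeOf G graphP2P3) (h2 : IsFreeOf G graphGem) :
    G.chromaticNumber ≤ (phi G.cliqueNum : ℕ∞) := by
  obtain ⟨K, hK⟩ := G.exists_isNClique_cliqueNum
  have hmax : ∀ R : Finset V, G.IsClique (R : Set V) → R.card ≤ K.card := fun R hR => by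
    rw [hK.card_eq]
    exact hR.card_le_cliqueNum
  have F : MaxCliqueFrame G K := ⟨noP2P3_of_isFreeOf h1, noGem_of_isFreeOf h2,
    fun a ha b hb hab => hK.isClique ha hb hab, hmax⟩
  have v : V := Classical.arbitrary V
  have h0 := hmax {v} (by simp)
  rw [Finset.card_singleton] at h0
  rw [← hK.card_eq]
  exact (colorable_phi F h0).chromaticNumber_le

/-- `force n f` is `f n`; evaluating it first reduces `n` to a numeral. -/
def force {α : Type} (n : ℕ) (f : ℕ → α) : α :=
  Nat.rec (f 0) (fun k _ => f (k + 1)) n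

theorem force_eq {α : Type} (n : ℕ) (f : ℕ → α) : force n f = f n := by
  cases n <;> rfl

/-- A vertex of the set `rem` with few available colours, sets being encoded by binary digits;
digits `n * i, …, n * i + n - 1` of `S` encode the vertices for which colour `i` is forbidden. -/
def pickVertex (n rem S : ℕ) : ℕ → ℕ → ℕ → ℕ → ℕ
  | 0, a, b, c => Nat.log2 (cond (Nat.beq a rem) (cond (Nat.beq b rem) (cond (Nat.beq c rem) rem
      (Nat.xor rem c)) (Nat.xor rem b)) (Nat.xor rem a))
  | i + 1, a, b, c =>
    force (Nat.xor rem (Nat.land rem (Nat.shiftRight S (Nat.mul n i)))) fun d =>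
    force (Nat.lor c (Nat.land b d)) fun c₁ =>
    force (Nat.lor b (Nat.land a d)) fun b₁ =>
    force (Nat.lor a d) fun a₁ => pickVertex n rem S i a₁ b₁ c₁

/-- Backtracking search for a colouring with `q` colours; `N v` encodes the neighbours of
`v`, and `m` colours are already in use. The result `true` means that no colouring exists. -/
def refute (n : ℕ) (N : ℕ → ℕ) (q : ℕ) : ℕ → ℕ → ℕ → ℕ → Bool
  | 0, _, _, _ => false
  | k + 1, rem, m, S =>
    force (pickVertex n rem S (Nat.min (m + 1) q) 0 0 0) fun v =>
    Nat.blt v n && (List.range q).all fun i => Nat.blt m i || Nat.testBit S (n * i + v) ||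
      force (S ||| N v <<< (n * i)) fun S' =>
      force (Nat.xor rem (Nat.shiftLeft 1 v)) fun rem' =>
      force (Nat.max m (i + 1)) fun m' => refute n N q k rem' m' S'

theorem refute_sound {n q : ℕ} {N : ℕ → ℕ} (hN : ∀ u v, (N u).testBit v = true → v < n) (k : ℕ) :
    ∀ rem m S, refute n N q k rem m S = true →
      (∀ i w, w < n → S.testBit (n * i + w) = true → i < m) →
      ∀ f : ℕ → ℕ, (∀ v, f v < q) →
        (∀ u v, u < n → v < n → (N u).testBit v = true → f u ≠ f v) →
        (∀ i w, w < n → S.testBit (n * i + w) = true → f w ≠ i) → False := by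
  induction k with
  | zero => exact fun rem m S h => by simp [refute] at h
  | succ k ih =>
    intro rem m S h hm f hf hne hS
    simp only [refute, force_eq] at h
    generalize pickVertex n rem S (Nat.min (m + 1) q) 0 0 0 = v at h
    rw [Bool.and_eq_true, List.all_eq_true] at h
    obtain ⟨hv, h⟩ := h
    replace hv : v < n := by simpa using hv
    have step : ∀ f : ℕ → ℕ, (∀ v, f v < q) →
        (∀ u v, u < n → v < n → (N u).testBit v = true → f u ≠ f v) →
        (∀ i w, w < n → S.testBit (n * i + w) = true → f w ≠ i) → f v ≤ m → False := by
      intro f hf hne hS hvm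
      have h1 := h (f v) (List.mem_range.2 (hf v))
      rw [Bool.or_eq_true, Bool.or_eq_true] at h1
      rcases h1 with (h1 | h1) | h1
      · have : m < f v := by simpa using h1
        omega
      · exact hS _ v hv h1 rfl
      · have hbit : ∀ i w, w < n → (S ||| N v <<< (n * f v)).testBit (n * i + w) = true →
            S.testBit (n * i + w) = true ∨ (i = f v ∧ (N v).testBit w = true) := by
          intro i w hw hb
          rw [Nat.testBit_or, Bool.or_eq_true, Nat.testBit_shiftLeft, Bool.and_eq_true] at hb
          rcases hb with hb | ⟨hle, hb⟩
          · exact Or.inl hb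
          · right
            replace hle : n * f v ≤ n * i + w := by simpa using hle
            have hlt := hN _ _ hb
            have : i = f v := by
              rcases lt_trichotomy i (f v) with h | h | h
              · have := Nat.mul_le_mul_left n (Nat.succ_le_of_lt h)
                rw [Nat.mul_succ] at this
                omega
              · exact h
              · have := Nat.mul_le_mul_left n (Nat.succ_le_of_lt h)
                rw [Nat.mul_succ] at this
                omega
            subst this
            rw [Nat.add_sub_cancel_left] at hb
            exact ⟨rfl, hb⟩
        refine ih _ _ _ h1 ?_ f hf hne ?_
        · intro i w hw hb
          have e1 := Nat.le_max_left m (f v + 1)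
          have e2 := Nat.le_max_right m (f v + 1)
          change i < Max.max m (f v + 1)
          rcases hbit i w hw hb with hb | ⟨rfl, -⟩
          · have := hm i w hw hb
            omega
          · omega
        · intro i w hw hb
          rcases hbit i w hw hb with hb | ⟨rfl, hb'⟩
          · exact hS i w hw hb
          · exact (hne v w hv hw hb').symm
    rcases le_total (f v) m with hle | hle
    · exact step f hf hne hS hle
    · have hmq : m < q := hle.trans_lt (hf v)
      refine step (fun w => Equiv.swap (f v) m (f w)) (fun w => ?_) (fun u w hu hw hb h =>
        hne u w hu hw hb ((Equiv.injective _) h)) (fun i w hw hb h => ?_) ?_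
      · have := hf w
        have := hf v
        rw [Equiv.swap_apply_def]
        split_ifs <;> omega
      · have him := hm i w hw hb
        rw [Equiv.swap_apply_eq_iff, Equiv.swap_apply_of_ne_of_ne (by omega) (by omega)] at h
        exact hS i w hw hb h
      · simp

theorem not_colorable_of_refute {n q code k rem : ℕ} {G : SimpleGraph (Fin n)} (hn : 0 < n)
    (hG : ∀ u v : Fin n, code.testBit (n * u + v) = true → G.Adj u v)
    (h : refute n (fun v => (code >>> (n * v)) % 2 ^ n) q k rem 0 0 = true) :
    ¬ G.Colorable q := by
  rintro ⟨C⟩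
  refine refute_sound (fun u v h => ?_) k rem 0 0 h (by simp)
    (fun v => if hv : v < n then C ⟨v, hv⟩ else C ⟨0, hn⟩) (fun v => ?_) (fun u v hu hv h => ?_)
    (by simp)
  · rw [Nat.testBit_mod_two_pow, Bool.and_eq_true] at h
    simpa using h.1
  · split_ifs <;> exact Fin.is_lt _
  · rw [Nat.testBit_mod_two_pow, Bool.and_eq_true, Nat.testBit_shiftRight] at h
    simp only [hu, hv, dif_pos]
    exact fun heq => C.valid (hG ⟨u, hu⟩ ⟨v, hv⟩ h.2) (Fin.ext heq)

/-- Digit `11 * u + v` records whether the vertices `u` and `v` of the Grötzsch graph are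
adjacent. -/
def grotzschCode : ℕ := 1288344685710335012376723138625743442

/-- Digit `27 * u + v` records whether the vertices `u` and `v` of the complement of the Schläfli
graph are adjacent. -/
def schlafliCode : ℕ :=
  53067618229521769046738071573877416778872586263338265013355549100346230972124408789241793385084288113576990963260684376741750278034318370957010413230707409486494262579936661591203694540791800365035368156551509140701056

/-- The Grötzsch graph. -/
def grotzschGraph : SimpleGraph (Fin 11) where
  Adj u v := grotzschCode.testBit (11 * u + v) = true
  symm := by
    have h : ∀ u v : Fin 11, grotzschCode.testBit (11 * u + v) = true →
      grotzschCode.testBit (11 * v + u) = true := by decide +kernel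
    exact ⟨h⟩
  loopless := by
    have h : ∀ u : Fin 11, ¬ grotzschCode.testBit (11 * u + u) = true := by decide +kernel
    exact ⟨h⟩

/-- The complement of the Schläfli graph. -/
def schlafliComplement : SimpleGraph (Fin 27) where
  Adj u v := schlafliCode.testBit (27 * u + v) = true
  symm := by
    have h : ∀ u v : Fin 27, schlafliCode.testBit (27 * u + v) = true →
      schlafliCode.testBit (27 * v + u) = true := by decide +kernel
    exact ⟨h⟩
  loopless := by
    have h : ∀ u : Fin 27, ¬ schlafliCode.testBit (27 * u + u) = true := by decide +kernel
    exact ⟨h⟩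

instance : DecidableRel grotzschGraph.Adj := fun _ _ => inferInstanceAs (Decidable (_ = true))

instance : DecidableRel schlafliComplement.Adj :=
  fun _ _ => inferInstanceAs (Decidable (_ = true))

theorem not_colorable_grotzschGraph : ¬ grotzschGraph.Colorable 3 :=
  not_colorable_of_refute (k := 12) (rem := 2 ^ 11 - 1) (by decide) (fun _ _ h => h)
    (by decide +kernel)

theorem not_colorable_schlafliComplement : ¬ schlafliComplement.Colorable 5 :=
  not_colorable_of_refute (k := 28) (rem := 2 ^ 27 - 1) (by decide) (fun _ _ h => h)
    (by decide +kernel)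

theorem isFreeOf_of_common_nbr {V : Type*} {G : SimpleGraph V}
    (h1 : ∀ c q p r, G.Adj c q → G.Adj c p → G.Adj q p → G.Adj c r → G.Adj q r → p = r) :
    IsFreeOf G graphGem := by
  refine ⟨fun φ => ?_⟩
  have key : ∀ i j, graphGem.Adj i j → G.Adj (φ i) (φ j) := fun i j h => φ.map_adj_iff.2 h
  have := h1 (φ 4) (φ 1) (φ 0) (φ 2) (key _ _ (by simp [graphGem])) (key _ _ (by simp [graphGem]))
    (key _ _ (by simp [graphGem])) (key _ _ (by simp [graphGem])) (key _ _ (by simp [graphGem]))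
  exact absurd (φ.injective this) (by decide)

theorem isFreeOf_graphP2P3_of {V : Type*} {G : SimpleGraph V}
    (h : ∀ a b, G.Adj a b → ∀ y, ¬ G.Adj a y → ¬ G.Adj b y → ∀ x, G.Adj y x → ¬ G.Adj a x →
      ¬ G.Adj b x → ∀ z, G.Adj y z → ¬ G.Adj a z → ¬ G.Adj b z → ¬ x = z → G.Adj x z) :
    IsFreeOf G graphP2P3 := by
  refine ⟨fun φ => ?_⟩
  have key : ∀ i j, G.Adj (φ i) (φ j) ↔ graphP2P3.Adj i j := fun i j => φ.map_adj_iff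
  have := h (φ 0) (φ 1) ((key _ _).2 (by simp [graphP2P3])) (φ 3)
    (by rw [key]; simp [graphP2P3]) (by rw [key]; simp [graphP2P3]) (φ 2)
    ((key _ _).2 (by simp [graphP2P3])) (by rw [key]; simp [graphP2P3])
    (by rw [key]; simp [graphP2P3]) (φ 4) ((key _ _).2 (by simp [graphP2P3]))
    (by rw [key]; simp [graphP2P3]) (by rw [key]; simp [graphP2P3])
    (fun h => absurd (φ.injective h) (by decide))
  rw [key] at this
  simp [graphP2P3] at this

theorem isFreeOf_graphP2P3_grotzschGraph : IsFreeOf grotzschGraph graphP2P3 :=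
  isFreeOf_graphP2P3_of (by decide +kernel)

theorem isFreeOf_graphP2P3_schlafliComplement : IsFreeOf schlafliComplement graphP2P3 :=
  isFreeOf_graphP2P3_of (by decide +kernel)

theorem exists_max_of_not_colorable {V : Type} [Fintype V] {G : SimpleGraph V} {k : ℕ}
    (hk : 1 ≤ k) (h1 : IsFreeOf G graphP2P3) (h2 : IsFreeOf G graphGem)
    (hclique : ∃ s : Finset V, G.IsNClique k s) (hfree : G.CliqueFree (k + 1))
    (hcol : ∀ m, G.Colorable m → phi k ≤ m) :
    ∃ (V : Type) (_ : Fintype V) (G : SimpleGraph V), IsFreeOf G graphP2P3 ∧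
      IsFreeOf G graphGem ∧ G.cliqueNum = k ∧ G.chromaticNumber = (phi k : ℕ∞) := by
  obtain ⟨s, hs⟩ := hclique
  have hω : G.cliqueNum = k := by
    refine le_antisymm ?_ ?_
    · obtain ⟨K, hK⟩ := G.exists_isNClique_cliqueNum
      by_contra hlt
      exact (hfree.mono (by omega : k + 1 ≤ G.cliqueNum)) K hK
    · rw [← hs.card_eq]
      exact hs.isClique.card_le_cliqueNum
  have hne : Nonempty V := by
    have : 0 < s.card := by rw [hs.card_eq]; omega
    exact ⟨(Finset.card_pos.1 this).choose⟩
  refine ⟨V, inferInstance, G, h1, h2, hω, le_antisymm ?_ ?_⟩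
  · rw [← hω]
    exact chromaticNumber_le_phi_cliqueNum G h1 h2
  · exact le_chromaticNumber_iff_colorable.2 fun m hm => Nat.cast_le.2 (hcol m hm)

theorem common_nbr_schlafliComplement : ∀ c q, schlafliComplement.Adj c q →
    ∀ p, schlafliComplement.Adj c p → schlafliComplement.Adj q p →
    ∀ r, schlafliComplement.Adj c r → schlafliComplement.Adj q r → p = r := by
  decide +kernel

theorem not_adj_of_common_nbr_grotzschGraph : ∀ c q, grotzschGraph.Adj c q →
    ∀ p, grotzschGraph.Adj c p → ¬ grotzschGraph.Adj q p := by
  decide +kernel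

theorem cliqueFree_grotzschGraph : grotzschGraph.CliqueFree 3 := by
  intro s hs
  obtain ⟨a, b, c, hab, hac, hbc, -⟩ := is3Clique_iff.1 hs
  exact not_adj_of_common_nbr_grotzschGraph a b hab c hac hbc

theorem cliqueFree_schlafliComplement : schlafliComplement.CliqueFree 4 := by
  intro s hs
  obtain ⟨a, ha⟩ := Finset.card_pos.1 (by rw [hs.card_eq]; omega : 0 < s.card)
  have h3 : (s.erase a).card = 3 := by rw [Finset.card_erase_of_mem ha, hs.card_eq]
  obtain ⟨b, c, d, hbc, hbd, hcd, he⟩ := Finset.card_eq_three.1 h3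
  have hb := Finset.mem_erase.1 (he ▸ (by simp) : b ∈ s.erase a)
  have hc := Finset.mem_erase.1 (he ▸ (by simp) : c ∈ s.erase a)
  have hd := Finset.mem_erase.1 (he ▸ (by simp) : d ∈ s.erase a)
  have h := hs.isClique
  exact hcd (common_nbr_schlafliComplement a b (h ha hb.2 hb.1.symm) c (h ha hc.2 hc.1.symm)
    (h hb.2 hc.2 hbc) d (h ha hd.2 hd.1.symm) (h hb.2 hd.2 hbd))

/-- Adjacent or equal positions on the 5-cycle. -/
def CloseC5 (i j : Fin 5) : Prop := i = j ∨ j = i + 1 ∨ i = j + 1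

instance : DecidableRel CloseC5 := fun _ _ => inferInstanceAs (Decidable (_ ∨ _ ∨ _))

theorem isFreeOf_graphP2P3_of_closeC5 {V : Type*} {G : SimpleGraph V} (g : V → Fin 5)
    (hg : ∀ x y, G.Adj x y ↔ x ≠ y ∧ CloseC5 (g x) (g y)) : IsFreeOf G graphP2P3 := by
  refine ⟨fun φ => ?_⟩
  have key : ∀ i j, i ≠ j → (graphP2P3.Adj i j ↔ CloseC5 (g (φ i)) (g (φ j))) := fun i j h => by
    rw [← φ.map_adj_iff, hg]
    simp [h]
  have h01 := (key 0 1 (by decide)).1 (by simp [graphP2P3])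
  have h02 := mt (key 0 2 (by decide)).2 (by simp [graphP2P3])
  have h03 := mt (key 0 3 (by decide)).2 (by simp [graphP2P3])
  have h04 := mt (key 0 4 (by decide)).2 (by simp [graphP2P3])
  have h23 := (key 2 3 (by decide)).1 (by simp [graphP2P3])
  have h34 := (key 3 4 (by decide)).1 (by simp [graphP2P3])
  have h24 := mt (key 2 4 (by decide)).2 (by simp [graphP2P3])
  have : ∀ a b, ¬ CloseC5 a b → ∀ c, ¬ CloseC5 a c → CloseC5 b c := by
    decide +kernel
  exact h24 (this _ _ h02 _ h04)

theorem isFreeOf_graphGem_of_closeC5 {V : Type*} {G : SimpleGraph V} (g : V → Fin 5)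
    (hg : ∀ x y, G.Adj x y ↔ x ≠ y ∧ CloseC5 (g x) (g y)) : IsFreeOf G graphGem := by
  refine ⟨fun φ => ?_⟩
  have key : ∀ i j, i ≠ j → (graphGem.Adj i j ↔ CloseC5 (g (φ i)) (g (φ j))) := fun i j h => by
    rw [← φ.map_adj_iff, hg]
    simp [h]
  have : ∀ p q : Fin 5, CloseC5 p q → ∀ r, CloseC5 q r → ¬ CloseC5 p r → ∀ s, CloseC5 r s →
      ¬ CloseC5 q s → ¬ CloseC5 p s → ∀ c, CloseC5 c p → CloseC5 c q → CloseC5 c r →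
      ¬ CloseC5 c s := by
    decide +kernel
  exact this _ _ ((key 0 1 (by decide)).1 (by simp [graphGem])) _
    ((key 1 2 (by decide)).1 (by simp [graphGem]))
    (mt (key 0 2 (by decide)).2 (by simp [graphGem])) _
    ((key 2 3 (by decide)).1 (by simp [graphGem]))
    (mt (key 1 3 (by decide)).2 (by simp [graphGem]))
    (mt (key 0 3 (by decide)).2 (by simp [graphGem])) _
    ((key 4 0 (by decide)).1 (by simp [graphGem])) ((key 4 1 (by decide)).1 (by simp [graphGem]))
    ((key 4 2 (by decide)).1 (by simp [graphGem])) ((key 4 3 (by decide)).1 (by simp [graphGem]))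

/-- The class of a vertex of a clique blow-up of the 5-cycle. -/
def blowupC5Class {t : Fin 5 → ℕ} : (Σ i : Fin 5, Fin (t i)) ⊕ Fin 0 → Fin 5 :=
  Sum.elim Sigma.fst finZeroElim

theorem blowupC5_adj {t : Fin 5 → ℕ} (x y : (Σ i : Fin 5, Fin (t i)) ⊕ Fin 0) :
    (blowupC5 t 0).Adj x y ↔ x ≠ y ∧ CloseC5 (blowupC5Class x) (blowupC5Class y) := by
  rcases x with x | x
  · rcases y with y | y
    · simp only [blowupC5, fromRel_adj, blowupC5Class, Sum.elim_inl, CloseC5, Sum.inl.injEq]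
      refine and_congr_right fun _ => ?_
      constructor
      · rintro (⟨a, b, rfl, rfl, h⟩ | ⟨a, b, rfl, rfl, h⟩)
        · exact h.imp_right Or.inl
        · rcases h with h | h
          · exact Or.inl h.symm
          · exact Or.inr (Or.inr h)
      · rintro (h | h | h)
        · exact Or.inl ⟨x, y, rfl, rfl, Or.inl h⟩
        · exact Or.inl ⟨x, y, rfl, rfl, Or.inr h⟩
        · exact Or.inr ⟨y, x, rfl, rfl, Or.inr h⟩
    · exact y.elim0
  · exact x.elim0

theorem card_filter_blowupC5Class {t : Fin 5 → ℕ} (i : Fin 5) :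
    (Finset.univ.filter fun x : (Σ i : Fin 5, Fin (t i)) ⊕ Fin 0 =>
      blowupC5Class x = i).card = t i := by
  have : (Finset.univ.filter fun x : (Σ i : Fin 5, Fin (t i)) ⊕ Fin 0 => blowupC5Class x = i) =
      Finset.univ.map ⟨fun j : Fin (t i) => Sum.inl ⟨i, j⟩, fun a b h => by simpa using h⟩ := by
    ext x
    rcases x with ⟨j, x⟩ | x
    · rw [Finset.mem_filter, Finset.mem_map]
      constructor
      · rintro ⟨-, rfl⟩
        exact ⟨x, Finset.mem_univ _, rfl⟩
      · rintro ⟨a, -, h⟩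
        exact ⟨Finset.mem_univ _, (congrArg Sigma.fst (Sum.inl.inj h)).symm⟩
    · exact x.elim0
  rw [this, Finset.card_map, Finset.card_univ, Fintype.card_fin]

theorem card_le_two_mul_of_colorable_blowupC5 {t : Fin 5 → ℕ} {m : ℕ}
    (h : (blowupC5 t 0).Colorable m) : ∑ i, t i ≤ 2 * m := by
  classical
  obtain ⟨C⟩ := h
  have hc : ∀ c ∈ (Finset.univ : Finset (Fin m)),
      (Finset.univ.filter fun x => C x = c).card ≤ 2 := by
    intro c _
    by_contra hlt
    obtain ⟨x, hx, y, hy, z, hz, hxy, hxz, hyz⟩ := Finset.two_lt_card.1 (not_le.1 hlt)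
    have far : ∀ x y, C x = c → C y = c → x ≠ y → ¬ CloseC5 (blowupC5Class x) (blowupC5Class y) :=
      fun x y hx hy hne h => C.valid ((blowupC5_adj x y).2 ⟨hne, h⟩) (hx.trans hy.symm)
    simp only [Finset.mem_filter, Finset.mem_univ, true_and] at hx hy hz
    have : ∀ a b, ¬ CloseC5 a b → ∀ c, ¬ CloseC5 a c → CloseC5 b c := by decide +kernel
    exact far y z hy hz hyz (this _ _ (far x y hx hy hxy) _ (far x z hx hz hxz))
  have := Finset.card_le_mul_card_image_of_maps_to (f := C) (s := Finset.univ)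
    (t := Finset.univ) (fun _ _ => Finset.mem_univ _) 2 hc
  simpa using this

theorem card_le_of_isClique_blowupC5 {t : Fin 5 → ℕ} {k : ℕ} (ht : ∀ i, t i + t (i + 1) ≤ k)
    {s : Finset ((Σ i : Fin 5, Fin (t i)) ⊕ Fin 0)} (hs : (blowupC5 t 0).IsClique s) :
    s.card ≤ k := by
  classical
  have key : ∀ S : Finset (Fin 5), (∀ a ∈ S, ∀ b ∈ S, CloseC5 a b) →
      ∃ i, ∀ a ∈ S, a = i ∨ a = i + 1 := by decide +kernel
  obtain ⟨i, hi⟩ := key (s.image blowupC5Class) (by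
    intro a ha b hb
    obtain ⟨x, hx, rfl⟩ := Finset.mem_image.1 ha
    obtain ⟨y, hy, rfl⟩ := Finset.mem_image.1 hb
    by_cases hxy : x = y
    · exact Or.inl (by rw [hxy])
    · exact ((blowupC5_adj x y).1 (hs hx hy hxy)).2)
  have hsub : s ⊆ (Finset.univ.filter fun x => blowupC5Class x = i) ∪
      (Finset.univ.filter fun x => blowupC5Class x = i + 1) := by
    intro x hx
    simpa using hi _ (Finset.mem_image_of_mem _ hx)
  refine (Finset.card_le_card hsub).trans ((Finset.card_union_le _ _).trans ?_)
  rw [card_filter_blowupC5Class, card_filter_blowupC5Class]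
  exact ht i

theorem exists_isNClique_blowupC5 (t : Fin 5 → ℕ) :
    ∃ s, (blowupC5 t 0).IsNClique (t 0 + t 1) s := by
  classical
  refine ⟨(Finset.univ.filter fun x => blowupC5Class x = 0) ∪
      (Finset.univ.filter fun x => blowupC5Class x = 1), ?_, ?_⟩
  · intro x hx y hy hxy
    simp only [Finset.coe_union, Finset.coe_filter, Finset.mem_univ, true_and, Set.mem_union,
      Set.mem_ofPred_eq] at hx hy
    refine (blowupC5_adj x y).2 ⟨hxy, ?_⟩
    rcases hx with hx | hx <;> rcases hy with hy | hy <;> rw [hx, hy] <;> decide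
  · rw [Finset.card_union_of_disjoint, card_filter_blowupC5Class, card_filter_blowupC5Class]
    rw [Finset.disjoint_filter]
    intro x _ h0 h1
    exact absurd (h0.symm.trans h1) (by decide)

theorem exists_max_of_four_le {k : ℕ} (hk : 4 ≤ k) :
    ∃ (V : Type) (_ : Fintype V) (G : SimpleGraph V), IsFreeOf G graphP2P3 ∧
      IsFreeOf G graphGem ∧ G.cliqueNum = k ∧ G.chromaticNumber = (phi k : ℕ∞) := by
  have hphi : phi k = k + (k + 2) / 4 := phi_eq_add hk (by omega) (by omega)
  obtain ⟨t, h0, ht, hsum⟩ : ∃ t : Fin 5 → ℕ, t 0 + t 1 = k ∧ (∀ i, t i + t (i + 1) ≤ k) ∧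
      2 * (k + (k + 2) / 4) ≤ ∑ i, t i + 1 := by
    refine ⟨![k - k / 2, k / 2, k - k / 2, k / 2, k / 2], ?_, ?_, ?_⟩
    · simp
      omega
    · intro i
      fin_cases i <;> simp <;> omega
    · simp [Fin.sum_univ_five]
      omega
  refine exists_max_of_not_colorable (G := blowupC5 t 0) (by omega)
    (isFreeOf_graphP2P3_of_closeC5 _ blowupC5_adj) (isFreeOf_graphGem_of_closeC5 _ blowupC5_adj)
    (h0 ▸ exists_isNClique_blowupC5 t) (fun s hs => ?_) (fun m hm => ?_)
  · have := card_le_of_isClique_blowupC5 ht hs.isClique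
    have := hs.card_eq
    omega
  · have := card_le_two_mul_of_colorable_blowupC5 hm
    omega

theorem exists_max {k : ℕ} (hk : 1 ≤ k) :
    ∃ (V : Type) (_ : Fintype V) (G : SimpleGraph V), IsFreeOf G graphP2P3 ∧
      IsFreeOf G graphGem ∧ G.cliqueNum = k ∧ G.chromaticNumber = (phi k : ℕ∞) := by
  rcases (by omega : k = 1 ∨ k = 2 ∨ k = 3 ∨ 4 ≤ k) with rfl | rfl | rfl | h4
  · have hphi : phi 1 = 1 := by simp [phi]
    refine exists_max_of_not_colorable (V := Fin 1) (G := ⊥) le_rfl ⟨fun φ => ?_⟩ ⟨fun φ => ?_⟩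
      ⟨{0}, by simp⟩ (fun s hs => ?_) (fun m hm => ?_)
    · exact absurd (φ.injective (Subsingleton.elim (φ 0) (φ 1))) (by decide)
    · exact absurd (φ.injective (Subsingleton.elim (φ 0) (φ 1))) (by decide)
    · have := Finset.card_le_univ s
      rw [hs.card_eq, Fintype.card_fin] at this
      omega
    · obtain ⟨C⟩ := hm
      have := Fin.pos (C 0)
      omega
  · have hphi : phi 2 = 4 := by simp [phi]
    refine exists_max_of_not_colorable (G := grotzschGraph) hk isFreeOf_graphP2P3_grotzschGraph
      (isFreeOf_of_common_nbr fun c q p r hcq hcp hqp _ _ =>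
        absurd hqp (not_adj_of_common_nbr_grotzschGraph c q hcq p hcp))
      ?_ cliqueFree_grotzschGraph (fun m hm => ?_)
    · have : ∃ u v, grotzschGraph.Adj u v := by decide +kernel
      obtain ⟨u, v, huv⟩ := this
      exact ⟨{u, v}, by simp [isNClique_iff, huv, huv.ne]⟩
    · by_contra hlt
      exact not_colorable_grotzschGraph (hm.mono (by omega))
  · have hphi : phi 3 = 6 := by simp [phi]
    refine exists_max_of_not_colorable (G := schlafliComplement) hk
      isFreeOf_graphP2P3_schlafliComplement
      (isFreeOf_of_common_nbr fun c q p r hcq hcp hqp hcr hqr =>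
        common_nbr_schlafliComplement c q hcq p hcp hqp r hcr hqr)
      ?_ cliqueFree_schlafliComplement (fun m hm => ?_)
    · have : ∃ u v, schlafliComplement.Adj u v ∧ ∃ w, schlafliComplement.Adj u w ∧
        schlafliComplement.Adj v w := by decide +kernel
      obtain ⟨u, v, huv, w, huw, hvw⟩ := this
      exact ⟨{u, v, w}, is3Clique_triple_iff.2 ⟨huv, huw, hvw⟩⟩
    · by_contra hlt
      exact not_colorable_schlafliComplement (hm.mono (by omega))
  · exact exists_max_of_four_le h4

/-- For every positive integer `k` there is a (P2+P3, gem)-free graph with clique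
number `k` and chromatic number `φ(k)`; consequently (together with the bound
`χ ≤ φ(ω)`), `φ` is the smallest χ-binding function for the class of
(P2+P3, gem)-free graphs. -/
theorem phi_is_smallest_chi_binding_function :
    (∀ k : ℕ, 1 ≤ k → ∃ (V : Type) (_ : Fintype V) (G : SimpleGraph V),
      IsFreeOf G graphP2P3 ∧ IsFreeOf G graphGem ∧
      G.cliqueNum = k ∧ G.chromaticNumber = (phi k : ℕ∞)) ∧
    (∀ (V : Type) (_ : Fintype V) (G : SimpleGraph V), Nonempty V →
      IsFreeOf G graphP2P3 → IsFreeOf G graphGem →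
      G.chromaticNumber ≤ (phi G.cliqueNum : ℕ∞)) := by
  exact ⟨fun _ hk => exists_max hk, fun _ _ G _ => chromaticNumber_le_phi_cliqueNum G⟩
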